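/- For every subset C of SB the following are equivalent: (i) there exists a separable Banach space Y which is universal for C (every member of C embeds isomorphically into Y) but is not universal for all separable Banach spaces; (ii) sup{φ_NU(X) : X ∈ C} < ω₁; (iii) there exists an analytic subset A of NU with C ⊆ A. -/

import Mathlib

open Filter Topology MeasureTheory

noncomputable section

/-! ### The Cantor set and the space `C(2^ℕ)` -/

/-- The Cantor set `2^ℕ`. -/
abbrev CantorSet : Type := ℕ → Bool

/-- The Banach space `C(2^ℕ)` of continuous real-valued functions on the Cantor set. -/
abbrev CantorC : Type := C(CantorSet, ℝ)

/-! ### The standard Borel space `SB` of separable Banach spaces -/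

/-- `SB`: the set of closed linear subspaces of `C(2^ℕ)`. -/
def SB : Type := {Y : Submodule ℝ CantorC // IsClosed (Y : Set CantorC)}

/-- The Effros-Borel σ-algebra on `SB`, generated by the sets
`{Y : Y ∩ U ≠ ∅}` for `U` open in `C(2^ℕ)`. -/
instance : MeasurableSpace SB :=
  MeasurableSpace.generateFrom
    {A : Set SB | ∃ U : Set CantorC, IsOpen U ∧ A = {Y : SB | ((Y.1 : Set CantorC) ∩ U).Nonempty}}

/-- A subset of a standard Borel space is analytic if it is the image of a Borel map
from the Baire space `ℕ^ℕ`. -/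
def IsAnalyticIn {α : Type*} [MeasurableSpace α] (A : Set α) : Prop :=
  ∃ f : (ℕ → ℕ) → α, Measurable f ∧ A = Set.range f

/-! ### Embeddings, isomorphisms, universality -/

/-- `X` embeds isomorphically into `Y`: there is a bounded linear map which is
bounded below, i.e. an isomorphism onto its range. -/
def Embeds (X Y : Type*) [SeminormedAddCommGroup X] [NormedSpace ℝ X]
    [SeminormedAddCommGroup Y] [NormedSpace ℝ Y] : Prop :=
  ∃ (T : X →L[ℝ] Y) (c : ℝ), 0 < c ∧ ∀ x : X, c * ‖x‖ ≤ ‖T x‖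

/-- `X` embeds isometrically into `Y` (i.e. `Y` contains an isometric copy of `X`). -/
def EmbedsIsometrically (X Y : Type*) [SeminormedAddCommGroup X] [NormedSpace ℝ X]
    [SeminormedAddCommGroup Y] [NormedSpace ℝ Y] : Prop :=
  Nonempty (X →ₗᵢ[ℝ] Y)

/-- `X` and `Y` are isomorphic Banach spaces (linearly homeomorphic). -/
def IsomorphicTo (X Y : Type*) [SeminormedAddCommGroup X] [NormedSpace ℝ X]
    [SeminormedAddCommGroup Y] [NormedSpace ℝ Y] : Prop :=
  Nonempty (X ≃L[ℝ] Y)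

/-- The class `NU ⊆ SB` of non-universal spaces: those `X ∈ SB` which do not contain
an isomorphic copy of `C(2^ℕ)` (equivalently, are not universal for all separable
Banach spaces). -/
def NU : Set SB := {Y : SB | ¬ Embeds CantorC Y.1}

/-- The class `NC_X ⊆ SB` of all `Y ∈ SB` containing no isomorphic copy of `X`. -/
def NCin (X : Type*) [SeminormedAddCommGroup X] [NormedSpace ℝ X] : Set SB :=
  {Y : SB | ¬ Embeds X Y.1}

/-! ### Schauder bases -/

/-- `x` is a Schauder basis of `E`: every vector has a unique representation as a
norm convergent series `Σ aₙ • xₙ`. -/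
def IsSchauderBasis {E : Type*} [SeminormedAddCommGroup E] [NormedSpace ℝ E]
    (x : ℕ → E) : Prop :=
  ∀ y : E, ∃! a : ℕ → ℝ,
    Tendsto (fun m => ∑ n ∈ Finset.range m, a n • x n) atTop (𝓝 y)

/-- `E` has a Schauder basis. -/
def HasSchauderBasis (E : Type*) [SeminormedAddCommGroup E] [NormedSpace ℝ E] : Prop :=
  ∃ x : ℕ → E, IsSchauderBasis x

/-- `x` is a monotone basis sequence: initial-segment projections have norm at most 1. -/
def IsMonotoneSeq {E : Type*} [SeminormedAddCommGroup E] [NormedSpace ℝ E]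
    (x : ℕ → E) : Prop :=
  ∀ (a : ℕ → ℝ) (k m : ℕ), k ≤ m →
    ‖∑ n ∈ Finset.range k, a n • x n‖ ≤ ‖∑ n ∈ Finset.range m, a n • x n‖

/-- `x` is a bi-monotone sequence: interval projections have norm at most 1. -/
def IsBimonotoneSeq {E : Type*} [SeminormedAddCommGroup E] [NormedSpace ℝ E]
    (x : ℕ → E) : Prop :=
  ∀ (a : ℕ → ℝ) (j k m : ℕ), j ≤ k → k ≤ m →
    ‖∑ n ∈ Finset.Ico j k, a n • x n‖ ≤ ‖∑ n ∈ Finset.range m, a n • x n‖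

/-- `x` is a Schauder basic sequence: it is a Schauder basis of its closed linear span. -/
def IsSchauderBasicSeq {E : Type*} [NormedAddCommGroup E] [NormedSpace ℝ E]
    (x : ℕ → E) : Prop :=
  ∀ y ∈ (Submodule.span ℝ (Set.range x)).topologicalClosure,
    ∃! a : ℕ → ℝ,
      Tendsto (fun m => ∑ n ∈ Finset.range m, a n • x n) atTop (𝓝 y)

/-! ### Trees, ordinal ranks and Bourgain's index -/

/-- A tree on `Λ`: a set of finite sequences closed under initial segments. -/
def IsTree {Λ : Type*} (T : Set (List Λ)) : Prop :=
  ∀ s t : List Λ, s <+: t → t ∈ T → s ∈ T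

/-- A pruned tree: every node has a proper extension in the tree. -/
def IsPruned {Λ : Type*} (T : Set (List Λ)) : Prop :=
  ∀ t ∈ T, ∃ a : Λ, t ++ [a] ∈ T

/-- `σ` is an infinite branch of `T`. -/
def IsBranch {Λ : Type*} (T : Set (List Λ)) (σ : ℕ → Λ) : Prop :=
  ∀ n : ℕ, (List.ofFn fun i : Fin n => σ i) ∈ T

/-- `T` is ill-founded: it has an infinite branch. -/
def TreeIllFounded {Λ : Type*} (T : Set (List Λ)) : Prop :=
  ∃ σ : ℕ → Λ, IsBranch T σ

/-- The derivative of a tree: its non-maximal nodes, i.e. nodes having a proper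
extension in the tree. -/
def treeDeriv {Λ : Type*} (T : Set (List Λ)) : Set (List Λ) :=
  {l | l ∈ T ∧ ∃ a : Λ, l ++ [a] ∈ T}

/-- The iterated derivatives `T^(ξ)` of a tree, defined by transfinite recursion. -/
def treeDerivIter {Λ : Type*} (T : Set (List Λ)) (ξ : Ordinal.{0}) : Set (List Λ) :=
  Ordinal.limitRecOn ξ T (fun _ S => treeDeriv S)
    (fun o _ ih => ⋂ (o' : Ordinal.{0}) (h : o' < o), ih o' h)

/-- The ordinal rank `o(T)` of a (well-founded) tree: the least `ξ` with `T^(ξ) = ∅`. -/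
def treeRank {Λ : Type*} (T : Set (List Λ)) : Ordinal.{0} :=
  sInf {ξ : Ordinal.{0} | treeDerivIter T ξ = ∅}

/-- The first uncountable ordinal `ω₁`. -/
def omega1 : Ordinal.{0} := (Cardinal.aleph 1).ord

/-- Bourgain's tree `T(Y, (e_n), δ)`: all finite sequences `(y_0, …, y_k)` in `Y`
which are `δ`-equivalent to `(e_0, …, e_k)`. -/
def bourgainTree {W : Type*} [SeminormedAddCommGroup W] [NormedSpace ℝ W] (e : ℕ → W)
    (δ : ℝ) (Y : Type*) [SeminormedAddCommGroup Y] [NormedSpace ℝ Y] : Set (List Y) :=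
  {l : List Y | ∀ a : ℕ → ℝ,
    δ * ‖∑ i ∈ Finset.range l.length, a i • e i‖ ≤
        ‖∑ i ∈ Finset.range l.length, a i • l.getD i 0‖ ∧
    ‖∑ i ∈ Finset.range l.length, a i • l.getD i 0‖ ≤
        δ⁻¹ * ‖∑ i ∈ Finset.range l.length, a i • e i‖}

open Classical in
/-- Bourgain's ordinal index of `Y` relative to a (normalized Schauder) basis `(e_n)`
of a space `W`: it equals `ω₁` if some tree `T(Y, (e_n), δ)` is ill-founded, and
otherwise `sup_{0 < δ ≤ 1} o(T(Y, (e_n), δ))`.  With `W = C(2^ℕ)` this is `φ_NU`,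
and with `W = Z` it is `φ_{NC_Z}`. -/
def bourgainIndex {W : Type*} [SeminormedAddCommGroup W] [NormedSpace ℝ W] (e : ℕ → W)
    (Y : Type*) [SeminormedAddCommGroup Y] [NormedSpace ℝ Y] : Ordinal.{0} :=
  if ∃ δ ∈ Set.Ioc (0:ℝ) 1, TreeIllFounded (bourgainTree e δ Y) then omega1
  else ⨆ δ : Set.Ioc (0:ℝ) 1, treeRank (bourgainTree e δ.1 Y)

/-! ### The Schur property and the Radon-Nikodym property -/

/-- `X` has the Schur property: weakly convergent sequences are norm convergent. -/
def HasSchurProperty (X : Type*) [SeminormedAddCommGroup X] [NormedSpace ℝ X] : Prop :=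
  ∀ (f : ℕ → X) (x : X),
    (∀ φ : X →L[ℝ] ℝ, Tendsto (fun n => φ (f n)) atTop (𝓝 (φ x))) →
    Tendsto f atTop (𝓝 x)

/-- `X` has the Radon-Nikodym property: on every finite measure space, every
`X`-valued vector measure of bounded variation which is absolutely continuous
with respect to the measure has a Bochner-integrable density. -/
def HasRNP (X : Type*) [NormedAddCommGroup X] [NormedSpace ℝ X] : Prop :=
  ∀ (Ω : Type) [MeasurableSpace Ω] (μ : Measure Ω), IsFiniteMeasure μ →
    ∀ τ : VectorMeasure Ω X,
      (∀ s : Set Ω, MeasurableSet s → μ s = 0 → τ s = 0) →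
      (∃ C : ℝ, ∀ P : Finset (Set Ω), (∀ s ∈ P, MeasurableSet s) →
        ((P : Set (Set Ω)).Pairwise fun s t => Disjoint s t) →
        ∑ s ∈ P, ‖τ s‖ ≤ C) →
      ∃ g : Ω → X, Integrable g μ ∧
        ∀ s : Set Ω, MeasurableSet s → τ s = ∫ x in s, g x ∂μ

/-! ### `𝓛_{∞,λ}`-spaces -/

/-- The Banach-Mazur distance from `G` to `ℓ∞^n` is at most `θ`, witnessed by an
isomorphism `e` with `‖e‖ ⬝ ‖e⁻¹‖ ≤ θ'` for every `θ' > θ`. -/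
def BMdistToLinftyLE (G : Type*) [SeminormedAddCommGroup G] [NormedSpace ℝ G]
    (n : ℕ) (θ : ℝ) : Prop :=
  ∀ θ' : ℝ, θ < θ' → ∃ e : G ≃L[ℝ] (Fin n → ℝ),
    ‖(e : G →L[ℝ] (Fin n → ℝ))‖ * ‖(e.symm : (Fin n → ℝ) →L[ℝ] G)‖ ≤ θ'

/-- `X` is an (infinite-dimensional) `𝓛_{∞,λ}`-space: every finite-dimensional subspace
`F` of `X` is contained in a finite-dimensional subspace `G` with `d(G, ℓ∞^(dim G)) ≤ λ`. -/
def IsLinftyLam (lam : ℝ) (X : Type*) [NormedAddCommGroup X] [NormedSpace ℝ X] : Prop :=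
  (¬ FiniteDimensional ℝ X) ∧
  ∀ F : Submodule ℝ X, FiniteDimensional ℝ F →
    ∃ G : Submodule ℝ X, F ≤ G ∧ FiniteDimensional ℝ G ∧
      BMdistToLinftyLE G (Module.finrank ℝ G) lam

/-- `X` is an `𝓛_{∞,λ+}`-space: it is an `𝓛_{∞,θ}`-space for every `θ > λ`. -/
def IsLinftyPlus (lam : ℝ) (X : Type*) [NormedAddCommGroup X] [NormedSpace ℝ X] : Prop :=
  ∀ θ : ℝ, lam < θ → IsLinftyLam θ X

/-! ### Minimal spaces and `ℓ₁` -/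

/-- The space `ℓ₁`. -/
abbrev EllOne : Type := lp (fun _ : ℕ => ℝ) 1

/-- `X` is a minimal Banach space: it is infinite-dimensional and embeds isomorphically
into every infinite-dimensional (closed) subspace of itself. -/
def IsMinimal (X : Type*) [NormedAddCommGroup X] [NormedSpace ℝ X] : Prop :=
  (¬ FiniteDimensional ℝ X) ∧
  ∀ Z : Submodule ℝ X, IsClosed (Z : Set X) → ¬ FiniteDimensional ℝ Z → Embeds X Z

end


theorem Embeds.trans' {X Y Z : Type*} [SeminormedAddCommGroup X] [NormedSpace ℝ X]
    [SeminormedAddCommGroup Y] [NormedSpace ℝ Y] [SeminormedAddCommGroup Z] [NormedSpace ℝ Z]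
    (h1 : Embeds X Y) (h2 : Embeds Y Z) : Embeds X Z := by
  obtain ⟨T, c, hc, hT⟩ := h1
  obtain ⟨U, d, hd, hU⟩ := h2
  refine ⟨U.comp T, d * c, by positivity, fun x => ?_⟩
  calc d * c * ‖x‖ = d * (c * ‖x‖) := by ring
    _ ≤ d * ‖T x‖ := by gcongr; exact hT x
    _ ≤ _ := hU _

/-- Extension of linear maps from a dense subspace, with bounds. -/
theorem exists_extend {V X Z : Type*} [AddCommGroup V] [Module ℝ V]
    [NormedAddCommGroup X] [NormedSpace ℝ X]
    [NormedAddCommGroup Z] [NormedSpace ℝ Z] [CompleteSpace Z]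
    (A : V →ₗ[ℝ] X) (hA : DenseRange A) (B : V →ₗ[ℝ] Z) (K : ℝ)
    (h : ∀ v, ‖B v‖ ≤ K * ‖A v‖) :
    ∃ T : X →L[ℝ] Z, (∀ v, T (A v) = B v) ∧ ∀ x, ‖T x‖ ≤ K * ‖x‖ :=
  ⟨B.extendOfNorm A, fun v => LinearMap.extendOfNorm_eq hA ⟨K, h⟩ v,
    fun x => LinearMap.norm_extendOfNorm_apply_le hA K h x⟩

theorem embeds_of_dense {V X Z : Type*} [AddCommGroup V] [Module ℝ V]
    [NormedAddCommGroup X] [NormedSpace ℝ X]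
    [NormedAddCommGroup Z] [NormedSpace ℝ Z] [CompleteSpace Z]
    (A : V →ₗ[ℝ] X) (hA : DenseRange A) (B : V →ₗ[ℝ] Z) (c K : ℝ) (hc : 0 < c)
    (h : ∀ v, ‖B v‖ ≤ K * ‖A v‖) (h' : ∀ v, c * ‖A v‖ ≤ ‖B v‖) : Embeds X Z := by
  obtain ⟨T, hT, -⟩ := exists_extend A hA B K h
  refine ⟨T, c, hc, fun x => ?_⟩
  refine isClosed_property hA (p := fun x => c * ‖x‖ ≤ ‖T x‖)
    (isClosed_le (by fun_prop) (by fun_prop)) (fun v => ?_) x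
  rw [hT]; exact h' v

/-- Extension of seminorms from a dense subspace. -/
theorem exists_seminorm_extend {V X : Type*} [AddCommGroup V] [Module ℝ V]
    [NormedAddCommGroup X] [NormedSpace ℝ X]
    (A : V →ₗ[ℝ] X) (hA : DenseRange A) (p : Seminorm ℝ V) (K : ℝ)
    (h : ∀ v, p v ≤ K * ‖A v‖) :
    ∃ q : Seminorm ℝ X, (∀ v, q (A v) = p v) ∧ (∀ x, q x ≤ K * ‖x‖) := by
  by_cases hK : K < 0
  · have h0 : ∀ v, A v = 0 := fun v => by
      by_contra hv
      have := norm_pos_iff.2 hv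
      have h1 := h v
      have h2 := apply_nonneg p v
      nlinarith
    refine ⟨0, fun v => ?_, fun x => ?_⟩
    · have := h v
      rw [h0] at this ⊢
      have h2 := apply_nonneg p v
      simp only [norm_zero, mul_zero] at this ⊢
      simp; linarith
    · have hx : x ∈ closure (Set.range A) := hA x
      have : Set.range A ⊆ {0} := by rintro _ ⟨v, rfl⟩; simp [h0]
      have : x ∈ closure ({0} : Set X) := closure_mono this hx
      simp at this
      simp [this]
  push Not at hK
  have key : ∀ x (v : V), 0 ≤ p v + K * ‖x - A v‖ := fun x v => by positivity
  have bdd : ∀ x, BddBelow (Set.range fun v : V => p v + K * ‖x - A v‖) := fun x =>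
    ⟨0, by rintro _ ⟨v, rfl⟩; exact key x v⟩
  let f : X → ℝ := fun x => ⨅ v : V, (p v + K * ‖x - A v‖)
  have f0 : f 0 = 0 := by
    apply le_antisymm
    · refine (ciInf_le (bdd 0) 0).trans ?_
      simp
    · exact le_ciInf fun v => key 0 v
  have fadd : ∀ x y, f (x + y) ≤ f x + f y := by
    intro x y
    refine le_ciInf_add_ciInf fun v w => ?_
    refine (ciInf_le (bdd _) (v + w)).trans ?_
    have h1 := map_add_le_add p v w
    have h2 : ‖x + y - A (v + w)‖ ≤ ‖x - A v‖ + ‖y - A w‖ := by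
      rw [map_add, add_sub_add_comm]; exact norm_add_le _ _
    nlinarith
  have fsmul : ∀ (r : ℝ) x, f (r • x) ≤ ‖r‖ * f x := by
    intro r x
    rw [Real.mul_iInf_of_nonneg (norm_nonneg r)]
    refine le_ciInf fun v => ?_
    refine (ciInf_le (bdd _) (r • v)).trans ?_
    rw [map_smul_eq_mul, map_smul, ← smul_sub, norm_smul]
    apply le_of_eq; ring
  refine ⟨Seminorm.ofSMulLE f f0 fadd fsmul, fun v => ?_, fun x => ?_⟩
  · change f (A v) = p v
    apply le_antisymm
    · refine (ciInf_le (bdd _) v).trans ?_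
      simp
    · refine le_ciInf fun w => ?_
      have h1 := h (v - w)
      rw [map_sub A] at h1
      have h2 : p v ≤ p w + p (v - w) := by
        have := map_add_le_add p w (v - w); simpa using this
      linarith
  · change f x ≤ _
    refine (ciInf_le (bdd _) 0).trans ?_
    simp

theorem seminorm_continuous {X : Type*} [NormedAddCommGroup X] [NormedSpace ℝ X]
    (q : Seminorm ℝ X) (K : ℝ) (h : ∀ x, q x ≤ K * ‖x‖) : Continuous q := by
  have : LipschitzWith (Real.toNNReal K) q := by
    refine LipschitzWith.of_le_add_mul _ fun x y => ?_
    have h1 : q x ≤ q y + q (x - y) := by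
      have := map_add_le_add q y (x - y); simpa using this
    have h2 := h (x - y)
    have h3 : K ≤ (Real.toNNReal K : ℝ) := Real.le_coe_toNNReal K
    rw [dist_eq_norm]
    have := norm_nonneg (x - y)
    nlinarith
  exact this.continuous

/-- The closed linear span of a sequence. -/
noncomputable def Xspan {X : Type*} [NormedAddCommGroup X] [NormedSpace ℝ X] (x : ℕ → X) :
    Submodule ℝ X :=
  (Submodule.span ℝ (Set.range x)).topologicalClosure

theorem isClosed_Xspan {X : Type*} [NormedAddCommGroup X] [NormedSpace ℝ X] (x : ℕ → X) :
    IsClosed (Xspan x : Set X) := Submodule.isClosed_topologicalClosure _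

theorem mem_Xspan {X : Type*} [NormedAddCommGroup X] [NormedSpace ℝ X] (x : ℕ → X) (n : ℕ) :
    x n ∈ Xspan x := Submodule.le_topologicalClosure _ (Submodule.subset_span ⟨n, rfl⟩)

/-- linear combinations, as a map into the closed span -/
noncomputable def Xmap {X : Type*} [NormedAddCommGroup X] [NormedSpace ℝ X] (x : ℕ → X) :
    (ℕ →₀ ℝ) →ₗ[ℝ] Xspan x :=
  (Finsupp.linearCombination ℝ x).codRestrict (Xspan x) (fun a => by
    apply Submodule.le_topologicalClosure
    rw [← Finsupp.range_linearCombination]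
    exact ⟨a, rfl⟩)

theorem Xmap_coe {X : Type*} [NormedAddCommGroup X] [NormedSpace ℝ X] (x : ℕ → X) (a : ℕ →₀ ℝ) :
    (Xmap x a : X) = Finsupp.linearCombination ℝ x a := rfl

theorem denseRange_Xmap {X : Type*} [NormedAddCommGroup X] [NormedSpace ℝ X] (x : ℕ → X) :
    DenseRange (Xmap x) := by
  intro y
  have hy : (y : X) ∈ closure ((Submodule.span ℝ (Set.range x) : Submodule ℝ X) : Set X) := y.2
  rw [closure_subtype]
  convert! hy using 2
  ext z
  rw [← Finsupp.range_linearCombination]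
  constructor
  · rintro ⟨_, ⟨a, rfl⟩, rfl⟩
    exact ⟨a, rfl⟩
  · rintro ⟨a, rfl⟩
    exact ⟨_, ⟨a, rfl⟩, rfl⟩

theorem embeds_Xspan {X Z : Type*} [NormedAddCommGroup X] [NormedSpace ℝ X]
    [NormedAddCommGroup Z] [NormedSpace ℝ Z] [CompleteSpace Z] (x : ℕ → X)
    (B : (ℕ →₀ ℝ) →ₗ[ℝ] Z) (c K : ℝ) (hc : 0 < c)
    (h : ∀ a, ‖B a‖ ≤ K * ‖Finsupp.linearCombination ℝ x a‖)
    (h' : ∀ a, c * ‖Finsupp.linearCombination ℝ x a‖ ≤ ‖B a‖) : Embeds (Xspan x) Z :=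
  embeds_of_dense (Xmap x) (denseRange_Xmap x) B c K hc h h'

/-! ### Cylinders and step functions on the Cantor set -/

/-- The word of the first `n` letters, newest letter first. -/
def pre (x : CantorSet) : ℕ → List Bool
  | 0 => []
  | n + 1 => x n :: pre x n

theorem pre_length (x : CantorSet) (n : ℕ) : (pre x n).length = n := by
  induction n with
  | zero => rfl
  | succ n ih => simp [pre, ih]

theorem pre_congr {x y : CantorSet} {n : ℕ} (h : ∀ i < n, x i = y i) : pre x n = pre y n := by
  induction n with
  | zero => rfl
  | succ n ih => simp only [pre]; rw [ih (fun i hi => h i (by omega)), h n (by omega)]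

theorem pre_inj {x y : CantorSet} {n : ℕ} (h : pre x n = pre y n) : ∀ i < n, x i = y i := by
  induction n with
  | zero => intro i hi; omega
  | succ n ih =>
    simp only [pre, List.cons.injEq] at h
    intro i hi
    rcases Nat.lt_succ_iff_lt_or_eq.1 hi with h1 | rfl
    · exact ih h.2 i h1
    · exact h.1

theorem isLocallyConstant_pre (n : ℕ) : IsLocallyConstant (fun x : CantorSet => pre x n) := by
  induction n with
  | zero => exact IsLocallyConstant.const _
  | succ n ih =>
    have h1 : IsLocallyConstant (fun x : CantorSet => x n) :=
      (IsLocallyConstant.iff_continuous _).2 (continuous_apply n)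
    exact (h1.prodMk ih).comp (fun p : Bool × List Bool => p.1 :: p.2)

/-- The canonical point of the cylinder of the word `w`. -/
def pt : List Bool → CantorSet
  | [] => fun _ => false
  | b :: w => Function.update (pt w) w.length b

theorem pre_pt (w : List Bool) : pre (pt w) w.length = w := by
  induction w with
  | nil => rfl
  | cons b w ih =>
    simp only [List.length_cons, pre, pt]
    rw [Function.update_self]
    congr 1
    conv_rhs => rw [← ih]
    apply pre_congr
    intro i hi
    rw [Function.update_of_ne (by omega)]

noncomputable section

/-- Truncation. -/
def trunc (n : ℕ) (x : CantorSet) : CantorSet := fun i => if i < n then x i else false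

theorem continuous_trunc (n : ℕ) : Continuous (trunc n) := by
  unfold trunc
  refine continuous_pi fun i => ?_
  split_ifs
  · exact continuous_apply i
  · exact continuous_const

theorem trunc_trunc (k m : ℕ) (x : CantorSet) : trunc k (trunc m x) = trunc (min k m) x := by
  ext i
  simp only [trunc, lt_min_iff]
  split_ifs <;> simp_all

theorem pre_trunc (n : ℕ) (x : CantorSet) : pre (trunc n x) n = pre x n :=
  pre_congr fun i hi => by simp [trunc, hi]

/-- The conditional projections `f ↦ f ∘ trunc m`. -/
def QQ (m : ℕ) : CantorC →L[ℝ] CantorC :=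
  LinearMap.mkContinuous
    { toFun := fun f => f.comp ⟨trunc m, continuous_trunc m⟩
      map_add' := fun f g => by ext; rfl
      map_smul' := fun c f => by ext; rfl } 1 (fun f => by
        rw [one_mul, ContinuousMap.norm_le _ (norm_nonneg _)]
        intro x; exact f.norm_coe_le_norm _)

theorem QQ_apply (m : ℕ) (f : CantorC) (x : CantorSet) : QQ m f x = f (trunc m x) := rfl

theorem norm_QQ_le (m : ℕ) (f : CantorC) : ‖QQ m f‖ ≤ ‖f‖ := by
  rw [ContinuousMap.norm_le _ (norm_nonneg _)]
  intro x; exact f.norm_coe_le_norm _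

theorem QQ_QQ (k m : ℕ) (f : CantorC) : QQ k (QQ m f) = QQ (min k m) f := by
  ext x
  simp only [QQ_apply, trunc_trunc, min_comm]

theorem QQ_of_le {k m : ℕ} (h : k ≤ m) {f : CantorC} (hf : QQ k f = f) : QQ m f = f := by
  rw [← hf, QQ_QQ, min_eq_right h]

theorem tendsto_QQ (f : CantorC) : Tendsto (fun n => QQ n f) atTop (𝓝 f) := by
  rw [ContinuousMap.tendsto_iff_tendstoUniformly]
  have h1 : TendstoUniformly (fun n x => trunc n x) (fun x => x) atTop := by
    rw [tendstoUniformly_iff_tendsto, Pi.uniformity, tendsto_iInf]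
    intro i
    rw [tendsto_comap_iff]
    refine Tendsto.congr' (f₁ := fun p : ℕ × CantorSet => (p.2 i, p.2 i)) ?_ ?_
    · have : ∀ᶠ p : ℕ × CantorSet in atTop ×ˢ ⊤, i < p.1 :=
        (eventually_gt_atTop i).prod_inl _
      filter_upwards [this] with p hp
      simp [trunc, hp]
    · intro s hs
      exact Filter.mem_map.2 (Filter.univ_mem' fun p => mem_uniformity_of_eq hs rfl)
  have h2 : UniformContinuous f := CompactSpace.uniformContinuous_of_continuous f.continuous
  exact h2.comp_tendstoUniformly h1

theorem isLocallyConstant_QQ (n : ℕ) (f : CantorC) : IsLocallyConstant (QQ n f) := by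
  have h : (QQ n f : CantorSet → ℝ) = (fun w => f (trunc n (pt w))) ∘ (fun x => pre x n) := by
    ext x
    simp only [QQ_apply, Function.comp]
    congr 1
    have := pre_pt (pre x n)
    rw [pre_length] at this
    have := pre_inj this
    ext i
    simp only [trunc]
    split_ifs with hi
    · rw [this i hi]
    · rfl
  rw [h]
  exact (isLocallyConstant_pre n).comp _

/-- Indicators of cylinders. -/
def chi (w : List Bool) : CantorC :=
  ⟨fun x => if pre x w.length = w then 1 else 0,
    ((isLocallyConstant_pre w.length).comp (fun v => if v = w then (1 : ℝ) else 0)).continuous⟩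

theorem chi_apply (w : List Bool) (x : CantorSet) :
    chi w x = if pre x w.length = w then 1 else 0 := rfl

theorem chi_nil : chi [] = 1 := by ext x; simp [chi_apply, pre]

theorem chi_split (w : List Bool) : chi w = chi (false :: w) + chi (true :: w) := by
  ext x
  simp only [chi_apply, ContinuousMap.add_apply, List.length_cons, pre, List.cons.injEq]
  cases x w.length <;> simp

/-- All words of length `n`. -/
def words : ℕ → Finset (List Bool)
  | 0 => {[]}
  | n + 1 => (words n).image (List.cons false) ∪ (words n).image (List.cons true)

theorem mem_words {n : ℕ} {w : List Bool} : w ∈ words n ↔ w.length = n := by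
  induction n generalizing w with
  | zero => simp [words]
  | succ n ih =>
    simp only [words, Finset.mem_union, Finset.mem_image, ih]
    constructor
    · rintro (⟨v, hv, rfl⟩ | ⟨v, hv, rfl⟩) <;> simp [hv]
    · intro h
      match w, h with
      | false :: w, h => left; exact ⟨w, by simpa using h, rfl⟩
      | true :: w, h => right; exact ⟨w, by simpa using h, rfl⟩

theorem sum_words_succ {Z : Type*} [AddCommMonoid Z] (n : ℕ) (F : List Bool → Z) :
    ∑ w ∈ words (n + 1), F w = ∑ w ∈ words n, (F (false :: w) + F (true :: w)) := by
  rw [words, Finset.sum_union, Finset.sum_image (by simp), Finset.sum_image (by simp),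
    Finset.sum_add_distrib]
  rw [Finset.disjoint_left]
  intro w hw hw'
  simp only [Finset.mem_image] at hw hw'
  obtain ⟨a, _, rfl⟩ := hw
  obtain ⟨b, _, hb⟩ := hw'
  simp at hb

theorem card_words (n : ℕ) : (words n).card = 2 ^ n := by
  induction n with
  | zero => simp [words]
  | succ n ih =>
    rw [Finset.card_eq_sum_ones, sum_words_succ, Finset.sum_const, ih]
    simp [pow_succ]

theorem sum_chi_apply (n : ℕ) (a : List Bool → ℝ) (x : CantorSet) :
    (∑ w ∈ words n, a w • chi w) x = a (pre x n) := by
  rw [ContinuousMap.sum_apply]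
  rw [Finset.sum_eq_single (pre x n)]
  · simp [chi_apply, pre_length]
  · intro b hb hne
    rw [mem_words] at hb
    simp [chi_apply, hb, Ne.symm hne]
  · intro h
    exact absurd (mem_words.2 (pre_length x n)) h

theorem abs_le_norm_sum_chi (n : ℕ) (a : List Bool → ℝ) (w : List Bool) (hw : w ∈ words n) :
    |a w| ≤ ‖∑ w ∈ words n, a w • chi w‖ := by
  have h := (∑ w ∈ words n, a w • chi w).norm_coe_le_norm (pt w)
  rw [sum_chi_apply] at h
  rw [mem_words] at hw
  subst hw
  rwa [pre_pt] at h

theorem QQ_eq_sum (n : ℕ) (f : CantorC) :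
    QQ n f = ∑ w ∈ words n, f (trunc n (pt w)) • chi w := by
  ext x
  rw [sum_chi_apply n (fun w => f (trunc n (pt w))), QQ_apply]
  congr 1
  have := pre_pt (pre x n)
  rw [pre_length] at this
  have := pre_inj this
  ext i
  simp only [trunc]
  split_ifs with hi
  · rw [this i hi]
  · rfl

/-- simultaneous refinement of linear combinations of additive systems -/
theorem refine_system {Z₁ Z₂ : Type*} [AddCommGroup Z₁] [Module ℝ Z₁] [AddCommGroup Z₂]
    [Module ℝ Z₂] (g₁ : List Bool → Z₁) (g₂ : List Bool → Z₂)
    (h₁ : ∀ w, g₁ w = g₁ (false :: w) + g₁ (true :: w))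
    (h₂ : ∀ w, g₂ w = g₂ (false :: w) + g₂ (true :: w)) (v : List Bool →₀ ℝ) :
    ∃ (n : ℕ) (a : List Bool → ℝ),
      Finsupp.linearCombination ℝ g₁ v = ∑ w ∈ words n, a w • g₁ w ∧
      Finsupp.linearCombination ℝ g₂ v = ∑ w ∈ words n, a w • g₂ w := by
  suffices H : ∃ n₀, ∀ n ≥ n₀, ∃ (a : List Bool → ℝ),
      Finsupp.linearCombination ℝ g₁ v = ∑ w ∈ words n, a w • g₁ w ∧
      Finsupp.linearCombination ℝ g₂ v = ∑ w ∈ words n, a w • g₂ w by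
    obtain ⟨n, hn⟩ := H
    exact ⟨n, hn n le_rfl⟩
  induction v using Finsupp.induction_linear with
  | zero => exact ⟨0, fun n _ => ⟨0, by simp, by simp⟩⟩
  | add f g hf hg =>
    obtain ⟨n, hn⟩ := hf
    obtain ⟨m, hm⟩ := hg
    refine ⟨max n m, fun k hk => ?_⟩
    obtain ⟨a, ha, ha'⟩ := hn k (le_trans (le_max_left _ _) hk)
    obtain ⟨b, hb, hb'⟩ := hm k (le_trans (le_max_right _ _) hk)
    refine ⟨a + b, ?_, ?_⟩
    · simp [add_smul, Finset.sum_add_distrib, ha, hb]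
    · simp [add_smul, Finset.sum_add_distrib, ha', hb']
  | single u c =>
    refine ⟨u.length, fun n hn => ?_⟩
    induction n, hn using Nat.le_induction with
    | base =>
      refine ⟨fun w => if w = u then c else 0, ?_, ?_⟩ <;>
      · rw [Finset.sum_eq_single u]
        · simp
        · intro b _ hb; simp [hb]
        · intro h; exact absurd (mem_words.2 rfl) h
    | succ n hn ih =>
      obtain ⟨a, ha, ha'⟩ := ih
      refine ⟨fun w => a w.tail, ?_, ?_⟩
      · rw [ha, sum_words_succ]
        refine Finset.sum_congr rfl fun w _ => ?_
        rw [h₁ w]; simp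
      · rw [ha', sum_words_succ]
        refine Finset.sum_congr rfl fun w _ => ?_
        rw [h₂ w]; simp

theorem denseRange_chi : DenseRange (Finsupp.linearCombination ℝ chi) := by
  intro f
  refine mem_closure_of_tendsto (tendsto_QQ f) (Eventually.of_forall fun n => ?_)
  rw [QQ_eq_sum]
  refine ⟨∑ w ∈ words n, Finsupp.single w (f (trunc n (pt w))), ?_⟩
  simp [map_sum]

theorem exists_system_op {Z : Type*} [NormedAddCommGroup Z] [NormedSpace ℝ Z] [CompleteSpace Z]
    (g : List Bool → Z) (hg : ∀ w, g w = g (false :: w) + g (true :: w)) (K : ℝ)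
    (hK : ∀ n (a : List Bool → ℝ) (M : ℝ), (∀ w ∈ words n, |a w| ≤ M) →
      ‖∑ w ∈ words n, a w • g w‖ ≤ K * M) :
    ∃ T : CantorC →L[ℝ] Z, (∀ w, T (chi w) = g w) ∧ ∀ f, ‖T f‖ ≤ K * ‖f‖ := by
  obtain ⟨T, hT, hT'⟩ := exists_extend (Finsupp.linearCombination ℝ chi) denseRange_chi
    (Finsupp.linearCombination ℝ g) K (fun v => by
      obtain ⟨n, a, h1, h2⟩ := refine_system chi g chi_split hg v
      rw [h1, h2]
      exact hK n a _ (abs_le_norm_sum_chi n a))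
  refine ⟨T, fun w => ?_, hT'⟩
  have := hT (Finsupp.single w 1)
  simpa using this

/-- to check a closed property of functions it suffices to look at step functions -/
theorem step_induction {P : CantorC → Prop} (hP : IsClosed {f | P f})
    (h : ∀ n (a : List Bool → ℝ), P (∑ w ∈ words n, a w • chi w)) (f : CantorC) : P f := by
  have := mem_closure_of_tendsto (tendsto_QQ f) (s := {f | P f}) (Eventually.of_forall fun n => by
    change P _
    rw [QQ_eq_sum]
    exact h n (fun w => f (trunc n (pt w))))
  rwa [hP.closure_eq] at this

theorem loc_induction {P : CantorC → Prop} (hP : IsClosed {f | P f})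
    (h : ∀ f : CantorC, IsLocallyConstant f → P f) (f : CantorC) : P f := by
  have := mem_closure_of_tendsto (tendsto_QQ f) (s := {f | P f}) (Eventually.of_forall fun n => by
    change P _
    exact h _ (isLocallyConstant_QQ n f))
  rwa [hP.closure_eq] at this

/-- Haar functions -/
def haar (w : List Bool) : CantorC := chi (false :: w) - chi (true :: w)

theorem norm_step_le (n : ℕ) (a : List Bool → ℝ) (M : ℝ) (hM : 0 ≤ M)
    (h : ∀ w ∈ words n, |a w| ≤ M) : ‖∑ w ∈ words n, a w • chi w‖ ≤ M := by
  rw [ContinuousMap.norm_le _ hM]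
  intro x
  rw [sum_chi_apply]
  exact h _ (mem_words.2 (pre_length x n))

theorem norm_haar_le (w : List Bool) : ‖haar w‖ ≤ 1 := by
  rw [ContinuousMap.norm_le _ zero_le_one]
  intro x
  simp only [haar, ContinuousMap.sub_apply, chi_apply]
  split_ifs with h1 h2
  · rw [List.length_cons] at h1 h2
    rw [h1] at h2
    simp at h2
  all_goals simp

theorem seminorm_sum_le {Z ι : Type*} [AddCommGroup Z] [Module ℝ Z] (q : Seminorm ℝ Z)
    (s : Finset ι) (f : ι → Z) : q (∑ i ∈ s, f i) ≤ ∑ i ∈ s, q (f i) :=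
  Finset.le_sum_of_subadditive q (map_zero q).le (map_add_le_add q) s f

/-- **Lemma H**: estimating a dyadic system by its Haar parts. -/
theorem haar_bound {Z : Type*} [AddCommGroup Z] [Module ℝ Z] (q : Seminorm ℝ Z)
    (g j : List Bool → Z) (h0 : ∀ w, g (false :: w) = (1 / 2 : ℝ) • (g w + j w))
    (h1 : ∀ w, g (true :: w) = (1 / 2 : ℝ) • (g w - j w)) (ε : ℝ) (hε : 0 ≤ ε)
    (hg : q (g []) ≤ ε) (hj : ∀ w, q (j w) ≤ ε * (1 / 4) ^ (w.length + 1))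
    (n : ℕ) (a : List Bool → ℝ) (M : ℝ) (hM : 0 ≤ M) (ha : ∀ w ∈ words n, |a w| ≤ M) :
    q (∑ w ∈ words n, a w • g w) ≤ 2 * ε * M := by
  suffices H : q (∑ w ∈ words n, a w • g w) ≤ (2 - (1 / 2) ^ n) * ε * M by
    refine H.trans ?_
    gcongr
    have : (0 : ℝ) ≤ (1 / 2) ^ n := by positivity
    linarith
  induction n generalizing a with
  | zero =>
    simp only [words, Finset.sum_singleton, pow_zero]
    rw [map_smul_eq_mul]
    have := ha [] (by simp [words])
    rw [Real.norm_eq_abs]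
    calc |a []| * q (g []) ≤ M * ε := by gcongr
      _ = _ := by ring
  | succ n ih =>
    rw [sum_words_succ]
    have e1 : ∑ w ∈ words n, (a (false :: w) • g (false :: w) + a (true :: w) • g (true :: w))
        = ∑ w ∈ words n, ((a (false :: w) + a (true :: w)) / 2) • g w
          + ∑ w ∈ words n, ((a (false :: w) - a (true :: w)) / 2) • j w := by
      rw [← Finset.sum_add_distrib]
      refine Finset.sum_congr rfl fun w _ => ?_
      rw [h0, h1]
      module
    rw [e1]
    refine (map_add_le_add q _ _).trans ?_
    have ha0 : ∀ w ∈ words n, |a (false :: w)| ≤ M ∧ |a (true :: w)| ≤ M := fun w hw =>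
      ⟨ha _ (by rw [mem_words] at *; simp [hw]), ha _ (by rw [mem_words] at *; simp [hw])⟩
    have b1 := ih (fun w => (a (false :: w) + a (true :: w)) / 2) (fun w hw => by
      have := ha0 w hw
      rw [abs_le] at *
      rw [abs_le] at this
      constructor <;> linarith)
    have b2 : q (∑ w ∈ words n, ((a (false :: w) - a (true :: w)) / 2) • j w)
        ≤ (1 / 2) ^ (n + 1) * ε * M := by
      have : q (∑ w ∈ words n, ((a (false :: w) - a (true :: w)) / 2) • j w)
          ≤ ∑ w ∈ words n, M * (ε * (1 / 4) ^ (n + 1)) := by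
        refine (seminorm_sum_le q _ _).trans ?_
        refine Finset.sum_le_sum fun w hw => ?_
        rw [map_smul_eq_mul]
        have h2 := hj w
        rw [mem_words.1 hw] at h2
        gcongr
        have := ha0 w hw
        rw [Real.norm_eq_abs]
        rw [abs_le] at *
        rw [abs_le] at this
        constructor <;> linarith
      refine this.trans ?_
      rw [Finset.sum_const, card_words, nsmul_eq_mul]
      push_cast
      have e2 : (2 : ℝ) ^ n * (M * (ε * (1 / 4) ^ (n + 1)))
          = (2 ^ n * (1 / 2) ^ n) * (1/2) * ((1 / 2) ^ (n + 1) * ε * M) := by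
        rw [show (1 / 4 : ℝ) = (1 / 2) * (1 / 2) by norm_num, mul_pow]
        ring
      rw [e2, ← mul_pow]
      have : 0 ≤ (1 / 2 : ℝ) ^ (n + 1) * ε * M := by positivity
      norm_num
      norm_num at this
      linarith
    have e3 : ((1 : ℝ) / 2) ^ n = 2 * (1 / 2) ^ (n + 1) := by rw [pow_succ]; ring
    rw [e3] at b1
    nlinarith

end

noncomputable section

/-- Isometric copies of `C(2^ℕ)` inside itself. -/
abbrev Copy := CantorC →ₗᵢ[ℝ] CantorC

/-- forget the first `n` letters -/
def shiftC (n : ℕ) (x : CantorSet) : CantorSet := fun i => x (i + n)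

theorem continuous_shiftC (n : ℕ) : Continuous (shiftC n) :=
  continuous_pi fun i => continuous_apply (i + n)

/-- put the word `u` in front -/
def glue (u : List Bool) (y : CantorSet) : CantorSet :=
  fun i => if i < u.length then pt u i else y (i - u.length)

theorem pre_glue (u : List Bool) (y : CantorSet) : pre (glue u y) u.length = u := by
  conv_rhs => rw [← pre_pt u]
  exact pre_congr fun i hi => by simp [glue, hi]

theorem shift_glue (u : List Bool) (y : CantorSet) : shiftC u.length (glue u y) = y := by
  ext i; simp [shiftC, glue]

/-- transplant a function onto a cylinder -/
def trf (u : List Bool) (f : CantorC) : CantorC :=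
  chi u * f.comp ⟨shiftC u.length, continuous_shiftC _⟩

theorem trf_apply (u : List Bool) (f : CantorC) (x : CantorSet) :
    trf u f x = if pre x u.length = u then f (shiftC u.length x) else 0 := by
  simp only [trf, ContinuousMap.mul_apply, chi_apply, ContinuousMap.comp_apply,
    ContinuousMap.coe_mk]
  split_ifs <;> simp

theorem trf_glue (u : List Bool) (f : CantorC) (y : CantorSet) : trf u f (glue u y) = f y := by
  rw [trf_apply, if_pos (pre_glue u y), shift_glue]

/-- transplanting as a linear isometry -/
def tr (u : List Bool) : Copy where
  toFun := trf u
  map_add' := fun f g => by ext x; simp only [trf_apply, ContinuousMap.add_apply]; split_ifs <;> simp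
  map_smul' := fun c f => by ext x; simp [trf_apply]
  norm_map' := fun f => by
    change ‖trf u f‖ = ‖f‖
    apply le_antisymm
    · rw [ContinuousMap.norm_le _ (norm_nonneg _)]
      intro x
      rw [trf_apply]
      split_ifs
      · exact f.norm_coe_le_norm _
      · simp
    · rw [ContinuousMap.norm_le _ (norm_nonneg _)]
      intro x
      rw [← trf_glue u f x]
      exact (trf u f).norm_coe_le_norm _

theorem tr_apply (u : List Bool) (f : CantorC) (x : CantorSet) :
    tr u f x = if pre x u.length = u then f (shiftC u.length x) else 0 := trf_apply u f x

theorem tr_glue (u : List Bool) (f : CantorC) (y : CantorSet) : tr u f (glue u y) = f y :=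
  trf_glue u f y

theorem norm_tr_add_le (v : List Bool) (f g : CantorC) (M : ℝ) (hf : ‖f‖ ≤ M) (hg : ‖g‖ ≤ M) :
    ‖tr (false :: v) f + tr (true :: v) g‖ ≤ M := by
  rw [ContinuousMap.norm_le _ ((norm_nonneg f).trans hf)]
  intro x
  rw [ContinuousMap.add_apply, tr_apply, tr_apply]
  split_ifs with h1 h2 h2
  · simp only [List.length_cons] at h1 h2
    rw [h1] at h2
    simp at h2
  · rw [add_zero]; exact (f.norm_coe_le_norm _).trans hf
  · rw [zero_add]; exact (g.norm_coe_le_norm _).trans hg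
  · simpa using (norm_nonneg f).trans hf

/-- the left half -/
def LH : Copy := tr [false]
/-- the right half -/
def RH : Copy := tr [true]

theorem norm_LH_RH (f g : CantorC) (M : ℝ) (hf : ‖f‖ ≤ M) (hg : ‖g‖ ≤ M) :
    ‖LH f + RH g‖ ≤ M := norm_tr_add_le [] f g M hf hg

theorem norm_chain_le (Kc J' : ℕ → Copy) (hK : ∀ n f, Kc (n + 1) f = Kc n (RH (J' n f)))
    (h : ℕ → CantorC) (M : ℝ) (hM : 0 ≤ M) (hh : ∀ n, ‖h n‖ ≤ M) (m : ℕ) :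
    ‖∑ i ∈ Finset.range m, Kc i (LH (h i))‖ ≤ M := by
  have key : ∀ m k, ∃ g : CantorC, ‖g‖ ≤ M ∧
      ∑ i ∈ Finset.range m, Kc (k + i) (LH (h (k + i))) = Kc k g := by
    intro m
    induction m with
    | zero => intro k; exact ⟨0, by simpa using hM, by simp⟩
    | succ m ih =>
      intro k
      obtain ⟨g, hg, hg'⟩ := ih (k + 1)
      refine ⟨LH (h k) + RH (J' k g), norm_LH_RH _ _ _ (hh k) (by simpa using hg), ?_⟩
      rw [Finset.sum_range_succ', map_add, ← hK, ← hg', add_comm]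
      simp only [add_zero]
      congr 1
      refine Finset.sum_congr rfl fun i _ => ?_
      rw [show k + (i + 1) = k + 1 + i by ring]
  obtain ⟨g, hg, hg'⟩ := key m 0
  simp only [zero_add] at hg'
  rw [hg']
  simpa using hg

/-- smallness of a seminorm on a copy -/
def SmallOn (p : Seminorm ℝ CantorC) (J : Copy) (ε : ℝ) : Prop :=
  p (J 1) ≤ ε ∧ ∀ w, p (J (haar w)) ≤ ε * (1 / 4) ^ (w.length + 1)

theorem chi_false (w : List Bool) : chi (false :: w) = (1 / 2 : ℝ) • (chi w + haar w) := by
  rw [haar, chi_split w]; module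

theorem chi_true (w : List Bool) : chi (true :: w) = (1 / 2 : ℝ) • (chi w - haar w) := by
  rw [haar, chi_split w]; module

theorem SmallOn.bound {p : Seminorm ℝ CantorC} {J : Copy} {ε K : ℝ} (h : SmallOn p J ε)
    (hp : ∀ f, p f ≤ K * ‖f‖) (f : CantorC) : p (J f) ≤ 2 * ε * ‖f‖ := by
  have hε : 0 ≤ ε := (apply_nonneg p _).trans h.1
  have hc := seminorm_continuous p K hp
  refine step_induction (P := fun f => p (J f) ≤ 2 * ε * ‖f‖)
    (isClosed_le (hc.comp J.continuous) (by fun_prop)) (fun n a => ?_) f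
  have := haar_bound p (fun w => J (chi w)) (fun w => J (haar w))
    (fun w => by rw [chi_false, map_smul, map_add])
    (fun w => by rw [chi_true, map_smul, map_sub]) ε hε (by rw [chi_nil]; exact h.1) h.2 n a _
    (norm_nonneg (∑ w ∈ words n, a w • chi w)) (abs_le_norm_sum_chi n a)
  simpa [map_sum] using this

/-- the recursive construction in the dichotomy -/
def dbuild (H : Set CantorSet → ℝ → CantorC) (U V : Set CantorSet → ℝ → Set CantorSet) (ε : ℝ) :
    List Bool → CantorC × Set CantorSet
  | [] => (H Set.univ ε, U Set.univ ε)
  | false :: w => ((1 / 2 : ℝ) • ((dbuild H U V ε w).1 +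
      H (dbuild H U V ε w).2 (ε * (1 / 4) ^ (w.length + 1))),
      U (dbuild H U V ε w).2 (ε * (1 / 4) ^ (w.length + 1)))
  | true :: w => ((1 / 2 : ℝ) • ((dbuild H U V ε w).1 -
      H (dbuild H U V ε w).2 (ε * (1 / 4) ^ (w.length + 1))),
      V (dbuild H U V ε w).2 (ε * (1 / 4) ^ (w.length + 1)))

/-- test functions -/
def TestF (u : Set CantorSet) (h : CantorC) (a b : Set CantorSet) : Prop :=
  (∀ x, |h x| ≤ 1) ∧ (∀ x, x ∉ u → h x = 0) ∧ IsOpen a ∧ a.Nonempty ∧ a ⊆ u ∧ (∀ x ∈ a, h x = 1)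
    ∧ IsOpen b ∧ b.Nonempty ∧ b ⊆ u ∧ (∀ x ∈ b, h x = -1)

theorem dichotomy_small (p : Seminorm ℝ CantorC)
    (hp : ∀ u : Set CantorSet, IsOpen u → u.Nonempty → ∀ ε > (0 : ℝ), ∃ h a b, TestF u h a b ∧ p h ≤ ε)
    (ε : ℝ) (hε : 0 < ε) : ∃ J : Copy, SmallOn p J ε := by
  have hp' : ∀ (u : Set CantorSet) (ε : ℝ), ∃ h a b, IsOpen u → u.Nonempty → 0 < ε →
      TestF u h a b ∧ p h ≤ ε := by
    intro u ε
    by_cases h : IsOpen u ∧ u.Nonempty ∧ 0 < ε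
    · obtain ⟨x, a, b, h'⟩ := hp u h.1 h.2.1 ε h.2.2
      exact ⟨x, a, b, fun _ _ _ => h'⟩
    · exact ⟨0, ∅, ∅, fun h1 h2 h3 => absurd ⟨h1, h2, h3⟩ h⟩
  choose H U V hH using hp'
  set B := dbuild H U V ε with hB
  have hpos : ∀ w : List Bool, 0 < ε * (1 / 4) ^ (w.length + 1) := fun w => by positivity
  set j : List Bool → CantorC := fun w => H (B w).2 (ε * (1 / 4) ^ (w.length + 1)) with hj
  have inv : ∀ w, IsOpen (B w).2 ∧ (B w).2.Nonempty ∧ ∀ x ∈ (B w).2, (B w).1 x = 1 := by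
    intro w
    induction w with
    | nil =>
      obtain ⟨⟨h1, h2, h3, h4, h5, h6, h7, h8, h9, h10⟩, h11⟩ :=
        hH Set.univ ε isOpen_univ Set.univ_nonempty hε
      exact ⟨h3, h4, h6⟩
    | cons b w ih =>
      obtain ⟨⟨h1, h2, h3, h4, h5, h6, h7, h8, h9, h10⟩, h11⟩ :=
        hH (B w).2 _ ih.1 ih.2.1 (hpos w)
      cases b with
      | false =>
        refine ⟨h3, h4, fun x hx => ?_⟩
        have e1 := ih.2.2 x (h5 hx)
        have e2 := h6 x hx
        change (1 / 2 : ℝ) * ((B w).1 x + H (B w).2 _ x) = 1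
        rw [e1, e2]; norm_num
      | true =>
        refine ⟨h7, h8, fun x hx => ?_⟩
        have e1 := ih.2.2 x (h9 hx)
        have e2 := h10 x hx
        change (1 / 2 : ℝ) * ((B w).1 x - H (B w).2 _ x) = 1
        rw [e1, e2]; norm_num
  have hT : ∀ w, TestF (B w).2 (j w) (U (B w).2 (ε * (1 / 4) ^ (w.length + 1)))
      (V (B w).2 (ε * (1 / 4) ^ (w.length + 1))) ∧ p (j w) ≤ ε * (1 / 4) ^ (w.length + 1) :=
    fun w => hH (B w).2 _ (inv w).1 (inv w).2.1 (hpos w)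
  have hT0 := hH Set.univ ε isOpen_univ Set.univ_nonempty hε
  have hf : ∀ w, (B (false :: w)).1 = (1 / 2 : ℝ) • ((B w).1 + j w) := fun w => rfl
  have ht : ∀ w, (B (true :: w)).1 = (1 / 2 : ℝ) • ((B w).1 - j w) := fun w => rfl
  have hsys : ∀ w, (B w).1 = (B (false :: w)).1 + (B (true :: w)).1 := by
    intro w; rw [hf, ht]; module
  have habs : ∀ w x, |(B (false :: w)).1 x| + |(B (true :: w)).1 x| = |(B w).1 x| := by
    intro w x
    rw [hf, ht]
    simp only [ContinuousMap.smul_apply, ContinuousMap.add_apply, ContinuousMap.sub_apply,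
      smul_eq_mul, abs_mul]
    by_cases hx : x ∈ (B w).2
    · rw [(inv w).2.2 x hx]
      have := (hT w).1.1 x
      rw [abs_le] at this
      rw [abs_of_nonneg (by linarith : 0 ≤ 1 + (j w) x), abs_of_nonneg (by linarith : 0 ≤ 1 - (j w) x)]
      norm_num
      ring
    · rw [(hT w).1.2.1 x hx]
      norm_num
      ring
  have hsum : ∀ n x, ∑ w ∈ words n, |(B w).1 x| ≤ 1 := by
    intro n x
    induction n with
    | zero =>
      have := hT0.1.1 x
      simp only [words, Finset.sum_singleton]
      exact this
    | succ n ih =>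
      rw [sum_words_succ]
      simpa only [habs] using ih
  obtain ⟨T, hT1, hT2⟩ := exists_system_op (fun w => (B w).1) hsys 1 (fun n a M ha => by
    have hM : 0 ≤ M := by
      have := ha (List.replicate n false) (by simp [mem_words])
      exact (abs_nonneg _).trans this
    rw [one_mul, ContinuousMap.norm_le _ hM]
    intro x
    rw [ContinuousMap.sum_apply]
    refine (norm_sum_le _ _).trans ?_
    calc ∑ w ∈ words n, ‖(a w • (B w).1) x‖ ≤ ∑ w ∈ words n, M * |(B w).1 x| := by
          refine Finset.sum_le_sum fun w hw => ?_
          rw [ContinuousMap.smul_apply, norm_smul, Real.norm_eq_abs, Real.norm_eq_abs]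
          gcongr
          exact ha w hw
      _ = M * ∑ w ∈ words n, |(B w).1 x| := by rw [Finset.mul_sum]
      _ ≤ M * 1 := by gcongr; exact hsum n x
      _ = M := mul_one M)
  have hlow : ∀ f, ‖f‖ ≤ ‖T f‖ := by
    intro f
    refine step_induction (P := fun f => ‖f‖ ≤ ‖T f‖)
      (isClosed_le (by fun_prop) (by fun_prop)) (fun n a => ?_) f
    refine norm_step_le n a _ (norm_nonneg _) fun w hw => ?_
    obtain ⟨x, hx⟩ := (inv w).2.1
    have h1 := (inv w).2.2 x hx
    have h2 : T (∑ w ∈ words n, a w • chi w) x = a w := by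
      rw [map_sum, ContinuousMap.sum_apply, Finset.sum_eq_single w]
      · rw [map_smul, hT1, ContinuousMap.smul_apply, h1]; simp
      · intro v hv hne
        rw [map_smul, hT1, ContinuousMap.smul_apply]
        have h3 := hsum n x
        rw [← Finset.add_sum_erase _ _ hw, h1, abs_one] at h3
        have h4 : |(B v).1 x| ≤ ∑ w ∈ (words n).erase w, |(B w).1 x| :=
          Finset.single_le_sum (f := fun w => |(B w).1 x|) (fun _ _ => abs_nonneg _)
            (Finset.mem_erase.2 ⟨hne, hv⟩)
        have h5 : |(B v).1 x| = 0 := le_antisymm (by linarith) (abs_nonneg _)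
        rw [abs_eq_zero.1 h5]; simp
      · intro h; exact absurd hw h
    rw [← h2]
    exact (T _).norm_coe_le_norm x
  refine ⟨⟨T.toLinearMap, fun f => le_antisymm ?_ (hlow f)⟩, ?_, fun w => ?_⟩
  · simpa using hT2 f
  · change p (T 1) ≤ ε
    rw [← chi_nil, hT1]
    exact hT0.2
  · change p (T (haar w)) ≤ _
    rw [haar, map_sub, hT1, hT1, hf, ht]
    have : (1 / 2 : ℝ) • ((B w).1 + j w) - (1 / 2 : ℝ) • ((B w).1 - j w) = j w := by module
    rw [this]
    exact (hT w).2

theorem cyl_in_open (u : Set CantorSet) (hu : IsOpen u) (hne : u.Nonempty) :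
    ∃ v : List Bool, ∀ x, pre x v.length = v → x ∈ u := by
  obtain ⟨x, hx⟩ := hne
  obtain ⟨I, s, hs, hsub⟩ := isOpen_pi_iff.1 hu x hx
  obtain ⟨n, hn⟩ := I.exists_nat_subset_range
  refine ⟨pre x n, fun y hy => hsub fun i hi => ?_⟩
  rw [pre_length] at hy
  rw [pre_inj hy i (Finset.mem_range.1 (hn hi))]
  exact (hs i hi).2

theorem isOpen_cyl (v : List Bool) : IsOpen {x | pre x v.length = v} :=
  (isLocallyConstant_pre v.length).isOpen_fiber v

/-- the dichotomy -/
theorem dichotomy (p : Seminorm ℝ CantorC) (K : ℝ) (hK : ∀ f, p f ≤ K * ‖f‖) :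
    (∃ (J : Copy) (c : ℝ), 0 < c ∧ ∀ f, c * ‖f‖ ≤ p (J f)) ∨
    (∀ ε > 0, ∃ J : Copy, SmallOn p J ε) := by
  by_cases hp : ∀ u : Set CantorSet, IsOpen u → u.Nonempty → ∀ ε > (0 : ℝ),
      ∃ h a b, TestF u h a b ∧ p h ≤ ε
  · right; exact dichotomy_small p hp
  left
  push Not at hp
  obtain ⟨u, hu, hne, ε, hε, hbad⟩ := hp
  obtain ⟨v, hv⟩ := cyl_in_open u hu hne
  have hcyl : ∀ (b : Bool) (x), pre x (b :: v).length = b :: v → pre x v.length = v := by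
    intro b x hx
    simp only [List.length_cons, pre, List.cons.injEq] at hx
    exact hx.2
  set A : CantorC →ₗ[ℝ] CantorC := (tr (false :: v)).toLinearMap - (tr (true :: v)).toLinearMap
    with hA
  have hAa : ∀ f, A f = tr (false :: v) f - tr (true :: v) f := fun f => rfl
  have hAf : ∀ f y, A f (glue (false :: v) y) = f y := by
    intro f y
    rw [hAa, ContinuousMap.sub_apply, tr_glue, tr_apply, if_neg, sub_zero]
    have := pre_glue (false :: v) y
    simp only [List.length_cons] at this ⊢
    rw [this]; simp
  have hAt : ∀ f y, A f (glue (true :: v) y) = - f y := by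
    intro f y
    rw [hAa, ContinuousMap.sub_apply, tr_glue, tr_apply, if_neg, zero_sub]
    have := pre_glue (true :: v) y
    simp only [List.length_cons] at this ⊢
    rw [this]; simp
  have hnorm : ∀ f, ‖A f‖ = ‖f‖ := by
    intro f
    apply le_antisymm
    · have := norm_tr_add_le v f (-f) ‖f‖ le_rfl (by simp)
      rwa [map_neg, ← sub_eq_add_neg] at this
    · rw [ContinuousMap.norm_le _ (norm_nonneg _)]
      intro y
      rw [← hAf f y]
      exact (A f).norm_coe_le_norm _
  let J : Copy := ⟨A, hnorm⟩
  refine ⟨J, ε, hε, fun f => ?_⟩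
  refine loc_induction (P := fun f => ε * ‖f‖ ≤ p (J f)) (isClosed_le (by fun_prop)
    ((seminorm_continuous p K hK).comp J.continuous)) (fun f hf => ?_) f
  by_cases hf0 : f = 0
  · subst hf0; simp
  have hfpos : 0 < ‖f‖ := norm_pos_iff.2 hf0
  obtain ⟨x₀, hx₀⟩ : ∃ x₀, |f x₀| = ‖f‖ := by
    obtain ⟨x₀, -, hx₀⟩ := isCompact_univ.exists_isMaxOn (Set.univ_nonempty (α := CantorSet))
      (f := fun x => |f x|) (by fun_prop)
    refine ⟨x₀, le_antisymm (f.norm_coe_le_norm x₀) ?_⟩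
    rw [ContinuousMap.norm_le _ (abs_nonneg _)]
    exact fun x => hx₀ (Set.mem_univ x)
  set c := f x₀ with hc
  have hc0 : c ≠ 0 := by intro h; rw [h] at hx₀; simp at hx₀; linarith
  set o : Set CantorSet := {x | f x = c} with ho
  have hoo : IsOpen o := hf.isOpen_fiber c
  have hsh : ∀ b : Bool, IsOpen ({x | pre x (b :: v).length = b :: v} ∩ shiftC (b :: v).length ⁻¹' o) :=
    fun b => (isOpen_cyl _).inter (hoo.preimage (continuous_shiftC _))
  have hshne : ∀ b : Bool,
      ({x | pre x (b :: v).length = b :: v} ∩ shiftC (b :: v).length ⁻¹' o).Nonempty := fun b =>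
    ⟨glue (b :: v) x₀, pre_glue _ _, by
      change shiftC _ (glue (b :: v) x₀) ∈ o
      rw [shift_glue]; rfl⟩
  have hb := hbad (c⁻¹ • A f) ({x | pre x (false :: v).length = false :: v} ∩
      shiftC (false :: v).length ⁻¹' o) ({x | pre x (true :: v).length = true :: v} ∩
      shiftC (true :: v).length ⁻¹' o) ⟨fun x => ?_, fun x hx => ?_, hsh _, hshne _,
      fun x hx => hv x (hcyl _ x hx.1), fun x hx => ?_, hsh _, hshne _,
      fun x hx => hv x (hcyl _ x hx.1), fun x hx => ?_⟩
  · rw [map_smul_eq_mul, norm_inv, Real.norm_eq_abs, hx₀] at hb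
    change ε * ‖f‖ ≤ p (A f)
    rw [inv_mul_eq_div, lt_div_iff₀ hfpos] at hb
    exact hb.le
  · rw [ContinuousMap.smul_apply, smul_eq_mul, abs_mul, abs_inv, hx₀, inv_mul_eq_div,
      div_le_one hfpos, ← hnorm f]
    exact (A f).norm_coe_le_norm x
  · have hx' : ∀ b : Bool, ¬ pre x (b :: v).length = b :: v := fun b h => hx (hv x (hcyl b x h))
    rw [ContinuousMap.smul_apply, hAa, ContinuousMap.sub_apply, tr_apply, tr_apply, if_neg (hx' _),
      if_neg (hx' _)]
    simp
  · obtain ⟨h1, h2⟩ := hx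
    have h1' : pre x (false :: v).length = false :: v := h1
    have h3 : ¬ pre x (true :: v).length = true :: v := by
      simp only [List.length_cons] at h1' ⊢
      rw [h1']; simp
    have h2' : f (shiftC (false :: v).length x) = c := h2
    rw [ContinuousMap.smul_apply, hAa, ContinuousMap.sub_apply, tr_apply, tr_apply, if_pos h1',
      if_neg h3, h2']
    simp [hc0]
  · obtain ⟨h1, h2⟩ := hx
    have h1' : pre x (true :: v).length = true :: v := h1
    have h3 : ¬ pre x (false :: v).length = false :: v := by
      simp only [List.length_cons] at h1' ⊢
      rw [h1']; simp
    have h2' : f (shiftC (true :: v).length x) = c := h2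
    rw [ContinuousMap.smul_apply, hAa, ContinuousMap.sub_apply, tr_apply, tr_apply, if_pos h1',
      if_neg h3, h2']
    simp [hc0]

/-- build a system from its Haar parts -/
def hbuild {Z : Type*} [AddCommGroup Z] [Module ℝ Z] (g0 : Z) (j : List Bool → Z) : List Bool → Z
  | [] => g0
  | false :: w => (1 / 2 : ℝ) • (hbuild g0 j w + j w)
  | true :: w => (1 / 2 : ℝ) • (hbuild g0 j w - j w)

/-- **Perturbation.** -/
theorem perturb_embed {Z : Type*} [NormedAddCommGroup Z] [NormedSpace ℝ Z] [CompleteSpace Z]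
    (S : CantorC →L[ℝ] Z) (c : ℝ) (hS : ∀ f, c * ‖f‖ ≤ ‖S f‖)
    (X : Submodule ℝ Z) (hX : IsClosed (X : Set Z)) (ε : ℝ) (hε : 0 ≤ ε) (hc : 2 * ε < c)
    (h0 : ∃ x ∈ X, ‖S 1 - x‖ ≤ ε)
    (h1 : ∀ w, ∃ x ∈ X, ‖S (haar w) - x‖ ≤ ε * (1 / 4) ^ (w.length + 1)) : Embeds CantorC X := by
  have : CompleteSpace X := hX.completeSpace_coe
  obtain ⟨g0, hg0, hg0'⟩ := h0
  choose j hj hj' using h1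
  let g : List Bool → X := hbuild ⟨g0, hg0⟩ (fun w => ⟨j w, hj w⟩)
  have hgf : ∀ w, g (false :: w) = (1 / 2 : ℝ) • (g w + ⟨j w, hj w⟩) := fun w => rfl
  have hgt : ∀ w, g (true :: w) = (1 / 2 : ℝ) • (g w - ⟨j w, hj w⟩) := fun w => rfl
  have hgs : ∀ w, g w = g (false :: w) + g (true :: w) := by
    intro w; rw [hgf, hgt]; module
  have hb : ∀ n (a : List Bool → ℝ) (M : ℝ), 0 ≤ M → (∀ w ∈ words n, |a w| ≤ M) →
      ‖∑ w ∈ words n, a w • (S (chi w) - (g w : Z))‖ ≤ 2 * ε * M := by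
    intro n a M hM ha
    refine haar_bound (normSeminorm ℝ Z) (fun w => S (chi w) - (g w : Z))
      (fun w => S (haar w) - j w) (fun w => ?_) (fun w => ?_) ε hε ?_ hj' n a M hM ha
    · rw [hgf, chi_false, map_smul, map_add]
      push_cast
      module
    · rw [hgt, chi_true, map_smul, map_sub]
      push_cast
      module
    · simp only [chi_nil]; exact hg0'
  obtain ⟨T, hT, hT'⟩ := exists_system_op g hgs (‖S‖ + 2 * ε) (fun n a M ha => by
    have hM : 0 ≤ M := by
      have := ha (List.replicate n false) (by simp [mem_words])
      exact (abs_nonneg _).trans this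
    have e1 : ((∑ w ∈ words n, a w • g w : X) : Z) =
        S (∑ w ∈ words n, a w • chi w) - ∑ w ∈ words n, a w • (S (chi w) - (g w : Z)) := by
      rw [map_sum, ← Finset.sum_sub_distrib]
      push_cast
      refine Finset.sum_congr rfl fun w _ => ?_
      rw [map_smul]; module
    rw [Submodule.coe_norm, e1]
    refine (norm_sub_le _ _).trans ?_
    have e2 := S.le_opNorm (∑ w ∈ words n, a w • chi w)
    have e3 := norm_step_le n a M hM ha
    have e4 := hb n a M hM ha
    have e5 : ‖S‖ * ‖∑ w ∈ words n, a w • chi w‖ ≤ ‖S‖ * M := by gcongr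
    linarith)
  refine ⟨T, c - 2 * ε, by linarith, fun f => ?_⟩
  refine step_induction (P := fun f => (c - 2 * ε) * ‖f‖ ≤ ‖T f‖)
    (isClosed_le (by fun_prop) (by fun_prop)) (fun n a => ?_) f
  have e1 : ((T (∑ w ∈ words n, a w • chi w) : X) : Z) =
      S (∑ w ∈ words n, a w • chi w) - ∑ w ∈ words n, a w • (S (chi w) - (g w : Z)) := by
    rw [map_sum, map_sum, ← Finset.sum_sub_distrib]
    push_cast
    refine Finset.sum_congr rfl fun w _ => ?_
    rw [map_smul, map_smul, hT]; push_cast; module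
  rw [Submodule.coe_norm, e1]
  have e2 := hS (∑ w ∈ words n, a w • chi w)
  have e4 := hb n a _ (norm_nonneg _) (abs_le_norm_sum_chi n a)
  have e5 := norm_sub_norm_le (S (∑ w ∈ words n, a w • chi w))
    (∑ w ∈ words n, a w • (S (chi w) - (g w : Z)))
  linarith

/-- **Sign lemma.** -/
theorem sign_lemma {Z : Type*} [AddCommGroup Z] [Module ℝ Z] (m : ℕ) (x : ℕ → Z)
    (q : ℕ → Seminorm ℝ Z) :
    ∃ θ : ℕ → ℝ, (∀ i, |θ i| = 1) ∧
      ∑ i ∈ Finset.range m, q i (x i) ≤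
        ∑ i ∈ Finset.range m, q i (∑ j ∈ Finset.range m, θ j • x j) := by
  -- stronger: add vector `y` and any seminorms, by induction on the number of signs
  have key : ∀ k, ∀ (n : ℕ) (y : ℕ → Z), (∀ i, y i = y 0) → ∃ θ : ℕ → ℝ, (∀ i, |θ i| = 1) ∧
      ∑ i ∈ Finset.range k, q i (x i) + ∑ i ∈ Finset.Ico k (k + n), q i (y i) ≤
        ∑ i ∈ Finset.range (k + n), q i (∑ j ∈ Finset.range k, θ j • x j + y i) := by
    intro k
    induction k with
    | zero =>
      intro n y hy
      refine ⟨fun _ => 1, by simp, ?_⟩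
      simp
    | succ k ih =>
      intro n y hy
      obtain ⟨θ, hθ, h1⟩ := ih (n + 1) (fun i => x k + y 0) (fun _ => rfl)
      obtain ⟨θ', hθ', h2⟩ := ih (n + 1) (fun i => -x k + y 0) (fun _ => rfl)
      by_contra hcon
      push Not at hcon
      have c1 := hcon (Function.update θ k 1) (fun i => by
        by_cases h : i = k
        · subst h; simp
        · rw [Function.update_of_ne h]; exact hθ i)
      have c2 := hcon (Function.update θ' k (-1)) (fun i => by
        by_cases h : i = k
        · subst h; simp
        · rw [Function.update_of_ne h]; exact hθ' i)
      have s1 : ∀ (θ : ℕ → ℝ) (r : ℝ), ∑ j ∈ Finset.range (k + 1), Function.update θ k r j • x j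
          = ∑ j ∈ Finset.range k, θ j • x j + r • x k := by
        intro θ r
        rw [Finset.sum_range_succ, Function.update_self]
        congr 1
        refine Finset.sum_congr rfl fun j hj => ?_
        rw [Function.update_of_ne (Finset.mem_range.1 hj).ne]
      simp only [s1, hy _] at c1 c2
      simp only [one_smul, neg_smul, add_assoc] at c1 c2
      rw [show k + (1 + n) = k + (n + 1) by ring] at c1 c2
      have e : ∑ i ∈ Finset.Ico k (k + (n + 1)), (q i (x k + y 0) + q i (-x k + y 0)) ≥
          2 * (q k (x k) + ∑ i ∈ Finset.Ico (k + 1) (k + (n + 1)), q i (y 0)) := by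
        rw [Finset.sum_eq_sum_Ico_succ_bot (by omega), mul_add, Finset.mul_sum]
        apply add_le_add
        · have h := map_sub_le_add (q k) (x k + y 0) (-x k + y 0)
          have : x k + y 0 - (-x k + y 0) = (2 : ℝ) • x k := by module
          rw [this, map_smul_eq_mul] at h
          simpa using h
        · refine Finset.sum_le_sum fun i _ => ?_
          have h := map_add_le_add (q i) (x k + y 0) (-x k + y 0)
          have : x k + y 0 + (-x k + y 0) = (2 : ℝ) • y 0 := by module
          rw [this, map_smul_eq_mul] at h
          simpa using h
      rw [Finset.sum_add_distrib] at e
      rw [Finset.sum_range_succ] at c1 c2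
      linarith
  obtain ⟨θ, h, h'⟩ := key m 0 0 (fun _ => rfl)
  refine ⟨θ, h, ?_⟩
  simpa using h'

end

noncomputable section

/-! ### The path functional -/

/-- the difference vectors along a path -/
def wv (l : ℕ → ℕ) (y : ℕ → CantorC) (n : ℕ) : CantorC := QQ (l n) (y n - y (n + 1))

/-- the distance to a subspace, as a seminorm -/
def dq (E : Submodule ℝ CantorC) : Seminorm ℝ CantorC :=
  (normSeminorm ℝ (CantorC ⧸ E)).comp E.mkQ

/-- the path functional -/
def Pif (l : ℕ → ℕ) (E : ℕ → Submodule ℝ CantorC) (M : ℕ) (y : ℕ → CantorC) : ℝ :=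
  ‖∑ n ∈ Finset.range M, wv l y n‖ + ∑ n ∈ Finset.range M, dq (E n) (wv l y n)

theorem Pif_nonneg (l : ℕ → ℕ) (E : ℕ → Submodule ℝ CantorC) (M : ℕ) (y : ℕ → CantorC) :
    0 ≤ Pif l E M y :=
  add_nonneg (norm_nonneg _) (Finset.sum_nonneg fun _ _ => apply_nonneg _ _)

theorem dq_le (E : Submodule ℝ CantorC) (x : CantorC) : dq E x ≤ ‖x‖ :=
  Submodule.Quotient.norm_mk_le E x

theorem dq_mono {E E' : Submodule ℝ CantorC} (h : E ≤ E') (x : CantorC) :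
    dq E' x ≤ dq E x := by
  refine le_of_forall_pos_le_add fun ε hε => ?_
  obtain ⟨m, hm, hm'⟩ := Submodule.Quotient.norm_mk_lt (S := E) (E.mkQ x) hε
  have h1 : m - x ∈ E := (Submodule.Quotient.eq E).1 hm
  have h2 : E'.mkQ x = E'.mkQ m := ((Submodule.Quotient.eq E').2 (h h1)).symm
  have h3 : dq E' x = dq E' m := by
    rw [dq, Seminorm.comp_apply, Seminorm.comp_apply, h2]
  rw [h3]
  exact (dq_le E' m).trans hm'.le

theorem dq_of_mem {E : Submodule ℝ CantorC} {x : CantorC} (h : x ∈ E) : dq E x = 0 := by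
  have h2 : E.mkQ x = E.mkQ 0 := (Submodule.Quotient.eq E).2 (by simpa using h)
  rw [dq, Seminorm.comp_apply, h2, ← Seminorm.comp_apply, map_zero]

theorem Q_wv (l : ℕ → ℕ) (y : ℕ → CantorC) {i n : ℕ} (h : l i ≤ l n) :
    QQ (l i) (wv l y n) = QQ (l i) (y n - y (n + 1)) := by
  rw [wv, QQ_QQ, min_eq_left h]

theorem Q_wv_self (l : ℕ → ℕ) (y : ℕ → CantorC) {i n : ℕ} (h : l n ≤ l i) :
    QQ (l i) (wv l y n) = wv l y n := by
  rw [wv, QQ_QQ, min_eq_right h]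

theorem Q_sum_tail (l : ℕ → ℕ) (hl : Monotone l) (y : ℕ → CantorC) {i j M : ℕ} (hij : i ≤ j)
    (hjM : j ≤ M) (hy : y M = 0) : QQ (l i) (∑ n ∈ Finset.Ico j M, wv l y n) = QQ (l i) (y j) := by
  rw [map_sum]
  have : ∀ n ∈ Finset.Ico j M, QQ (l i) (wv l y n) = QQ (l i) (y n) - QQ (l i) (y (n + 1)) := by
    intro n hn
    rw [Q_wv l y (hl (hij.trans (Finset.mem_Ico.1 hn).1)), map_sub]
  rw [Finset.sum_congr rfl this]
  have h2 := Finset.sum_Ico_sub (fun n => QQ (l i) (y n)) hjM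
  have h3 : ∑ n ∈ Finset.Ico j M, (QQ (l i) (y n) - QQ (l i) (y (n + 1)))
      = - ∑ n ∈ Finset.Ico j M, (QQ (l i) (y (n + 1)) - QQ (l i) (y n)) := by
    rw [← Finset.sum_neg_distrib]
    exact Finset.sum_congr rfl fun n _ => by abel
  rw [h3, h2, hy]
  simp

theorem Q_sum_head (l : ℕ → ℕ) (hl : Monotone l) (y : ℕ → CantorC) {i j : ℕ} (hij : j ≤ i + 1) :
    QQ (l i) (∑ n ∈ Finset.range j, wv l y n) = ∑ n ∈ Finset.range j, wv l y n := by
  rw [map_sum]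
  refine Finset.sum_congr rfl fun n hn => ?_
  rw [Q_wv_self]
  apply hl
  have := Finset.mem_range.1 hn
  omega

theorem dq_sum_head (l : ℕ → ℕ) (E : ℕ → Submodule ℝ CantorC) (hE : Monotone E)
    (y : ℕ → CantorC) {i j : ℕ} (hij : j ≤ i + 1) :
    dq (E i) (∑ n ∈ Finset.range j, wv l y n) ≤
      ∑ n ∈ Finset.range j, dq (E n) (wv l y n) := by
  refine (seminorm_sum_le _ _ _).trans (Finset.sum_le_sum fun n hn => ?_)
  apply dq_mono
  apply hE
  have := Finset.mem_range.1 hn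
  omega

theorem Pif_cut (l : ℕ → ℕ) (hl : Monotone l) (E : ℕ → Submodule ℝ CantorC) (hE : Monotone E)
    (M : ℕ) (y : ℕ → CantorC) (hy : y M = 0) (k : ℕ) (hk : k < M) :
    Pif l E (k + 1) (fun n => if n ≤ k then y n else 0) ≤ 2 * Pif l E M y := by
  set y' : ℕ → CantorC := fun n => if n ≤ k then y n else 0 with hy'
  set r := ∑ n ∈ Finset.range M, wv l y n with hr
  set h := ∑ n ∈ Finset.range k, wv l y n with hh
  have hw : ∀ n < k, wv l y' n = wv l y n := by
    intro n hn
    simp only [wv, hy']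
    rw [if_pos (by omega), if_pos (by omega)]
  have hsplit : r = h + ∑ n ∈ Finset.Ico k M, wv l y n := by
    rw [hr, hh, Finset.sum_range_add_sum_Ico _ hk.le]
  have hwk : wv l y' k = QQ (l k) r - h := by
    have h1 : wv l y' k = QQ (l k) (y k) := by
      simp only [wv, hy']
      rw [if_pos le_rfl, if_neg (by omega), sub_zero]
    rw [h1, hsplit, map_add, Q_sum_tail l hl y le_rfl hk.le hy, Q_sum_head l hl y (by omega)]
    abel
  have s1 : ∑ n ∈ Finset.range (k + 1), wv l y' n = QQ (l k) r := by
    rw [Finset.sum_range_succ, hwk,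
      Finset.sum_congr rfl (fun n hn => hw n (Finset.mem_range.1 hn))]
    abel
  have s2 : ∑ n ∈ Finset.range (k + 1), dq (E n) (wv l y' n) ≤
      2 * ∑ n ∈ Finset.range k, dq (E n) (wv l y n) + ‖r‖ := by
    rw [Finset.sum_range_succ, hwk,
      Finset.sum_congr rfl (fun n hn => by rw [hw n (Finset.mem_range.1 hn)])]
    have e1 := map_sub_le_add (dq (E k)) (QQ (l k) r) h
    have e2 := (dq_le (E k) (QQ (l k) r)).trans (norm_QQ_le _ _)
    have e3 := dq_sum_head l E hE y (i := k) (j := k) (by omega)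
    rw [← hh] at e3
    linarith
  have s3 : ∑ n ∈ Finset.range k, dq (E n) (wv l y n) ≤
      ∑ n ∈ Finset.range M, dq (E n) (wv l y n) :=
    Finset.sum_le_sum_of_subset_of_nonneg (Finset.range_mono hk.le) fun _ _ _ => apply_nonneg _ _
  unfold Pif
  rw [s1]
  have := norm_QQ_le (l k) r
  linarith

theorem Pif_top (l : ℕ → ℕ) (hl : Monotone l) (E : ℕ → Submodule ℝ CantorC) (hE : Monotone E)
    (M : ℕ) (y : ℕ → CantorC) (hy : y M = 0) (j : ℕ) (hj : j ≤ M) :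
    Pif l E M (fun n => if j ≤ n then y n else 0) ≤ 3 * Pif l E M y := by
  rcases Nat.eq_zero_or_pos j with rfl | hjp
  · simp only [Nat.zero_le, if_true]
    have : 0 ≤ Pif l E M y := Pif_nonneg _ _ _ _
    linarith
  obtain ⟨i, rfl⟩ : ∃ i, j = i + 1 := ⟨j - 1, by omega⟩
  set y' : ℕ → CantorC := fun n => if i + 1 ≤ n then y n else 0 with hy'
  set r := ∑ n ∈ Finset.range M, wv l y n with hr
  set h := ∑ n ∈ Finset.range (i + 1), wv l y n with hh
  set t := ∑ n ∈ Finset.Ico (i + 1) M, wv l y n with ht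
  have hsplit : r = h + t := by
    rw [hr, hh, ht, Finset.sum_range_add_sum_Ico _ hj]
  have hw0 : ∀ n < i, wv l y' n = 0 := by
    intro n hn
    simp only [wv, hy']
    rw [if_neg (by omega), if_neg (by omega)]; simp
  have hw1 : ∀ n, i + 1 ≤ n → wv l y' n = wv l y n := by
    intro n hn
    simp only [wv, hy']
    rw [if_pos (by omega), if_pos (by omega)]
  have hwi : wv l y' i = h - QQ (l i) r := by
    have h1 : wv l y' i = - QQ (l i) (y (i + 1)) := by
      simp only [wv, hy']
      rw [if_neg (by omega), if_pos (by omega), zero_sub, map_neg]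
    rw [h1, hsplit, map_add, Q_sum_tail l hl y (by omega) hj hy, Q_sum_head l hl y (by omega)]
    abel
  have s1 : ∑ n ∈ Finset.range M, wv l y' n = r - QQ (l i) r := by
    rw [← Finset.sum_range_add_sum_Ico _ hj, Finset.sum_range_succ, hwi,
      Finset.sum_congr rfl (fun n hn => hw0 n (Finset.mem_range.1 hn)),
      Finset.sum_congr rfl (fun n hn => hw1 n (Finset.mem_Ico.1 hn).1), hsplit]
    rw [Finset.sum_const_zero]
    abel
  have s2 : ∑ n ∈ Finset.range M, dq (E n) (wv l y' n) ≤
      ∑ n ∈ Finset.range M, dq (E n) (wv l y n) + ‖r‖ := by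
    rw [← Finset.sum_range_add_sum_Ico _ hj, Finset.sum_range_succ, hwi,
      Finset.sum_eq_zero (fun n hn => by rw [hw0 n (Finset.mem_range.1 hn), map_zero]),
      Finset.sum_congr (g := fun n => dq (E n) (wv l y n)) rfl
        (fun n hn => by rw [hw1 n (Finset.mem_Ico.1 hn).1]),
      ← Finset.sum_range_add_sum_Ico (fun n => dq (E n) (wv l y n)) hj]
    have e1 := map_sub_le_add (dq (E i)) h (QQ (l i) r)
    have e2 := (dq_le (E i) (QQ (l i) r)).trans (norm_QQ_le _ _)
    have e3 := dq_sum_head l E hE y (i := i) (j := i + 1) le_rfl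
    rw [← hh] at e3
    linarith
  unfold Pif
  rw [s1]
  have := norm_QQ_le (l i) r
  have := norm_sub_le r (QQ (l i) r)
  have : 0 ≤ ∑ n ∈ Finset.range M, dq (E n) (wv l y n) := Finset.sum_nonneg fun _ _ => apply_nonneg _ _
  linarith

theorem Pif_congr {l l' : ℕ → ℕ} {E E' : ℕ → Submodule ℝ CantorC} {M : ℕ} {y y' : ℕ → CantorC}
    (hl : ∀ n < M, l n = l' n) (hE : ∀ n < M, E n = E' n) (hy : ∀ n ≤ M, y n = y' n) :
    Pif l E M y = Pif l' E' M y' := by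
  have hw : ∀ n < M, wv l y n = wv l' y' n := fun n hn => by
    rw [wv, wv, hl n hn, hy n hn.le, hy (n + 1) hn]
  unfold Pif
  rw [Finset.sum_congr rfl (fun n hn => hw n (Finset.mem_range.1 hn))]
  congr 1
  refine Finset.sum_congr rfl fun n hn => ?_
  rw [hw n (Finset.mem_range.1 hn), hE n (Finset.mem_range.1 hn)]

/-- extending the range past the support does not matter -/
theorem Pif_extend (l : ℕ → ℕ) (E : ℕ → Submodule ℝ CantorC) {M M' : ℕ} (y : ℕ → CantorC)
    (hM : M ≤ M') (hy : ∀ n ≥ M, y n = 0) : Pif l E M' y = Pif l E M y := by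
  have hw : ∀ n ∈ Finset.range M', n ∉ Finset.range M → wv l y n = 0 := fun n _ hn => by
    have : M ≤ n := by simpa using hn
    rw [wv, hy n this, hy (n + 1) (by omega)]; simp
  unfold Pif
  rw [Finset.sum_subset (Finset.range_mono hM) hw,
    Finset.sum_subset (Finset.range_mono hM) (f := fun n => dq (E n) (wv l y n))]
  intro n h1 h2
  rw [hw n h1 h2]; simp

/-! ### The tree norm -/

/-- level of a node -/
def lvt (lev : ℕ → ℕ) (t : List ℕ) : ℕ := (t.map lev).foldr max 0

theorem le_lvt (lev : ℕ → ℕ) {t : List ℕ} {i : ℕ} (h : i ∈ t) : lev i ≤ lvt lev t := by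
  induction t with
  | nil => simp at h
  | cons a t ih =>
    simp only [lvt, List.map_cons, List.foldr_cons]
    rcases List.mem_cons.1 h with rfl | h
    · exact le_max_left _ _
    · exact (ih h).trans (le_max_right _ _)

theorem lvt_le (lev : ℕ → ℕ) {t : List ℕ} {m : ℕ} (h : ∀ i ∈ t, lev i ≤ m) : lvt lev t ≤ m := by
  induction t with
  | nil => simp [lvt]
  | cons a t ih =>
    simp only [lvt, List.map_cons, List.foldr_cons]
    exact max_le (h a (by simp)) (ih fun i hi => h i (by simp [hi]))

theorem lvt_mono (lev : ℕ → ℕ) {t t' : List ℕ} (h : t ⊆ t') : lvt lev t ≤ lvt lev t' :=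
  lvt_le lev fun _ hi => le_lvt lev (h hi)

/-- the finite-dimensional space of a node -/
def Et (lab : ℕ → CantorC) (t : List ℕ) : Submodule ℝ CantorC :=
  Submodule.span ℝ (lab '' {i | i ∈ t})

theorem Et_mono (lab : ℕ → CantorC) {t t' : List ℕ} (h : t ⊆ t') : Et lab t ≤ Et lab t' :=
  Submodule.span_mono (Set.image_mono fun _ hi => h hi)

instance Et_fin (lab : ℕ → CantorC) (t : List ℕ) : FiniteDimensional ℝ (Et lab t) := by
  apply FiniteDimensional.span_of_finite
  exact (List.finite_toSet t).image _

instance Et_closed (lab : ℕ → CantorC) (t : List ℕ) : IsClosed (Et lab t : Set CantorC) :=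
  Submodule.closed_of_finiteDimensional _

/-- the space of finitely supported functions on the nodes -/
abbrev VT := List ℕ →₀ CantorC

/-- the coordinates of `z` along a segment -/
def segy (s : ℕ × List ℕ) (n : ℕ) : VT →ₗ[ℝ] CantorC :=
  if s.1 ≤ n ∧ n ≤ s.2.length then Finsupp.lapply (s.2.take n) else 0

theorem segy_apply (s : ℕ × List ℕ) (n : ℕ) (z : VT) :
    segy s n z = if s.1 ≤ n ∧ n ≤ s.2.length then z (s.2.take n) else 0 := by
  unfold segy
  split_ifs <;> simp

/-- levels along a list -/
def lseg (lev : ℕ → ℕ) (b : List ℕ) (n : ℕ) : ℕ := lvt lev (b.take n)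
/-- spaces along a list -/
def Eseg (lab : ℕ → CantorC) (b : List ℕ) (n : ℕ) : Submodule ℝ CantorC := Et lab (b.take n)

theorem take_subset_take {b : List ℕ} {m n : ℕ} (h : m ≤ n) : b.take m ⊆ b.take n :=
  (List.take_prefix_take_left h).subset

theorem lseg_mono (lev : ℕ → ℕ) (b : List ℕ) : Monotone (lseg lev b) :=
  fun _ _ h => lvt_mono lev (take_subset_take h)

theorem Eseg_mono (lab : ℕ → CantorC) (b : List ℕ) : Monotone (Eseg lab b) :=
  fun _ _ h => Et_mono lab (take_subset_take h)

/-- the linear maps `w_n` of a segment -/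
def segw (lev : ℕ → ℕ) (s : ℕ × List ℕ) (n : ℕ) : VT →ₗ[ℝ] CantorC :=
  (QQ (lseg lev s.2 n)).toLinearMap ∘ₗ (segy s n - segy s (n + 1))

theorem segw_apply (lev : ℕ → ℕ) (s : ℕ × List ℕ) (n : ℕ) (z : VT) :
    segw lev s n z = wv (lseg lev s.2) (fun n => segy s n z) n := rfl

theorem seminorm_finset_sum_apply {V ι : Type*} [AddCommGroup V] [Module ℝ V]
    (p : ι → Seminorm ℝ V) (s : Finset ι) (z : V) : (∑ i ∈ s, p i) z = ∑ i ∈ s, p i z := by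
  classical
  induction s using Finset.induction_on with
  | empty => simp
  | insert a s ha ih => rw [Finset.sum_insert ha, Finset.sum_insert ha, ← ih]; rfl

/-- the seminorm of a segment -/
def segp (lab : ℕ → CantorC) (lev : ℕ → ℕ) (s : ℕ × List ℕ) : Seminorm ℝ VT :=
  (normSeminorm ℝ CantorC).comp (∑ n ∈ Finset.range (s.2.length + 1), segw lev s n) +
  ∑ n ∈ Finset.range (s.2.length + 1), (dq (Eseg lab s.2 n)).comp (segw lev s n)

theorem segp_apply (lab : ℕ → CantorC) (lev : ℕ → ℕ) (s : ℕ × List ℕ) (z : VT) :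
    segp lab lev s z = Pif (lseg lev s.2) (Eseg lab s.2) (s.2.length + 1) (fun n => segy s n z) := by
  have : segp lab lev s z = (normSeminorm ℝ CantorC).comp
      (∑ n ∈ Finset.range (s.2.length + 1), segw lev s n) z +
      (∑ n ∈ Finset.range (s.2.length + 1), (dq (Eseg lab s.2 n)).comp (segw lev s n)) z := rfl
  rw [this, seminorm_finset_sum_apply, Seminorm.comp_apply]
  unfold Pif
  simp only [LinearMap.sum_apply, segw_apply, coe_normSeminorm, Seminorm.comp_apply]

end

noncomputable section

/-! ### Admissible families and the tree norm -/

/-- `t` lies on the segment `s` -/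
def onseg (s : ℕ × List ℕ) (t : List ℕ) : Prop := s.2.take s.1 <+: t ∧ t <+: s.2

/-- admissible families of segments -/
def Adm (T : Set (List ℕ)) (F : Finset (ℕ × List ℕ)) : Prop :=
  (∀ s ∈ F, s.2 ∈ T ∧ s.1 ≤ s.2.length) ∧
  ∀ s ∈ F, ∀ s' ∈ F, s.2.take s.1 <+: s'.2.take s'.1 → s = s'

theorem prefix_total {a b c : List ℕ} (h : a <+: c) (h' : b <+: c) : a <+: b ∨ b <+: a :=
  List.prefix_or_prefix_of_prefix h h'

theorem Adm.unique {T : Set (List ℕ)} {F : Finset (ℕ × List ℕ)} (hF : Adm T F)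
    {s s' : ℕ × List ℕ} (hs : s ∈ F) (hs' : s' ∈ F) {t t' : List ℕ} (h : onseg s t)
    (h' : onseg s' t') (ht : t <+: t' ∨ t' <+: t) : s = s' := by
  have : s.2.take s.1 <+: s'.2.take s'.1 ∨ s'.2.take s'.1 <+: s.2.take s.1 := by
    rcases ht with ht | ht
    · exact prefix_total (h.1.trans ht) h'.1
    · exact prefix_total h.1 (h'.1.trans ht)
  rcases this with h1 | h1
  · exact hF.2 s hs s' hs' h1
  · exact (hF.2 s' hs' s hs h1).symm

theorem Pif_le (l : ℕ → ℕ) (E : ℕ → Submodule ℝ CantorC) (M : ℕ) (y : ℕ → CantorC)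
    (hy : y M = 0) : Pif l E M y ≤ 4 * ∑ n ∈ Finset.range M, ‖y n‖ := by
  have h1 : ∀ n, ‖wv l y n‖ ≤ ‖y n‖ + ‖y (n + 1)‖ := fun n =>
    (norm_QQ_le _ _).trans (norm_sub_le _ _)
  have h2 : ∑ n ∈ Finset.range M, ‖wv l y n‖ ≤ 2 * ∑ n ∈ Finset.range M, ‖y n‖ := by
    refine (Finset.sum_le_sum fun n _ => h1 n).trans ?_
    rw [Finset.sum_add_distrib]
    have h3 := Finset.sum_range_succ (fun n => ‖y n‖) M
    have h4 := Finset.sum_range_succ' (fun n => ‖y n‖) M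
    rw [hy, norm_zero, add_zero] at h3
    have := norm_nonneg (y 0)
    linarith
  unfold Pif
  have h3 := norm_sum_le (Finset.range M) (wv l y)
  have h4 : ∑ n ∈ Finset.range M, dq (E n) (wv l y n) ≤ ∑ n ∈ Finset.range M, ‖wv l y n‖ :=
    Finset.sum_le_sum fun n _ => dq_le _ _
  linarith

theorem segy_end (s : ℕ × List ℕ) (z : VT) : segy s (s.2.length + 1) z = 0 := by
  rw [segy_apply, if_neg (by omega)]

theorem segy_onseg {s : ℕ × List ℕ} {n : ℕ} {z : VT} (h : segy s n z ≠ 0) :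
    onseg s (s.2.take n) ∧ n ≤ s.2.length ∧ z (s.2.take n) ≠ 0 := by
  rw [segy_apply] at h
  split_ifs at h with h1
  · exact ⟨⟨List.take_prefix_take_left h1.1, List.take_prefix _ _⟩, h1.2, h⟩
  · exact absurd rfl h

open Classical in
theorem segp_le (lab : ℕ → CantorC) (lev : ℕ → ℕ) (s : ℕ × List ℕ) (z : VT) :
    segp lab lev s z ≤ 4 * ∑ t ∈ z.support, if onseg s t then ‖z t‖ else 0 := by
  rw [segp_apply]
  refine (Pif_le _ _ _ _ (segy_end s z)).trans ?_
  gcongr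
  rw [← Finset.sum_filter_add_sum_filter_not (Finset.range (s.2.length + 1))
    (fun n => segy s n z ≠ 0) (fun n => ‖segy s n z‖)]
  have h0 : ∑ n ∈ (Finset.range (s.2.length + 1)).filter (fun n => ¬ (segy s n z ≠ 0)),
      ‖segy s n z‖ = 0 := by
    apply Finset.sum_eq_zero
    intro n hn
    have := (Finset.mem_filter.1 hn).2
    rw [not_not.1 this, norm_zero]
  rw [h0, add_zero, ← Finset.sum_filter]
  rw [Finset.sum_congr (g := fun n => ‖z (s.2.take n)‖) rfl]
  · rw [← Finset.sum_image (f := fun t => ‖z t‖) (g := fun n => s.2.take n)]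
    · apply Finset.sum_le_sum_of_subset_of_nonneg
      · intro t ht
        obtain ⟨n, hn, rfl⟩ := Finset.mem_image.1 ht
        have := segy_onseg (Finset.mem_filter.1 hn).2
        simp [this.1, this.2.2]
      · intro _ _ _; exact norm_nonneg _
    · intro n hn m hm hnm
      have h1 := (segy_onseg (Finset.mem_filter.1 hn).2).2.1
      have h2 := (segy_onseg (Finset.mem_filter.1 hm).2).2.1
      have := congrArg List.length hnm
      simpa [h1, h2] using this
  · intro n hn
    have h := (Finset.mem_filter.1 hn).2
    rw [segy_apply] at h ⊢
    split_ifs at h ⊢ with h1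
    · rfl
    · exact absurd rfl h

theorem segp_ne_zero {lab : ℕ → CantorC} {lev : ℕ → ℕ} {s : ℕ × List ℕ} {z : VT}
    (h : segp lab lev s z ≠ 0) : ∃ t ∈ z.support, onseg s t := by
  classical
  by_contra! hc
  apply h
  apply le_antisymm _ (apply_nonneg _ _)
  refine (segp_le lab lev s z).trans ?_
  rw [Finset.sum_eq_zero, mul_zero]
  intro t ht
  rw [if_neg (hc t ht)]

theorem adm_sum_le (lab : ℕ → CantorC) (lev : ℕ → ℕ) {T : Set (List ℕ)}
    {F : Finset (ℕ × List ℕ)} (hF : Adm T F) (z : VT) :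
    ∑ s ∈ F, segp lab lev s z ≤ 4 * ∑ t ∈ z.support, ‖z t‖ := by
  classical
  refine (Finset.sum_le_sum fun s _ => segp_le lab lev s z).trans ?_
  rw [← Finset.mul_sum, Finset.sum_comm]
  gcongr with t ht
  rw [← Finset.sum_filter, Finset.sum_const, nsmul_eq_mul]
  have : (F.filter fun s => onseg s t).card ≤ 1 := by
    rw [Finset.card_le_one]
    intro a ha b hb
    exact hF.unique (Finset.mem_filter.1 ha).1 (Finset.mem_filter.1 hb).1
      (Finset.mem_filter.1 ha).2 (Finset.mem_filter.1 hb).2 (Or.inl (List.prefix_refl t))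
  have h2 : (((F.filter fun s => onseg s t).card : ℕ) : ℝ) ≤ 1 := by exact_mod_cast this
  nlinarith [norm_nonneg (z t)]

/-- the number of segments meeting a finite set -/
theorem adm_card_le {T : Set (List ℕ)} {F : Finset (ℕ × List ℕ)} (hF : Adm T F)
    (A : Finset (List ℕ)) (G : Finset (ℕ × List ℕ)) (hG : G ⊆ F)
    (hm : ∀ s ∈ G, ∃ t ∈ A, onseg s t) : G.card ≤ A.card := by
  classical
  choose! f hf using hm
  refine Finset.card_le_card_of_injOn f (fun s hs => (hf s hs).1) ?_
  intro s hs s' hs' h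
  exact hF.unique (hG hs) (hG hs') (hf s hs).2 (hf s' hs').2 (Or.inl (h ▸ List.prefix_refl _))

/-- the seminorm of a family of segments -/
def nuF (lab : ℕ → CantorC) (lev : ℕ → ℕ) (F : Finset (ℕ × List ℕ)) : Seminorm ℝ VT :=
  (NNReal.sqrt F.card)⁻¹ • ∑ s ∈ F, segp lab lev s

theorem nuF_apply (lab : ℕ → CantorC) (lev : ℕ → ℕ) (F : Finset (ℕ × List ℕ)) (z : VT) :
    nuF lab lev F z = (Real.sqrt F.card)⁻¹ * ∑ s ∈ F, segp lab lev s z := by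
  rw [← seminorm_finset_sum_apply]
  unfold nuF
  rw [smul_apply]
  rw [NNReal.smul_def]
  simp

theorem nuF_le (lab : ℕ → CantorC) (lev : ℕ → ℕ) (F : Finset (ℕ × List ℕ)) (z : VT) (M : ℝ)
    (hM : 0 ≤ M) (h : ∑ s ∈ F, segp lab lev s z ≤ Real.sqrt F.card * M) :
    nuF lab lev F z ≤ M := by
  rw [nuF_apply]
  rcases Nat.eq_zero_or_pos F.card with h0 | h0
  · rw [h0]; simpa using hM
  · have : 0 < Real.sqrt F.card := Real.sqrt_pos.2 (by exact_mod_cast h0)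
    rw [inv_mul_le_iff₀ this]
    exact h

theorem sqrt_card_ge {F : Finset (ℕ × List ℕ)} (hF : F.Nonempty) : 1 ≤ Real.sqrt F.card := by
  rw [Real.one_le_sqrt]
  exact_mod_cast hF.card_pos

theorem nuF_le' (lab : ℕ → CantorC) (lev : ℕ → ℕ) (F : Finset (ℕ × List ℕ)) (z : VT) (M : ℝ)
    (hM : 0 ≤ M) (h : ∑ s ∈ F, segp lab lev s z ≤ M) :
    nuF lab lev F z ≤ M := by
  apply nuF_le _ _ _ _ _ hM
  rcases F.eq_empty_or_nonempty with rfl | hF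
  · simp
  · have := sqrt_card_ge hF
    nlinarith

/-- the tree seminorm -/
def nu (lab : ℕ → CantorC) (lev : ℕ → ℕ) (T : Set (List ℕ)) : Seminorm ℝ VT :=
  ⨆ F : {F : Finset (ℕ × List ℕ) // Adm T F}, nuF lab lev F.1

theorem nu_bdd (lab : ℕ → CantorC) (lev : ℕ → ℕ) (T : Set (List ℕ)) :
    BddAbove (Set.range fun F : {F : Finset (ℕ × List ℕ) // Adm T F} => nuF lab lev F.1) := by
  rw [Seminorm.bddAbove_range_iff]
  intro z
  refine ⟨4 * ∑ t ∈ z.support, ‖z t‖, ?_⟩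
  rintro _ ⟨F, rfl⟩
  exact nuF_le' _ _ _ _ _ (by positivity) (adm_sum_le lab lev F.2 z)

theorem nu_apply (lab : ℕ → CantorC) (lev : ℕ → ℕ) (T : Set (List ℕ)) (z : VT) :
    nu lab lev T z = ⨆ F : {F : Finset (ℕ × List ℕ) // Adm T F}, nuF lab lev F.1 z :=
  Seminorm.iSup_apply (nu_bdd lab lev T)

theorem nu_le (lab : ℕ → CantorC) (lev : ℕ → ℕ) (T : Set (List ℕ)) (z : VT) (M : ℝ)
    (hM : 0 ≤ M)
    (h : ∀ F, Adm T F → ∑ s ∈ F, segp lab lev s z ≤ Real.sqrt F.card * M) :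
    nu lab lev T z ≤ M := by
  rw [nu_apply]
  exact Real.iSup_le (fun F => nuF_le _ _ _ _ _ hM (h F.1 F.2)) hM

theorem sum_le_nu (lab : ℕ → CantorC) (lev : ℕ → ℕ) {T : Set (List ℕ)} {F : Finset (ℕ × List ℕ)}
    (hF : Adm T F) (z : VT) :
    ∑ s ∈ F, segp lab lev s z ≤ Real.sqrt F.card * nu lab lev T z := by
  have h1 : nuF lab lev F z ≤ nu lab lev T z := by
    rw [nu_apply]
    exact le_ciSup (f := fun F : {F : Finset (ℕ × List ℕ) // Adm T F} => nuF lab lev F.1 z)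
      (Seminorm.bddAbove_range_iff.1 (nu_bdd lab lev T) z) ⟨F, hF⟩
  rcases F.eq_empty_or_nonempty with rfl | hne
  · simp
  · have := sqrt_card_ge hne
    rw [nuF_apply, inv_mul_le_iff₀ (by linarith)] at h1
    exact h1

theorem adm_singleton {T : Set (List ℕ)} {s : ℕ × List ℕ} (h : s.2 ∈ T) (h' : s.1 ≤ s.2.length) :
    Adm T {s} := by
  constructor
  · intro t ht; rw [Finset.mem_singleton.1 ht]; exact ⟨h, h'⟩
  · intro t ht t' ht' _; rw [Finset.mem_singleton.1 ht, Finset.mem_singleton.1 ht']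

theorem segp_le_nu (lab : ℕ → CantorC) (lev : ℕ → ℕ) {T : Set (List ℕ)} {s : ℕ × List ℕ}
    (h : s.2 ∈ T) (h' : s.1 ≤ s.2.length) (z : VT) : segp lab lev s z ≤ nu lab lev T z := by
  have := sum_le_nu lab lev (adm_singleton h h') z
  simpa using this

theorem nu_le_sum (lab : ℕ → CantorC) (lev : ℕ → ℕ) (T : Set (List ℕ)) (z : VT) :
    nu lab lev T z ≤ 4 * ∑ t ∈ z.support, ‖z t‖ := by
  rw [nu_apply]
  exact Real.iSup_le (fun F => nuF_le' _ _ _ _ _ (by positivity) (adm_sum_le lab lev F.2 z))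
    (by positivity)

/-- if the support is a chain, the norm is computed by single segments -/
theorem nu_le_chain (lab : ℕ → CantorC) (lev : ℕ → ℕ) (T : Set (List ℕ)) (z : VT) (M : ℝ)
    (hM : 0 ≤ M) (hz : ∀ t ∈ z.support, ∀ t' ∈ z.support, t <+: t' ∨ t' <+: t)
    (h : ∀ s : ℕ × List ℕ, s.2 ∈ T → s.1 ≤ s.2.length → segp lab lev s z ≤ M) :
    nu lab lev T z ≤ M := by
  rw [nu_apply]
  refine Real.iSup_le (fun F => nuF_le' _ _ _ _ _ hM ?_) hM
  by_cases hex : ∃ s ∈ F.1, segp lab lev s z ≠ 0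
  · obtain ⟨s, hs, hne⟩ := hex
    rw [Finset.sum_eq_single_of_mem s hs]
    · exact h s (F.2.1 s hs).1 (F.2.1 s hs).2
    · intro s' hs' hss
      by_contra hne'
      obtain ⟨t, ht, hst⟩ := segp_ne_zero hne
      obtain ⟨t', ht', hst'⟩ := segp_ne_zero hne'
      exact hss (F.2.unique hs' hs hst' hst (hz t' ht' t ht))
  · push Not at hex
    rw [Finset.sum_eq_zero hex]
    exact hM

/-! ### segments: restriction -/

theorem segp_cut (lab : ℕ → CantorC) (lev : ℕ → ℕ) (b : List ℕ) (k : ℕ) (hk : k ≤ b.length)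
    (z : VT) : segp lab lev (0, b.take k) z ≤ 2 * segp lab lev (0, b) z := by
  rw [segp_apply, segp_apply]
  refine le_of_eq_of_le ?_ (Pif_cut (lseg lev b) (lseg_mono lev b) (Eseg lab b) (Eseg_mono lab b)
    (b.length + 1) (fun n => segy (0, b) n z) (segy_end (0, b) z) k (by omega))
  have hlen : (b.take k).length = k := by simp [hk]
  simp only [hlen]
  apply Pif_congr
  · intro n hn; simp only [lseg, List.take_take]; congr 2; omega
  · intro n hn; simp only [Eseg, List.take_take]; congr 2; omega
  · intro n hn
    simp only [segy_apply, List.take_take, hlen]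
    by_cases h : n ≤ k
    · rw [if_pos (by omega), if_pos h, if_pos (by omega), min_eq_left h]
    · rw [if_neg (by omega), if_neg h]

theorem segp_top (lab : ℕ → CantorC) (lev : ℕ → ℕ) (b : List ℕ) (j : ℕ) (hj : j ≤ b.length)
    (z : VT) : segp lab lev (j, b) z ≤ 3 * segp lab lev (0, b) z := by
  rw [segp_apply, segp_apply]
  refine le_of_eq_of_le ?_ (Pif_top (lseg lev b) (lseg_mono lev b) (Eseg lab b) (Eseg_mono lab b)
    (b.length + 1) (fun n => segy (0, b) n z) (segy_end (0, b) z) j (by omega))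
  apply Pif_congr (fun _ _ => rfl) (fun _ _ => rfl)
  intro n hn
  simp only [segy_apply]
  by_cases h : j ≤ n
  · by_cases h' : n ≤ b.length
    · rw [if_pos ⟨h, h'⟩, if_pos h, if_pos (by omega)]
    · rw [if_neg (by omega), if_pos h, if_neg (by omega)]
  · rw [if_neg (by omega), if_neg h]

theorem Pif_add_le (l : ℕ → ℕ) (E : ℕ → Submodule ℝ CantorC) (M : ℕ) (y y' : ℕ → CantorC) :
    Pif l E M (fun n => y n + y' n) ≤ Pif l E M y + Pif l E M y' := by
  have hw : ∀ n, wv l (fun n => y n + y' n) n = wv l y n + wv l y' n := by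
    intro n; simp only [wv]; rw [← map_add]; congr 1; abel
  unfold Pif
  simp only [hw]
  rw [Finset.sum_add_distrib]
  have h1 := norm_add_le (∑ n ∈ Finset.range M, wv l y n) (∑ n ∈ Finset.range M, wv l y' n)
  have h2 : ∑ n ∈ Finset.range M, dq (E n) (wv l y n + wv l y' n) ≤
      ∑ n ∈ Finset.range M, dq (E n) (wv l y n) + ∑ n ∈ Finset.range M, dq (E n) (wv l y' n) := by
    rw [← Finset.sum_add_distrib]
    exact Finset.sum_le_sum fun n _ => map_add_le_add _ _ _
  linarith

theorem segp_split (lab : ℕ → CantorC) (lev : ℕ → ℕ) (b : List ℕ) (k : ℕ) (hk : k ≤ b.length)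
    (z : VT) :
    segp lab lev (0, b) z ≤ segp lab lev (0, b.take k) z + segp lab lev (k + 1, b) z := by
  have h1 : segp lab lev (0, b.take k) z = Pif (lseg lev b) (Eseg lab b) (b.length + 1)
      (fun n => if n ≤ k then segy (0, b) n z else 0) := by
    rw [segp_apply, Pif_extend (lseg lev b) (Eseg lab b) (M := k + 1) _ (by omega)
      (fun n hn => if_neg (by omega))]
    have hlen : (b.take k).length = k := by simp [hk]
    simp only [hlen]
    apply Pif_congr
    · intro n hn; simp only [lseg, List.take_take]; congr 2; omega
    · intro n hn; simp only [Eseg, List.take_take]; congr 2; omega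
    · intro n hn
      simp only [segy_apply, List.take_take, hlen]
      by_cases h : n ≤ k
      · rw [if_pos (by omega), if_pos h, if_pos (by omega), min_eq_left h]
      · rw [if_neg (by omega), if_neg h]
  rw [h1, segp_apply, segp_apply]
  refine le_of_eq_of_le ?_ (Pif_add_le _ _ _ _ _)
  apply Pif_congr (fun _ _ => rfl) (fun _ _ => rfl)
  intro n hn
  simp only [segy_apply]
  by_cases h : n ≤ k
  · rw [if_pos h, if_neg (c := k + 1 ≤ n ∧ n ≤ b.length) (by omega), add_zero]
  · rw [if_neg h, zero_add]
    by_cases h' : n ≤ b.length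
    · rw [if_pos (by omega), if_pos (by omega)]
    · rw [if_neg (by omega), if_neg (by omega)]

/-! ### branches -/

/-- initial segments of a branch -/
def pfx (σ : ℕ → ℕ) (n : ℕ) : List ℕ := (List.range n).map σ

@[simp] theorem pfx_length (σ : ℕ → ℕ) (n : ℕ) : (pfx σ n).length = n := by simp [pfx]

theorem pfx_take (σ : ℕ → ℕ) {n k : ℕ} (h : k ≤ n) : (pfx σ n).take k = pfx σ k := by
  rw [pfx, ← List.map_take, List.take_range, min_eq_left h, pfx]

theorem pfx_succ (σ : ℕ → ℕ) (n : ℕ) : pfx σ (n + 1) = pfx σ n ++ [σ n] := by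
  simp [pfx, List.range_succ]

theorem pfx_prefix (σ : ℕ → ℕ) {n k : ℕ} (h : k ≤ n) : pfx σ k <+: pfx σ n := by
  rw [← pfx_take σ h]; exact List.take_prefix _ _

theorem pfx_inj (σ : ℕ → ℕ) {n k : ℕ} (h : pfx σ n = pfx σ k) : n = k := by
  have := congrArg List.length h
  simpa using this

/-- the tree of a set of branches -/
def Tr (B : Set (ℕ → ℕ)) : Set (List ℕ) := {t | ∃ σ ∈ B, ∃ n, t = pfx σ n}

theorem Tr_take {B : Set (ℕ → ℕ)} {t : List ℕ} (h : t ∈ Tr B) (k : ℕ) : t.take k ∈ Tr B := by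
  obtain ⟨σ, hσ, n, rfl⟩ := h
  rcases le_total k n with h | h
  · rw [pfx_take σ h]; exact ⟨σ, hσ, k, rfl⟩
  · rw [List.take_of_length_le (by simpa using h)]; exact ⟨σ, hσ, n, rfl⟩

end

noncomputable section

/-! ### Embedding the branch spaces -/

/-- the embedding of the branch space -/
def Bmap (lab : ℕ → CantorC) (lev : ℕ → ℕ) (σ : ℕ → ℕ) : (ℕ →₀ ℝ) →ₗ[ℝ] VT :=
  Finsupp.linearCombination ℝ fun n => ∑ k ∈ Finset.range (n + 2),
    Finsupp.single (pfx σ k) (QQ (lvt lev (pfx σ k)) (lab (σ n)))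

/-- tails -/
def tailv (lab : ℕ → CantorC) (σ : ℕ → ℕ) (a : ℕ →₀ ℝ) (k : ℕ) : CantorC :=
  a.sum fun n c => if k ≤ n + 1 then c • lab (σ n) else 0

theorem Bmap_pfx (lab : ℕ → CantorC) (lev : ℕ → ℕ) (σ : ℕ → ℕ) (a : ℕ →₀ ℝ) (k : ℕ) :
    Bmap lab lev σ a (pfx σ k) = QQ (lvt lev (pfx σ k)) (tailv lab σ a k) := by
  rw [Bmap, Finsupp.linearCombination_apply, tailv, Finsupp.sum, Finsupp.sum, map_sum,
    Finsupp.finsetSum_apply]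
  refine Finset.sum_congr rfl fun n _ => ?_
  rw [Finsupp.smul_apply, Finsupp.finsetSum_apply]
  by_cases h : k ≤ n + 1
  · rw [if_pos h, map_smul, Finset.sum_eq_single_of_mem k (Finset.mem_range.2 (by omega))]
    · rw [Finsupp.single_eq_same]
    · intro m _ hm
      rw [Finsupp.single_apply, if_neg]
      exact fun h => hm (pfx_inj σ h)
  · rw [if_neg h, map_zero, Finset.sum_eq_zero, smul_zero]
    intro m hm
    rw [Finsupp.single_apply, if_neg]
    intro h'
    have := pfx_inj σ h'
    have := Finset.mem_range.1 hm
    omega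

theorem Bmap_supp (lab : ℕ → CantorC) (lev : ℕ → ℕ) (σ : ℕ → ℕ) (a : ℕ →₀ ℝ) (t : List ℕ)
    (h : Bmap lab lev σ a t ≠ 0) : ∃ k, t = pfx σ k := by
  by_contra! hc
  apply h
  rw [Bmap, Finsupp.linearCombination_apply, Finsupp.sum, Finsupp.finsetSum_apply]
  apply Finset.sum_eq_zero
  intro n _
  rw [Finsupp.smul_apply, Finsupp.finsetSum_apply, Finset.sum_eq_zero, smul_zero]
  intro m _
  rw [Finsupp.single_apply, if_neg]
  exact fun h => hc m h.symm

theorem tailv_sub (lab : ℕ → CantorC) (σ : ℕ → ℕ) (a : ℕ →₀ ℝ) (k : ℕ) :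
    tailv lab σ a (k + 1) - tailv lab σ a (k + 2) = a k • lab (σ k) := by
  rw [tailv, tailv, Finsupp.sum, Finsupp.sum, ← Finset.sum_sub_distrib]
  by_cases hk : k ∈ a.support
  · rw [Finset.sum_eq_single_of_mem k hk]
    · rw [if_pos (by omega), if_neg (by omega), sub_zero]
    · intro n _ hn
      by_cases h : k ≤ n
      · rw [if_pos (by omega), if_pos (by omega), sub_self]
      · rw [if_neg (by omega), if_neg (by omega), sub_self]
  · rw [Finset.sum_eq_zero, Finsupp.notMem_support_iff.1 hk, zero_smul]
    intro n hn
    have hnk : n ≠ k := fun h => hk (h ▸ hn)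
    by_cases h : k ≤ n
    · rw [if_pos (by omega), if_pos (by omega), sub_self]
    · rw [if_neg (by omega), if_neg (by omega), sub_self]

theorem tailv_zero (lab : ℕ → CantorC) (σ : ℕ → ℕ) (a : ℕ →₀ ℝ) :
    tailv lab σ a 0 = tailv lab σ a 1 := by
  rw [tailv, tailv, Finsupp.sum, Finsupp.sum]
  exact Finset.sum_congr rfl fun n _ => by rw [if_pos (by omega), if_pos (by omega)]

/-- levels along a branch -/
def lb (lev : ℕ → ℕ) (σ : ℕ → ℕ) (n : ℕ) : ℕ := lvt lev (pfx σ n)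
/-- spaces along a branch -/
def Eb (lab : ℕ → CantorC) (σ : ℕ → ℕ) (n : ℕ) : Submodule ℝ CantorC := Et lab (pfx σ n)

theorem lb_mono (lev : ℕ → ℕ) (σ : ℕ → ℕ) : Monotone (lb lev σ) :=
  fun _ _ h => lvt_mono lev (pfx_prefix σ h).subset

theorem Eb_mono (lab : ℕ → CantorC) (σ : ℕ → ℕ) : Monotone (Eb lab σ) :=
  fun _ _ h => Et_mono lab (pfx_prefix σ h).subset

theorem mem_pfx (σ : ℕ → ℕ) (n : ℕ) : σ n ∈ pfx σ (n + 1) := by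
  rw [pfx_succ]; simp

theorem wv_Bmap (lab : ℕ → CantorC) (lev : ℕ → ℕ) (hlev : ∀ i, QQ (lev i) (lab i) = lab i)
    (σ : ℕ → ℕ) (a : ℕ →₀ ℝ) (k : ℕ) :
    wv (lb lev σ) (fun n => Bmap lab lev σ a (pfx σ n)) k =
      if k = 0 then 0 else a (k - 1) • lab (σ (k - 1)) := by
  have h1 : wv (lb lev σ) (fun n => Bmap lab lev σ a (pfx σ n)) k =
      QQ (lb lev σ k) (tailv lab σ a k - tailv lab σ a (k + 1)) := by
    rw [wv, Bmap_pfx, Bmap_pfx, map_sub, map_sub]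
    change QQ (lb lev σ k) (QQ (lb lev σ k) _) - QQ (lb lev σ k) (QQ (lb lev σ (k + 1)) _) = _
    rw [QQ_QQ, QQ_QQ, min_self, min_eq_left (lb_mono lev σ (Nat.le_succ k))]
  rw [h1]
  rcases Nat.eq_zero_or_pos k with rfl | hk
  · rw [if_pos rfl, zero_add, tailv_zero, sub_self, map_zero]
  · obtain ⟨i, rfl⟩ : ∃ i, k = i + 1 := ⟨k - 1, by omega⟩
    rw [if_neg (by omega), tailv_sub, map_smul, Nat.add_sub_cancel]
    rw [← hlev (σ i), QQ_QQ, min_eq_right]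
    exact le_lvt lev (mem_pfx σ i)

theorem segp_pfx (lab : ℕ → CantorC) (lev : ℕ → ℕ) (σ : ℕ → ℕ) (N : ℕ) (z : VT) :
    segp lab lev (0, pfx σ N) z =
      Pif (lb lev σ) (Eb lab σ) (N + 1) (fun n => if n ≤ N then z (pfx σ n) else 0) := by
  rw [segp_apply]
  simp only [pfx_length]
  apply Pif_congr
  · intro n hn; rw [lseg, pfx_take σ (by omega), lb]
  · intro n hn; rw [Eseg, pfx_take σ (by omega), Eb]
  · intro n hn
    rw [segy_apply]
    simp only [pfx_length, Nat.zero_le, true_and]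
    split_ifs with h
    · rw [pfx_take σ h]
    · rfl

theorem segp_Bmap (lab : ℕ → CantorC) (lev : ℕ → ℕ) (hlev : ∀ i, QQ (lev i) (lab i) = lab i)
    (σ : ℕ → ℕ) (a : ℕ →₀ ℝ) (N : ℕ) (hN : ∀ n ≥ N, a n = 0) :
    segp lab lev (0, pfx σ N) (Bmap lab lev σ a) =
      ‖Finsupp.linearCombination ℝ (lab ∘ σ) a‖ := by
  have hz : ∀ n, N + 1 ≤ n → Bmap lab lev σ a (pfx σ n) = 0 := by
    intro n hn
    rw [Bmap_pfx, tailv, Finsupp.sum, Finset.sum_eq_zero, map_zero]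
    intro m hm
    rw [if_neg]
    intro h
    exact (Finsupp.mem_support_iff.1 hm) (hN m (by omega))
  have hy : (fun n => if n ≤ N then Bmap lab lev σ a (pfx σ n) else 0) =
      fun n => Bmap lab lev σ a (pfx σ n) := by
    funext n
    split_ifs with h
    · rfl
    · rw [hz n (by omega)]
  rw [segp_pfx, hy, Pif]
  have h2 : ∑ n ∈ Finset.range (N + 1),
      dq (Eb lab σ n) (wv (lb lev σ) (fun n => Bmap lab lev σ a (pfx σ n)) n) = 0 := by
    apply Finset.sum_eq_zero
    intro n _
    rw [wv_Bmap lab lev hlev]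
    apply dq_of_mem
    rcases Nat.eq_zero_or_pos n with rfl | hk
    · simp
    · obtain ⟨i, rfl⟩ : ∃ i, n = i + 1 := ⟨n - 1, by omega⟩
      rw [if_neg (by omega)]
      apply Submodule.smul_mem
      exact Submodule.subset_span ⟨σ i, mem_pfx σ i, rfl⟩
  rw [h2, add_zero]
  congr 1
  rw [Finset.sum_congr rfl fun n _ => wv_Bmap lab lev hlev σ a n, Finset.sum_range_succ', if_pos rfl,
    add_zero, Finsupp.linearCombination_apply]
  rw [Finsupp.sum_of_support_subset a (s := Finset.range N)]
  · exact Finset.sum_congr rfl fun n _ => by simp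
  · intro n hn
    rw [Finset.mem_range]
    by_contra h
    exact (Finsupp.mem_support_iff.1 hn) (hN n (by omega))
  · intro n _; simp

theorem segp_out (lab : ℕ → CantorC) (lev : ℕ → ℕ) (b : List ℕ) (j : ℕ) (hj : b.length < j)
    (z : VT) : segp lab lev (j, b) z = 0 := by
  apply le_antisymm _ (apply_nonneg _ _)
  rw [segp_apply]
  refine (Pif_le _ _ _ _ (segy_end _ z)).trans ?_
  rw [Finset.sum_eq_zero, mul_zero]
  intro n hn
  rw [segy_apply, if_neg, norm_zero]
  simp only
  omega

theorem nu_Bmap (lab : ℕ → CantorC) (lev : ℕ → ℕ) (hlev : ∀ i, QQ (lev i) (lab i) = lab i)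
    (B : Set (ℕ → ℕ)) (σ : ℕ → ℕ) (hσ : σ ∈ B) (a : ℕ →₀ ℝ) :
    ‖Finsupp.linearCombination ℝ (lab ∘ σ) a‖ ≤ nu lab lev (Tr B) (Bmap lab lev σ a) ∧
    nu lab lev (Tr B) (Bmap lab lev σ a) ≤ 6 * ‖Finsupp.linearCombination ℝ (lab ∘ σ) a‖ := by
  obtain ⟨N₀, hN₀⟩ : ∃ N₀, ∀ n ≥ N₀, a n = 0 := by
    refine ⟨a.support.sup id + 1, fun n hn => ?_⟩
    by_contra h
    have : n ≤ a.support.sup id := Finset.le_sup (f := id) (Finsupp.mem_support_iff.2 h)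
    omega
  constructor
  · rw [← segp_Bmap lab lev hlev σ a N₀ hN₀]
    have hT : pfx σ N₀ ∈ Tr B := ⟨σ, hσ, N₀, rfl⟩
    exact segp_le_nu lab lev (s := (0, pfx σ N₀)) hT (Nat.zero_le _) _
  · apply nu_le_chain _ _ _ _ _ (by positivity)
    · intro t ht t' ht'
      obtain ⟨k, rfl⟩ := Bmap_supp lab lev σ a t (Finsupp.mem_support_iff.1 ht)
      obtain ⟨k', rfl⟩ := Bmap_supp lab lev σ a t' (Finsupp.mem_support_iff.1 ht')
      rcases le_total k k' with h | h
      · exact Or.inl (pfx_prefix σ h)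
      · exact Or.inr (pfx_prefix σ h)
    · rintro ⟨j, b⟩ hb hj
      set z := Bmap lab lev σ a with hz
      simp only at hb hj
      have hP0 : b.take 0 = pfx σ 0 := by simp [pfx]
      classical
      set K := Nat.findGreatest (fun m => b.take m = pfx σ m) b.length with hK
      have hK1 : b.take K = pfx σ K :=
        Nat.findGreatest_spec (P := fun m => b.take m = pfx σ m) (Nat.zero_le _) hP0
      have hKl : K ≤ b.length := Nat.findGreatest_le _
      have h0 : segp lab lev (K + 1, b) z = 0 := by
        by_contra hne
        obtain ⟨t, ht, h1, h2⟩ := segp_ne_zero hne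
        obtain ⟨k, rfl⟩ := Bmap_supp lab lev σ a t (Finsupp.mem_support_iff.1 ht)
        have hbk : b.take k = pfx σ k := by
          have := List.prefix_iff_eq_take.1 h2
          rw [pfx_length] at this
          exact this.symm
        have hkl : k ≤ b.length := by simpa using h2.length_le
        have hkK : k ≤ K := Nat.le_findGreatest hkl hbk
        have := h1.length_le
        simp only [List.length_take, pfx_length] at this
        have hbK : b.length = K := by omega
        exact hne (segp_out lab lev b (K + 1) (by omega) z)
      have h1 := segp_split lab lev b K hKl z
      have h2 := segp_top lab lev b j hj z
      have h3 := segp_cut lab lev (pfx σ (max K N₀)) K (by simp) z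
      rw [pfx_take σ (le_max_left _ _), segp_Bmap lab lev hlev σ a _
        (fun n hn => hN₀ n ((le_max_right _ _).trans hn))] at h3
      rw [hK1, h0] at h1
      linarith

end

noncomputable section

theorem not_finDim_CantorC : ¬ FiniteDimensional ℝ CantorC := by
  intro hfd
  have : ∃ g : ℕ → CantorC, LinearIndependent ℝ g := by
    refine ⟨fun i => ⟨fun x : CantorSet => if x i then 1 else 0, ?_⟩, ?_⟩
    · have : Continuous fun x : CantorSet => x i := continuous_apply i
      exact (continuous_of_discreteTopology (f := fun b : Bool => if b then (1 : ℝ) else 0)).comp this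
    · rw [linearIndependent_iff']
      intro s c hc i hi
      have h1 := congrArg (fun f : CantorC => f (fun j => decide (j = i))) hc
      simp only [ContinuousMap.coe_sum, Finset.sum_apply, ContinuousMap.coe_smul, Pi.smul_apply,
        ContinuousMap.coe_mk, ContinuousMap.zero_apply, decide_eq_true_eq, smul_eq_mul] at h1
      simpa [hi] using h1
  obtain ⟨g, hg⟩ := this
  have h := hg.lt_aleph0_of_finiteDimensional
  simp at h

/-- finite-codimensional kernels on copies of `C` -/
theorem exists_ker {Y : Type*} [AddCommGroup Y] [Module ℝ Y] (N : ℕ → Submodule ℝ Y)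
    (hN : ∀ k, FiniteDimensional ℝ (Y ⧸ N k)) (T : CantorC →ₗ[ℝ] Y) (L : ℕ) :
    ∃ f : CantorC, ‖f‖ = 1 ∧ ∀ k < L, T f ∈ N k := by
  let Φ : CantorC →ₗ[ℝ] (∀ k : Fin L, Y ⧸ N k) := LinearMap.pi fun k => (N k).mkQ ∘ₗ T
  have hni : ¬ Function.Injective Φ := fun h =>
    not_finDim_CantorC (FiniteDimensional.of_injective Φ h)
  rw [← LinearMap.ker_eq_bot, Submodule.eq_bot_iff] at hni
  push Not at hni
  obtain ⟨f, hf, hf0⟩ := hni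
  have hfn : ‖f‖ ≠ 0 := norm_ne_zero_iff.2 hf0
  refine ⟨‖f‖⁻¹ • f, by rw [norm_smul, norm_inv, norm_norm, inv_mul_cancel₀ hfn], fun k hk => ?_⟩
  rw [map_smul]
  apply Submodule.smul_mem
  have h1 : Φ f = 0 := hf
  have h2 := congrFun h1 ⟨k, hk⟩
  simpa [Φ] using h2

/-- a seminorm which factors through a finite dimensional space on a dense subspace has
finite-codimensional kernel -/
theorem finDim_quot {V Y W : Type*} [AddCommGroup V] [Module ℝ V] [NormedAddCommGroup Y]
    [NormedSpace ℝ Y] [AddCommGroup W] [Module ℝ W] [FiniteDimensional ℝ W]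
    (A : V →ₗ[ℝ] Y) (hA : DenseRange A) (w : V →ₗ[ℝ] W) (q : Seminorm ℝ Y) (K : ℝ)
    (hq : ∀ y, q y ≤ K * ‖y‖) (h : ∀ v, w v = 0 → q (A v) = 0) :
    ∃ N : Submodule ℝ Y, FiniteDimensional ℝ (Y ⧸ N) ∧ ∀ y ∈ N, q y = 0 := by
  let N : Submodule ℝ Y :=
    { carrier := {y | q y = 0}
      zero_mem' := map_zero q
      add_mem' := by
        intro a b ha hb
        have := map_add_le_add q a b
        rw [Set.mem_ofPred_eq] at *
        exact le_antisymm (by linarith) (apply_nonneg _ _)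
      smul_mem' := by
        intro c a ha
        rw [Set.mem_ofPred_eq] at *
        rw [map_smul_eq_mul, ha, mul_zero] }
  have hNc : IsClosed (N : Set Y) :=
    isClosed_singleton.preimage (seminorm_continuous q K hq)
  obtain ⟨s, hs⟩ : ∃ s : LinearMap.range w →ₗ[ℝ] V, w.rangeRestrict ∘ₗ s = LinearMap.id :=
    w.rangeRestrict.exists_rightInverse_of_surjective w.range_rangeRestrict
  let U : Submodule ℝ Y := LinearMap.range (A ∘ₗ s)
  have hU : FiniteDimensional ℝ U := inferInstance
  have hcl : IsClosed ((N ⊔ U : Submodule ℝ Y) : Set Y) :=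
    Submodule.isClosed_sup_finiteDimensional _ _ hNc
  have htop : N ⊔ U = ⊤ := by
    rw [eq_top_iff]
    intro y _
    have : (Set.range A) ⊆ ((N ⊔ U : Submodule ℝ Y) : Set Y) := by
      rintro _ ⟨v, rfl⟩
      have h1 : A v = A (v - s (w.rangeRestrict v)) + A (s (w.rangeRestrict v)) := by
        rw [← map_add, sub_add_cancel]
      rw [h1]
      apply Submodule.add_mem_sup
      · apply h
        have h2 : w (s (w.rangeRestrict v)) = w v :=
          congrArg Subtype.val (LinearMap.congr_fun hs (w.rangeRestrict v))
        rw [map_sub, h2, sub_self]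
      · exact ⟨w.rangeRestrict v, rfl⟩
    exact hcl.closure_subset_iff.2 this (hA y)
  refine ⟨N, ?_, fun y hy => hy⟩
  have hsurj : Function.Surjective (N.mkQ ∘ₗ U.subtype) := by
    intro x
    obtain ⟨y, rfl⟩ := N.mkQ_surjective x
    have hy : y ∈ N ⊔ U := htop ▸ Submodule.mem_top
    obtain ⟨n, hn, u, hu, rfl⟩ := Submodule.mem_sup.1 hy
    refine ⟨⟨u, hu⟩, ?_⟩
    simp only [LinearMap.comp_apply, Submodule.subtype_apply, map_add]
    have : N.mkQ n = 0 := by simpa using hn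
    rw [this, zero_add]
  exact Module.Finite.of_surjective _ hsurj

/-- the `ℓ₁`-sum argument -/
theorem no_l1 {Y : Type*} [AddCommGroup Y] [Module ℝ Y] (N : ℕ → Submodule ℝ Y)
    (hN : ∀ k, FiniteDimensional ℝ (Y ⧸ N k)) (p : ℕ → Seminorm ℝ Y)
    (hp : ∀ k, ∀ y ∈ N k, p k y = 0) (ρ : Seminorm ℝ Y)
    (hρ : ∀ L y, ∑ k ∈ Finset.range L, p k y ≤ ρ y)
    (hρ' : ∀ y, ∀ η > 0, ∃ L, ρ y ≤ ∑ k ∈ Finset.range L, p k y + η)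
    (T : CantorC →ₗ[ℝ] Y) (K : ℝ) (hK : ∀ f, ρ (T f) ≤ K * ‖f‖) (c : ℝ) (hc : 0 < c)
    (h : ∀ f, c * ‖f‖ ≤ ρ (T f)) : False := by
  let Kc : ℕ → Copy := fun n => n.rec LinearIsometry.id (fun _ J => J.comp RH)
  have hKc : ∀ n f, Kc (n + 1) f = Kc n (RH ((LinearIsometry.id : Copy) f)) := fun n f => rfl
  have hstep : ∀ i L : ℕ, ∃ (f : CantorC) (L' : ℕ), L ≤ L' ∧ ‖f‖ = 1 ∧
      c / 2 ≤ ∑ k ∈ Finset.Ico L L', p k (T (Kc i (LH f))) := by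
    intro i L
    obtain ⟨f, hf1, hf⟩ := exists_ker N hN (T ∘ₗ ((Kc i).comp LH).toLinearMap) L
    obtain ⟨L', hL'⟩ := hρ' (T (Kc i (LH f))) (c / 2) (by linarith)
    refine ⟨f, max L L', le_max_left _ _, hf1, ?_⟩
    have h1 := h (Kc i (LH f))
    rw [LinearIsometry.norm_map, LinearIsometry.norm_map, hf1, mul_one] at h1
    have h2 : ∑ k ∈ Finset.range L', p k (T (Kc i (LH f))) ≤
        ∑ k ∈ Finset.range (max L L'), p k (T (Kc i (LH f))) :=
      Finset.sum_le_sum_of_subset_of_nonneg (Finset.range_mono (le_max_right _ _))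
        fun _ _ _ => apply_nonneg _ _
    have h3 := Finset.sum_range_add_sum_Ico (fun k => p k (T (Kc i (LH f)))) (le_max_left L L')
    have h4 : ∑ k ∈ Finset.range L, p k (T (Kc i (LH f))) = 0 :=
      Finset.sum_eq_zero fun k hk => hp k _ (hf k (Finset.mem_range.1 hk))
    linarith
  choose f g hg hf1 hfg using hstep
  let L : ℕ → ℕ := fun n => n.rec 0 (fun i l => g i l)
  have hL : ∀ i, L (i + 1) = g i (L i) := fun i => rfl
  let q : ℕ → Seminorm ℝ Y := fun i => ∑ k ∈ Finset.Ico (L i) (L (i + 1)), p k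
  let hh : ℕ → CantorC := fun i => f i (L i)
  have key : ∀ m : ℕ, (m : ℝ) * (c / 2) ≤ K := by
    intro m
    obtain ⟨θ, hθ, hs⟩ := sign_lemma m (fun i => T (Kc i (LH (hh i)))) q
    have h1 : (m : ℝ) * (c / 2) ≤ ∑ i ∈ Finset.range m, q i (T (Kc i (LH (hh i)))) := by
      rw [← nsmul_eq_mul]
      refine le_trans ?_ (Finset.card_nsmul_le_sum (Finset.range m) _ (c / 2) fun i _ => ?_)
      · rw [Finset.card_range]
      · simp only [q]
        rw [seminorm_finset_sum_apply]
        exact hfg i (L i)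
    set y := ∑ j ∈ Finset.range m, θ j • T (Kc j (LH (hh j))) with hy
    have h2 : ∑ i ∈ Finset.range m, q i y = ∑ k ∈ Finset.range (L m), p k y := by
      have : ∀ m, ∑ i ∈ Finset.range m, q i y = ∑ k ∈ Finset.range (L m), p k y := by
        intro m
        induction m with
        | zero => simp [L]
        | succ m ih =>
          rw [Finset.sum_range_succ, ih]
          simp only [q]
          rw [seminorm_finset_sum_apply, Finset.sum_range_add_sum_Ico _ (hg m (L m))]
      exact this m
    have h3 : y = T (∑ j ∈ Finset.range m, Kc j (LH (θ j • hh j))) := by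
      rw [hy, map_sum]
      exact Finset.sum_congr rfl fun j _ => by simp only [map_smul]
    have h4 := norm_chain_le Kc _ hKc (fun j => θ j • hh j) 1 zero_le_one
      (fun n => by rw [norm_smul, Real.norm_eq_abs, hθ, one_mul]; exact (hf1 _ _).le) m
    have h5 := hK (∑ j ∈ Finset.range m, Kc j (LH (θ j • hh j)))
    rw [← h3] at h5
    have h6 := hρ (L m) y
    have hK0 : 0 ≤ K := by
      have h7 := hK 1
      have h8 := h 1
      have h9 : ‖(1 : CantorC)‖ = 1 := norm_one
      rw [h9] at h7 h8
      linarith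
    have : K * ‖∑ j ∈ Finset.range m, Kc j (LH (θ j • hh j))‖ ≤ K := by
      nlinarith
    linarith
  obtain ⟨m, hm⟩ := exists_nat_gt (K / (c / 2))
  have := key m
  rw [div_lt_iff₀ (by linarith)] at hm
  linarith

end

noncomputable section

/-! ### The functionals of one branch -/

/-- a bound for the length of the support -/
def Nz (z : VT) : ℕ := z.support.sup List.length + 1

theorem eq_zero_of_Nz {z : VT} {t : List ℕ} (h : Nz z ≤ t.length) : z t = 0 := by
  by_contra hne
  have := Finset.le_sup (f := List.length) (Finsupp.mem_support_iff.2 hne)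
  unfold Nz at h
  omega

/-- the difference maps along a branch -/
def wb (lev : ℕ → ℕ) (σ : ℕ → ℕ) (n : ℕ) : VT →ₗ[ℝ] CantorC :=
  (QQ (lb lev σ n)).toLinearMap ∘ₗ (Finsupp.lapply (pfx σ n) - Finsupp.lapply (pfx σ (n + 1)))

theorem wb_apply (lev : ℕ → ℕ) (σ : ℕ → ℕ) (n : ℕ) (z : VT) :
    wb lev σ n z = wv (lb lev σ) (fun n => z (pfx σ n)) n := rfl

theorem wb_zero (lev : ℕ → ℕ) (σ : ℕ → ℕ) {n : ℕ} {z : VT} (h : Nz z ≤ n) : wb lev σ n z = 0 := by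
  rw [wb_apply, wv, eq_zero_of_Nz (by simpa using h), eq_zero_of_Nz (by simp; omega)]
  simp

theorem sum_wb {M : Type*} [AddCommMonoid M] (lev : ℕ → ℕ) (σ : ℕ → ℕ) (z : VT)
    (F : ℕ → CantorC → M) (hF : ∀ n, F n 0 = 0) {m : ℕ} (h : Nz z ≤ m) :
    ∑ n ∈ Finset.range m, F n (wb lev σ n z) = ∑ n ∈ Finset.range (Nz z), F n (wb lev σ n z) := by
  symm
  apply Finset.sum_subset (Finset.range_mono h)
  intro n _ hn
  rw [wb_zero lev σ (by simpa using hn), hF]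

/-- the sum of a branch -/
def rb (lev : ℕ → ℕ) (σ : ℕ → ℕ) : VT →ₗ[ℝ] CantorC where
  toFun z := ∑ n ∈ Finset.range (Nz z), wb lev σ n z
  map_add' z z' := by
    have h := fun (z : VT) (m : ℕ) (h : Nz z ≤ m) => sum_wb lev σ z (fun _ x => x) (fun _ => rfl) h
    rw [← h (z + z') (max (Nz (z + z')) (max (Nz z) (Nz z'))) (by omega),
      ← h z (max (Nz (z + z')) (max (Nz z) (Nz z'))) (by omega),
      ← h z' (max (Nz (z + z')) (max (Nz z) (Nz z'))) (by omega), ← Finset.sum_add_distrib]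
    exact Finset.sum_congr rfl fun n _ => map_add _ _ _
  map_smul' c z := by
    have h := fun (z : VT) (m : ℕ) (h : Nz z ≤ m) => sum_wb lev σ z (fun _ x => x) (fun _ => rfl) h
    rw [← h (c • z) (max (Nz (c • z)) (Nz z)) (by omega),
      ← h z (max (Nz (c • z)) (Nz z)) (by omega), RingHom.id_apply, Finset.smul_sum]
    exact Finset.sum_congr rfl fun n _ => map_smul _ _ _

theorem rb_apply (lev : ℕ → ℕ) (σ : ℕ → ℕ) (z : VT) {m : ℕ} (h : Nz z ≤ m) :
    rb lev σ z = ∑ n ∈ Finset.range m, wb lev σ n z :=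
  (sum_wb lev σ z (fun _ x => x) (fun _ => rfl) h).symm

/-- the total distance of a branch -/
def rhob (lab : ℕ → CantorC) (lev : ℕ → ℕ) (σ : ℕ → ℕ) : Seminorm ℝ VT :=
  Seminorm.of (fun z => ∑ n ∈ Finset.range (Nz z), dq (Eb lab σ n) (wb lev σ n z))
    (by
      intro z z'
      have h := fun (z : VT) (m : ℕ) (h : Nz z ≤ m) =>
        sum_wb lev σ z (fun n x => dq (Eb lab σ n) x) (fun n => map_zero _) h
      rw [← h (z + z') (max (Nz (z + z')) (max (Nz z) (Nz z'))) (by omega),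
        ← h z (max (Nz (z + z')) (max (Nz z) (Nz z'))) (by omega),
        ← h z' (max (Nz (z + z')) (max (Nz z) (Nz z'))) (by omega), ← Finset.sum_add_distrib]
      refine Finset.sum_le_sum fun n _ => ?_
      rw [map_add]
      exact map_add_le_add _ _ _)
    (by
      intro c z
      have h := fun (z : VT) (m : ℕ) (h : Nz z ≤ m) =>
        sum_wb lev σ z (fun n x => dq (Eb lab σ n) x) (fun n => map_zero _) h
      rw [← h (c • z) (max (Nz (c • z)) (Nz z)) (by omega),
        ← h z (max (Nz (c • z)) (Nz z)) (by omega), Finset.mul_sum]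
      refine Finset.sum_congr rfl fun n _ => ?_
      rw [map_smul, map_smul_eq_mul])

theorem rhob_apply (lab : ℕ → CantorC) (lev : ℕ → ℕ) (σ : ℕ → ℕ) (z : VT) {m : ℕ} (h : Nz z ≤ m) :
    rhob lab lev σ z = ∑ n ∈ Finset.range m, dq (Eb lab σ n) (wb lev σ n z) :=
  (sum_wb lev σ z (fun n x => dq (Eb lab σ n) x) (fun n => map_zero _) h).symm

theorem segp_branch (lab : ℕ → CantorC) (lev : ℕ → ℕ) (σ : ℕ → ℕ) (z : VT) {m : ℕ} (h : Nz z ≤ m) :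
    segp lab lev (0, pfx σ m) z = ‖rb lev σ z‖ + rhob lab lev σ z := by
  rw [segp_pfx, rb_apply lev σ z (m := m + 1) (by omega),
    rhob_apply lab lev σ z (m := m + 1) (by omega)]
  have : (fun n => if n ≤ m then z (pfx σ n) else 0) = fun n => z (pfx σ n) := by
    funext n
    split_ifs with hn
    · rfl
    · rw [eq_zero_of_Nz (by simp; omega)]
  rw [this]
  rfl

theorem branch_le_nu (lab : ℕ → CantorC) (lev : ℕ → ℕ) {B : Set (ℕ → ℕ)} {σ : ℕ → ℕ} (hσ : σ ∈ B)
    (z : VT) : ‖rb lev σ z‖ + rhob lab lev σ z ≤ nu lab lev (Tr B) z := by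
  rw [← segp_branch lab lev σ z le_rfl]
  have hT : pfx σ (Nz z) ∈ Tr B := ⟨σ, hσ, _, rfl⟩
  exact segp_le_nu lab lev (s := (0, pfx σ (Nz z))) hT (Nat.zero_le _) _

theorem segp_le_branch (lab : ℕ → CantorC) (lev : ℕ → ℕ) (σ : ℕ → ℕ) (z : VT) (n : ℕ) :
    segp lab lev (0, pfx σ n) z ≤ 2 * (‖rb lev σ z‖ + rhob lab lev σ z) := by
  rw [← segp_branch lab lev σ z (le_max_left (Nz z) n)]
  have := segp_cut lab lev (pfx σ (max (Nz z) n)) n (by simp) z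
  rwa [pfx_take σ (le_max_right _ _)] at this

theorem Eb_le (lab : ℕ → CantorC) (σ : ℕ → ℕ) (n : ℕ) : Eb lab σ n ≤ Xspan (lab ∘ σ) := by
  rw [Eb, Et, Submodule.span_le]
  rintro _ ⟨i, hi, rfl⟩
  simp only [Set.mem_ofPred_eq, pfx, List.mem_map, List.mem_range] at hi
  obtain ⟨k, _, rfl⟩ := hi
  exact mem_Xspan (lab ∘ σ) k

theorem dq_rb (lab : ℕ → CantorC) (lev : ℕ → ℕ) (σ : ℕ → ℕ) (z : VT) :
    dq (Xspan (lab ∘ σ)) (rb lev σ z) ≤ rhob lab lev σ z := by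
  rw [rb_apply lev σ z le_rfl, rhob_apply lab lev σ z le_rfl]
  refine (seminorm_sum_le _ _ _).trans (Finset.sum_le_sum fun n _ => ?_)
  exact dq_mono (Eb_le lab σ n) _

theorem exists_of_dq_lt {E : Submodule ℝ CantorC} {x : CantorC} {ε : ℝ} (h : dq E x < ε) :
    ∃ e ∈ E, ‖x - e‖ ≤ ε := by
  obtain ⟨m, hm, hm'⟩ := Submodule.Quotient.norm_mk_lt (S := E) (E.mkQ x)
    (ε := ε - dq E x) (by linarith)
  have h1 : m - x ∈ E := (Submodule.Quotient.eq E).1 hm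
  refine ⟨x - m, by simpa using E.neg_mem h1, ?_⟩
  rw [sub_sub_cancel]
  have h2 : dq E x = ‖E.mkQ x‖ := rfl
  rw [h2] at hm'
  linarith

/-- pass an inequality to the closure -/
theorem le_of_dense {V Y : Type*} [TopologicalSpace Y] (A : V → Y) (hA : DenseRange A)
    (F G : Y → ℝ) (hF : Continuous F) (hG : Continuous G) (h : ∀ v, F (A v) ≤ G (A v)) (y : Y) :
    F y ≤ G y :=
  hA.induction_on (p := fun y => F y ≤ G y) y (isClosed_le hF hG) h

/-- finite dimensional range of `QQ` -/
theorem finDim_range_QQ (m : ℕ) : FiniteDimensional ℝ (LinearMap.range (QQ m).toLinearMap) := by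
  have : LinearMap.range (QQ m).toLinearMap ≤ Submodule.span ℝ (chi '' (words m : Set (List Bool))) := by
    rintro _ ⟨f, rfl⟩
    change QQ m f ∈ _
    rw [QQ_eq_sum]
    apply Submodule.sum_mem
    intro w hw
    apply Submodule.smul_mem
    exact Submodule.subset_span ⟨w, hw, rfl⟩
  have h2 : FiniteDimensional ℝ (Submodule.span ℝ (chi '' (words m : Set (List Bool)))) :=
    FiniteDimensional.span_of_finite ℝ ((words m).finite_toSet.image _)
  exact Submodule.finiteDimensional_of_le this

/-- **Step 1.** -/
theorem step_one {Y : Type*} [NormedAddCommGroup Y] [NormedSpace ℝ Y]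
    (lab : ℕ → CantorC) (lev : ℕ → ℕ) (B : Set (ℕ → ℕ)) (ι : VT →ₗ[ℝ] Y) (hι : DenseRange ι)
    (hιn : ∀ v, ‖ι v‖ = nu lab lev (Tr B) v) (σ : ℕ → ℕ) (hσ : σ ∈ B)
    (hnu : ¬ Embeds CantorC (Xspan (lab ∘ σ)))
    (pY : ℕ × List ℕ → Seminorm ℝ Y) (hpY : ∀ n v, pY (0, pfx σ n) (ι v) = segp lab lev (0, pfx σ n) v)
    (hpb : ∀ n y, pY (0, pfx σ n) y ≤ 1 * ‖y‖)
    (S : CantorC →L[ℝ] Y) (ε : ℝ) (hε : 0 < ε) :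
    ∃ J : Copy, ∀ n f, pY (0, pfx σ n) (S (J f)) ≤ ε * ‖f‖ := by
  have hle := fun v => branch_le_nu lab lev hσ v
  have hr : ∀ v, ‖rb lev σ v‖ ≤ 1 * ‖ι v‖ := fun v => by
    have := hle v; have := apply_nonneg (rhob lab lev σ) v; rw [hιn]; linarith
  have hρ : ∀ v, rhob lab lev σ v ≤ 1 * ‖ι v‖ := fun v => by
    have := hle v; have := norm_nonneg (rb lev σ v); rw [hιn]; linarith
  have hk : ∀ k v, (dq (Eb lab σ k)).comp (wb lev σ k) v ≤ rhob lab lev σ v := by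
    intro k v
    rw [rhob_apply lab lev σ v (m := max (Nz v) (k + 1)) (le_max_left _ _)]
    exact Finset.single_le_sum (f := fun n => dq (Eb lab σ n) (wb lev σ n v))
      (fun _ _ => apply_nonneg _ _) (Finset.mem_range.2 (by omega))
  obtain ⟨r, hr1, hr2⟩ := exists_extend ι hι (rb lev σ) 1 hr
  obtain ⟨ρ, hρ1, hρ2⟩ := exists_seminorm_extend ι hι (rhob lab lev σ) 1 hρ
  have hex := fun k => exists_seminorm_extend ι hι ((dq (Eb lab σ k)).comp (wb lev σ k)) 1
    (fun v => (hk k v).trans (hρ v))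
  choose p hp1 hp2 using hex
  have hρc := seminorm_continuous ρ 1 hρ2
  have hpc := fun k => seminorm_continuous (p k) 1 (hp2 k)
  -- finite codimension
  have hN : ∀ k, ∃ N : Submodule ℝ Y, FiniteDimensional ℝ (Y ⧸ N) ∧ ∀ y ∈ N, p k y = 0 := by
    intro k
    haveI := finDim_range_QQ (lb lev σ k)
    refine finDim_quot ι hι ((QQ (lb lev σ k)).toLinearMap.rangeRestrict ∘ₗ
      (Finsupp.lapply (pfx σ k) - Finsupp.lapply (pfx σ (k + 1)))) (p k) 1 (hp2 k) ?_
    intro v hv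
    have h1 : wb lev σ k v = 0 := congrArg Subtype.val hv
    rw [hp1, Seminorm.comp_apply, h1, map_zero]
  choose N hN1 hN2 using hN
  have hsum : ∀ L y, ∑ k ∈ Finset.range L, p k y ≤ ρ y := by
    intro L
    refine le_of_dense ι hι _ _ (continuous_finset_sum _ fun k _ => hpc k) hρc ?_
    intro v
    rw [hρ1, rhob_apply lab lev σ v (m := max (Nz v) L) (le_max_left _ _)]
    simp only [hp1, Seminorm.comp_apply]
    exact Finset.sum_le_sum_of_subset_of_nonneg (Finset.range_mono (le_max_right _ _))
      fun _ _ _ => apply_nonneg _ _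
  have happrox : ∀ y, ∀ η > 0, ∃ L, ρ y ≤ ∑ k ∈ Finset.range L, p k y + η := by
    intro y η hη
    obtain ⟨v, hv⟩ := hι.exists_dist_lt y (ε := η / 2) (by linarith)
    rw [dist_eq_norm] at hv
    refine ⟨Nz v, ?_⟩
    have h1 : ρ (ι v) = ∑ k ∈ Finset.range (Nz v), p k (ι v) := by
      rw [hρ1, rhob_apply lab lev σ v le_rfl]
      simp only [hp1, Seminorm.comp_apply]
    have h2 : ρ y ≤ ρ (y - ι v) + ρ (ι v) := by
      have := map_add_le_add ρ (y - ι v) (ι v); rwa [sub_add_cancel] at this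
    have h3 : ∑ k ∈ Finset.range (Nz v), p k (ι v) ≤
        ∑ k ∈ Finset.range (Nz v), p k y + ∑ k ∈ Finset.range (Nz v), p k (y - ι v) := by
      rw [← Finset.sum_add_distrib]
      refine Finset.sum_le_sum fun k _ => ?_
      have := map_sub_le_add (p k) y (y - ι v)
      rwa [sub_sub_cancel] at this
    have h4 := hsum (Nz v) (y - ι v)
    have h5 := hρ2 (y - ι v)
    linarith
  have hdq : ∀ y, dq (Xspan (lab ∘ σ)) (r y) ≤ ρ y := by
    have hc : Continuous (dq (Xspan (lab ∘ σ))) :=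
      seminorm_continuous _ 1 fun x => by rw [one_mul]; exact dq_le _ x
    refine le_of_dense ι hι _ _ (hc.comp r.continuous) hρc ?_
    intro v
    rw [hr1, hρ1]
    exact dq_rb lab lev σ v
  have hpi : ∀ n y, pY (0, pfx σ n) y ≤ 2 * (‖r y‖ + ρ y) := by
    intro n
    refine le_of_dense ι hι _ _ (seminorm_continuous _ 1 (hpb n))
      (continuous_const.mul (r.continuous.norm.add hρc)) ?_
    intro v
    rw [hpY, hr1, hρ1]
    exact segp_le_branch lab lev σ v n
  have hno : ∀ T : CantorC →L[ℝ] Y, ∀ c > 0, ¬ ∀ f, c * ‖f‖ ≤ ρ (T f) := by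
    intro T c hc h
    refine no_l1 N hN1 p hN2 ρ hsum happrox T.toLinearMap ‖T‖ ?_ c hc h
    intro f
    have h1 := hρ2 (T f)
    have h2 := T.le_opNorm f
    exact h1.trans (by rw [one_mul]; exact h2)
  -- the dichotomy
  let P : Seminorm ℝ CantorC := (normSeminorm ℝ CantorC).comp (r.toLinearMap ∘ₗ S.toLinearMap) +
    ρ.comp S.toLinearMap
  have hP : ∀ f, P f = ‖r (S f)‖ + ρ (S f) := fun f => rfl
  have hPK : ∀ f, P f ≤ (2 * ‖S‖) * ‖f‖ := by
    intro f
    rw [hP]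
    have h1 := hr2 (S f)
    have h2 := hρ2 (S f)
    have h3 := S.le_opNorm f
    linarith
  rcases dichotomy P _ hPK with ⟨J, c, hc, hJ⟩ | hsmall
  · exfalso
    let S' : CantorC →L[ℝ] Y := S.comp J.toContinuousLinearMap
    have hS' : ∀ f, S' f = S (J f) := fun f => rfl
    have hρK : ∀ f, (ρ.comp S'.toLinearMap) f ≤ ‖S'‖ * ‖f‖ := by
      intro f
      have h1 := hρ2 (S' f)
      rw [one_mul] at h1
      exact h1.trans (S'.le_opNorm f)
    rcases dichotomy (ρ.comp S'.toLinearMap) _ hρK with ⟨J', c', hc', hJ'⟩ | hsm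
    · exact hno (S'.comp J'.toContinuousLinearMap) c' hc' hJ'
    · obtain ⟨J', hJ'⟩ := hsm (c / 16) (by linarith)
      have hb := hJ'.bound hρK
      let S2 : CantorC →L[ℝ] CantorC := r.comp (S'.comp J'.toContinuousLinearMap)
      have hS2 : ∀ f, S2 f = r (S (J (J' f))) := fun f => rfl
      refine hnu (perturb_embed S2 (c / 2) ?_ (Xspan (lab ∘ σ)) (isClosed_Xspan _) (c / 8)
        (by linarith) (by linarith) ?_ ?_)
      · intro f
        have h1 := hJ (J' f)
        rw [hP, LinearIsometry.norm_map] at h1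
        have h2 : ρ (S (J (J' f))) ≤ 2 * (c / 16) * ‖f‖ := hb f
        rw [hS2]
        nlinarith [norm_nonneg f]
      · have h1 : ρ (S (J (J' 1))) ≤ c / 16 := hJ'.1
        apply exists_of_dq_lt
        have := hdq (S (J (J' 1)))
        rw [hS2]
        linarith
      · intro w
        have h1 : ρ (S (J (J' (haar w)))) ≤ c / 16 * (1 / 4) ^ (w.length + 1) := hJ'.2 w
        apply exists_of_dq_lt
        have := hdq (S (J (J' (haar w))))
        rw [hS2]
        have h3 : (0 : ℝ) < (1 / 4) ^ (w.length + 1) := by positivity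
        nlinarith
  · obtain ⟨J, hJ⟩ := hsmall (ε / 4) (by linarith)
    have hb := hJ.bound hPK
    refine ⟨J, fun n f => ?_⟩
    have h1 := hpi n (S (J f))
    have h2 := hb f
    rw [hP] at h2
    linarith

end

noncomputable section

/-- chains of copies factor -/
theorem chain_factor (Kc J' : ℕ → Copy) (hK : ∀ n f, Kc (n + 1) f = Kc n (RH (J' n f))) (i d : ℕ) :
    ∃ g : Copy, ∀ f, Kc (i + 1 + d) f = Kc i (RH (J' i (g f))) := by
  induction d with
  | zero => exact ⟨LinearIsometry.id, fun f => hK i f⟩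
  | succ d ih =>
    obtain ⟨g, hg⟩ := ih
    refine ⟨g.comp (RH.comp (J' (i + 1 + d))), fun f => ?_⟩
    rw [← Nat.add_assoc, hK, hg]
    rfl

/-- many incomparable segments give a contradiction -/
theorem incomp_false {Y : Type*} [NormedAddCommGroup Y] [NormedSpace ℝ Y] {T : Set (List ℕ)}
    (pY : ℕ × List ℕ → Seminorm ℝ Y)
    (H1 : ∀ F, Adm T F → ∀ y, ∑ s ∈ F, pY s y ≤ Real.sqrt F.card * ‖y‖)
    (S : CantorC →L[ℝ] Y) (f : ℕ → CantorC) (s : ℕ → ℕ × List ℕ)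
    (hs : ∀ i, (s i).2 ∈ T ∧ (s i).1 ≤ (s i).2.length)
    (hinc : ∀ i j, (s i).2.take (s i).1 <+: (s j).2.take (s j).1 → i = j)
    (δ : ℝ) (hδ : 0 < δ) (hp : ∀ i, δ ≤ pY (s i) (S (f i)))
    (hn : ∀ m (θ : ℕ → ℝ), (∀ i, |θ i| = 1) → ‖∑ i ∈ Finset.range m, θ i • f i‖ ≤ 1) : False := by
  classical
  have hinj : Function.Injective s := fun i j h => hinc i j (by rw [h])
  have key : ∀ m : ℕ, (m : ℝ) * δ ≤ Real.sqrt m * ‖S‖ := by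
    intro m
    obtain ⟨θ, hθ, h1⟩ := sign_lemma m (fun i => S (f i)) (fun i => pY (s i))
    have h2 : (m : ℝ) * δ ≤ ∑ i ∈ Finset.range m, pY (s i) (S (f i)) := by
      have := Finset.card_nsmul_le_sum (Finset.range m) (fun i => pY (s i) (S (f i))) δ fun i _ => hp i
      rwa [Finset.card_range, nsmul_eq_mul] at this
    have h3 : ∑ j ∈ Finset.range m, θ j • S (f j) = S (∑ j ∈ Finset.range m, θ j • f j) := by
      rw [map_sum]; exact Finset.sum_congr rfl fun j _ => by rw [map_smul]
    rw [h3] at h1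
    have hadm : Adm T ((Finset.range m).image s) := by
      constructor
      · intro t ht
        obtain ⟨i, _, rfl⟩ := Finset.mem_image.1 ht
        exact hs i
      · intro t ht t' ht' h
        obtain ⟨i, _, rfl⟩ := Finset.mem_image.1 ht
        obtain ⟨j, _, rfl⟩ := Finset.mem_image.1 ht'
        rw [hinc i j h]
    have h4 := H1 _ hadm (S (∑ j ∈ Finset.range m, θ j • f j))
    rw [Finset.sum_image (fun i _ j _ h => hinj h), Finset.card_image_of_injective _ hinj,
      Finset.card_range] at h4
    have h5 := S.le_opNorm (∑ j ∈ Finset.range m, θ j • f j)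
    have h6 := hn m θ hθ
    have h7 : ‖S (∑ j ∈ Finset.range m, θ j • f j)‖ ≤ ‖S‖ := by
      nlinarith [norm_nonneg S]
    have h8 : Real.sqrt m * ‖S (∑ j ∈ Finset.range m, θ j • f j)‖ ≤ Real.sqrt m * ‖S‖ := by
      gcongr
    linarith
  obtain ⟨m, hm⟩ := exists_nat_gt ((‖S‖ / δ) ^ 2)
  have h1 := key m
  have hm0 : (0 : ℝ) < m := lt_of_le_of_lt (by positivity) hm
  have hsq : Real.sqrt m * Real.sqrt m = m := Real.mul_self_sqrt hm0.le
  have hsp : 0 < Real.sqrt m := Real.sqrt_pos.2 hm0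
  have h2 : Real.sqrt m * δ ≤ ‖S‖ := by
    have : Real.sqrt m * (Real.sqrt m * δ) ≤ Real.sqrt m * ‖S‖ := by
      rw [← mul_assoc, hsq]; exact h1
    exact le_of_mul_le_mul_left this hsp
  have h3 : Real.sqrt m ≤ ‖S‖ / δ := by rw [le_div_iff₀ hδ]; exact h2
  have h4 : (m : ℝ) ≤ (‖S‖ / δ) ^ 2 := by rw [← hsq, sq]; gcongr
  linarith

/-- the bad pairs -/
def Bad {Y : Type*} [NormedAddCommGroup Y] [NormedSpace ℝ Y] (T : Set (List ℕ))
    (pY : ℕ × List ℕ → Seminorm ℝ Y) (S : CantorC →L[ℝ] Y) (ε : ℝ) (t : List ℕ) (J : Copy) : Prop :=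
  ∀ J' : Copy, ∃ f : CantorC, ∃ b ∈ T, t <+: b ∧ ‖f‖ = 1 ∧ ε < pY (0, b) (S (J (J' f)))

theorem Bad.comp {Y : Type*} [NormedAddCommGroup Y] [NormedSpace ℝ Y] {T : Set (List ℕ)}
    {pY : ℕ × List ℕ → Seminorm ℝ Y} {S : CantorC →L[ℝ] Y} {ε : ℝ} {t : List ℕ} {J : Copy}
    (h : Bad T pY S ε t J) (J0 : Copy) : Bad T pY S ε t (J.comp J0) := fun J' => h (J0.comp J')

theorem not_bad {Y : Type*} [NormedAddCommGroup Y] [NormedSpace ℝ Y] {T : Set (List ℕ)}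
    {pY : ℕ × List ℕ → Seminorm ℝ Y} {S : CantorC →L[ℝ] Y} {ε : ℝ} {t : List ℕ} {J : Copy}
    (h : ¬ Bad T pY S ε t J) : ∃ J' : Copy, ∀ f, ∀ b ∈ T, t <+: b →
      pY (0, b) (S (J (J' f))) ≤ ε * ‖f‖ := by
  unfold Bad at h
  push Not at h
  obtain ⟨J', hJ'⟩ := h
  refine ⟨J', fun f b hb ht => ?_⟩
  by_cases hf : f = 0
  · rw [hf]; simp
  · have hfn : 0 < ‖f‖ := norm_pos_iff.2 hf
    have := hJ' (‖f‖⁻¹ • f) b hb ht (by rw [norm_smul, norm_inv, norm_norm, inv_mul_cancel₀ hfn.ne'])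
    rw [map_smul, map_smul, map_smul, map_smul_eq_mul, norm_inv, norm_norm,
      inv_mul_le_iff₀ hfn] at this
    linarith

theorem bad_child {Y : Type*} [NormedAddCommGroup Y] [NormedSpace ℝ Y] {B : Set (ℕ → ℕ)}
    (pY : ℕ × List ℕ → Seminorm ℝ Y)
    (H1 : ∀ F, Adm (Tr B) F → ∀ y, ∑ s ∈ F, pY s y ≤ Real.sqrt F.card * ‖y‖)
    (H2 : ∀ b ∈ Tr B, ∀ k < b.length, ∀ y, pY (0, b) y ≤ pY (0, b.take k) y + pY (k + 1, b) y)
    (H3 : ∀ σ ∈ B, ∀ (S : CantorC →L[ℝ] Y) (ε : ℝ), 0 < ε →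
      ∃ J : Copy, ∀ n f, pY (0, pfx σ n) (S (J f)) ≤ ε * ‖f‖)
    (S : CantorC →L[ℝ] Y) (ε : ℝ) (hε : 0 < ε) (t : List ℕ) (J : Copy)
    (hbad : Bad (Tr B) pY S ε t J) :
    ∃ (n : ℕ) (J' : Copy), Bad (Tr B) pY S ε (t ++ [n]) (J.comp J') := by
  by_contra! hno
  obtain ⟨_, b0, hb0, htb0, _⟩ := hbad LinearIsometry.id
  have htT : t ∈ Tr B := by
    rw [List.prefix_iff_eq_take.1 htb0]; exact Tr_take hb0 _
  obtain ⟨σ, hσ, n0, htσ⟩ := htT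
  obtain ⟨J0, hJ0⟩ := H3 σ hσ (S.comp J.toContinuousLinearMap) (ε / 4) (by linarith)
  have hstep : ∀ K : Copy, ∃ (f : CantorC) (b : List ℕ) (n : ℕ) (J' : Copy),
      b ∈ Tr B ∧ t ++ [n] <+: b ∧ ‖f‖ = 1 ∧ ε < pY (0, b) (S (J (J0 (K (LH f))))) ∧
      ∀ g, ∀ b' ∈ Tr B, t ++ [n] <+: b' →
        pY (0, b') (S (J (J0 (K (RH (J' g)))))) ≤ ε * ‖g‖ := by
    intro K
    obtain ⟨f, b, hb, htb, hf, hlt⟩ := hbad (J0.comp (K.comp LH))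
    have hne : b ≠ t := by
      intro h
      have h1 := hJ0 n0 (K (LH f))
      rw [← htσ, LinearIsometry.norm_map, LinearIsometry.norm_map, hf] at h1
      rw [h] at hlt
      have h2 : pY (0, t) (S (J (J0 (K (LH f))))) ≤ ε / 4 * 1 := h1
      have h3 : ε < pY (0, t) (S (J (J0 (K (LH f))))) := hlt
      linarith
    obtain ⟨u, rfl⟩ := htb
    cases u with
    | nil => exact absurd (by simp) hne
    | cons n u =>
      obtain ⟨J', hJ'⟩ := not_bad (hno n (J0.comp (K.comp RH)))
      exact ⟨f, _, n, J', hb, ⟨u, by simp⟩, hf, hlt, hJ'⟩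
  choose f b n J' hb hn hf hlt hJ' using hstep
  let Kc : ℕ → Copy := fun i => i.rec LinearIsometry.id (fun _ K => K.comp (RH.comp (J' K)))
  have hKc : ∀ i g, Kc (i + 1) g = Kc i (RH (J' (Kc i) g)) := fun i g => rfl
  have hdist : ∀ i j, i < j → n (Kc i) ≠ n (Kc j) := by
    intro i j hij h
    obtain ⟨d, rfl⟩ : ∃ d, j = i + 1 + d := ⟨j - i - 1, by omega⟩
    obtain ⟨g, hg⟩ := chain_factor Kc (fun i => J' (Kc i)) hKc i d
    have h1 := hlt (Kc (i + 1 + d))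
    rw [hg] at h1
    have h2 := hJ' (Kc i) (g (LH (f (Kc (i + 1 + d))))) (b (Kc (i + 1 + d))) (hb _)
      (by rw [h]; exact hn _)
    rw [LinearIsometry.norm_map, LinearIsometry.norm_map, hf] at h2
    linarith
  have htake : ∀ i, (b (Kc i)).take (t.length + 1) = t ++ [n (Kc i)] := by
    intro i
    have := List.prefix_iff_eq_take.1 (hn (Kc i))
    rw [this]; simp
  have hlen : ∀ i, t.length + 1 ≤ (b (Kc i)).length := by
    intro i
    have := (hn (Kc i)).length_le
    simpa using this
  refine incomp_false pY H1 ((S.comp J.toContinuousLinearMap).comp J0.toContinuousLinearMap)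
    (fun i => Kc i (LH (f (Kc i)))) (fun i => (t.length + 1, b (Kc i)))
    (fun i => ⟨hb _, hlen i⟩) ?_ (ε / 2) (by linarith) ?_ ?_
  · intro i j h
    simp only [htake] at h
    have h1 := h.eq_of_length (by simp)
    have h2 : n (Kc i) = n (Kc j) := by simpa using h1
    rcases lt_trichotomy i j with h3 | h3 | h3
    · exact absurd h2 (hdist i j h3)
    · exact h3
    · exact absurd h2.symm (hdist j i h3)
  · intro i
    have h1 := H2 (b (Kc i)) (hb _) t.length (by have := hlen i; omega)
      (S (J (J0 (Kc i (LH (f (Kc i)))))))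
    have h2 : (b (Kc i)).take t.length = t := by
      have h3 : t <+: b (Kc i) := (List.prefix_append t _).trans (hn (Kc i))
      exact (List.prefix_iff_eq_take.1 h3).symm
    rw [h2] at h1
    have h3 := hJ0 n0 (Kc i (LH (f (Kc i))))
    rw [← htσ, LinearIsometry.norm_map, LinearIsometry.norm_map, hf] at h3
    have h4 : pY (0, t) (S (J (J0 (Kc i (LH (f (Kc i))))))) ≤ ε / 4 * 1 := h3
    have h5 := hlt (Kc i)
    change ε / 2 ≤ pY (t.length + 1, b (Kc i)) (S (J (J0 (Kc i (LH (f (Kc i)))))))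
    linarith
  · intro m θ hθ
    have := norm_chain_le Kc (fun i => J' (Kc i)) hKc (fun i => θ i • f (Kc i)) 1 zero_le_one
      (fun i => by rw [norm_smul, Real.norm_eq_abs, hθ, hf, one_mul]) m
    simpa only [map_smul] using this

/-- **Step 2.** -/
theorem step_two {Y : Type*} [NormedAddCommGroup Y] [NormedSpace ℝ Y] {B : Set (ℕ → ℕ)}
    (pY : ℕ × List ℕ → Seminorm ℝ Y)
    (H1 : ∀ F, Adm (Tr B) F → ∀ y, ∑ s ∈ F, pY s y ≤ Real.sqrt F.card * ‖y‖)
    (H2 : ∀ b ∈ Tr B, ∀ k < b.length, ∀ y, pY (0, b) y ≤ pY (0, b.take k) y + pY (k + 1, b) y)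
    (H3 : ∀ σ ∈ B, ∀ (S : CantorC →L[ℝ] Y) (ε : ℝ), 0 < ε →
      ∃ J : Copy, ∀ n f, pY (0, pfx σ n) (S (J f)) ≤ ε * ‖f‖)
    (H4 : ∀ σ, (∀ n, pfx σ n ∈ Tr B) → σ ∈ B)
    (S : CantorC →L[ℝ] Y) (ε : ℝ) (hε : 0 < ε) :
    ∃ J : Copy, ∀ f, ∀ b ∈ Tr B, pY (0, b) (S (J f)) ≤ ε * ‖f‖ := by
  by_contra hcon
  have hbad0 : Bad (Tr B) pY S ε [] LinearIsometry.id := by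
    by_contra h
    obtain ⟨J', hJ'⟩ := not_bad h
    exact hcon ⟨J', fun f b hb => hJ' f b hb List.nil_prefix⟩
  have hch : ∀ x : {x : List ℕ × Copy // Bad (Tr B) pY S ε x.1 x.2}, ∃ (n : ℕ) (J' : Copy),
      Bad (Tr B) pY S ε (x.1.1 ++ [n]) (x.1.2.comp (RH.comp J')) := fun x =>
    bad_child pY H1 H2 H3 S ε hε x.1.1 (x.1.2.comp RH) (x.2.comp RH)
  choose c J' hcJ using hch
  let st : ℕ → {x : List ℕ × Copy // Bad (Tr B) pY S ε x.1 x.2} := fun i =>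
    i.rec ⟨([], LinearIsometry.id), hbad0⟩ (fun _ x => ⟨(x.1.1 ++ [c x], x.1.2.comp (RH.comp (J' x))), hcJ x⟩)
  let σ : ℕ → ℕ := fun i => c (st i)
  let Kc : ℕ → Copy := fun i => (st i).1.2
  have hKc : ∀ i g, Kc (i + 1) g = Kc i (RH (J' (st i) g)) := fun i g => rfl
  have hpfx : ∀ i, (st i).1.1 = pfx σ i := by
    intro i
    induction i with
    | zero => rfl
    | succ i ih => rw [pfx_succ, ← ih]
  have hbad : ∀ i, Bad (Tr B) pY S ε (pfx σ i) (Kc i) := fun i => by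
    rw [← hpfx]; exact (st i).2
  have hσ : σ ∈ B := by
    apply H4
    intro n
    obtain ⟨_, b0, hb0, htb0, _⟩ := hbad n LinearIsometry.id
    rw [List.prefix_iff_eq_take.1 htb0]; exact Tr_take hb0 _
  have hstep : ∀ i, ∃ (h : CantorC) (b : List ℕ) (l : ℕ), ‖h‖ = 1 ∧ b ∈ Tr B ∧ i ≤ l ∧
      l < b.length ∧ b.take l = pfx σ l ∧ b.take (l + 1) ≠ pfx σ (l + 1) ∧
      ε / 2 ≤ pY (l + 1, b) (S (Kc i (LH h))) := by
    intro i
    classical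
    obtain ⟨J0, hJ0⟩ := H3 σ hσ (S.comp ((Kc i).comp LH).toContinuousLinearMap) (ε / 4) (by linarith)
    obtain ⟨f, b, hb, htb, hf, hlt⟩ := hbad i (LH.comp J0)
    have hlt' : ε < pY (0, b) (S (Kc i (LH (J0 f)))) := hlt
    have hJ0' : ∀ n, pY (0, pfx σ n) (S (Kc i (LH (J0 f)))) ≤ ε / 4 := by
      intro n
      have := hJ0 n f
      rw [hf, mul_one] at this
      exact this
    have hP0 : b.take i = pfx σ i := by
      have := List.prefix_iff_eq_take.1 htb
      rw [pfx_length] at this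
      exact this.symm
    have hil : i ≤ b.length := by simpa using htb.length_le
    set l := Nat.findGreatest (fun m => b.take m = pfx σ m) b.length with hl
    have hl1 : b.take l = pfx σ l :=
      Nat.findGreatest_spec (P := fun m => b.take m = pfx σ m) hil hP0
    have hle : l ≤ b.length := Nat.findGreatest_le _
    have hli : i ≤ l := Nat.le_findGreatest hil hP0
    have hll : l < b.length := by
      rcases hle.lt_or_eq with h | h
      · exact h
      · exfalso
        rw [h, List.take_length] at hl1
        have := hJ0' b.length
        rw [← hl1] at this
        linarith
    refine ⟨J0 f, b, l, by rw [LinearIsometry.norm_map, hf], hb, hli, hll, hl1, ?_, ?_⟩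
    · intro h
      have : l + 1 ≤ l := Nat.le_findGreatest (P := fun m => b.take m = pfx σ m) hll h
      omega
    · have h1 := H2 b hb l hll (S (Kc i (LH (J0 f))))
      rw [hl1] at h1
      have := hJ0' l
      linarith
  choose h b l hh hb hil hlb htk htk' hp using hstep
  let φ : ℕ → ℕ := fun i => i.rec 0 (fun _ k => l k + 1)
  have hφ : ∀ i, φ (i + 1) = l (φ i) + 1 := fun i => rfl
  have hφlt : ∀ i, φ i < φ (i + 1) := fun i => by rw [hφ]; have := hil (φ i); omega
  have hφm : StrictMono φ := strictMono_nat_of_lt_succ hφlt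
  have hinc : ∀ i j, i < j → φ i < φ j ∧ l (φ i) + 1 ≤ l (φ j) := by
    intro i j hij
    have h1 : φ (i + 1) ≤ φ j := hφm.monotone hij
    rw [hφ] at h1
    exact ⟨hφm hij, h1.trans (hil _)⟩
  have hchain : ∀ i, ∃ g : Copy, ∀ f, Kc (φ (i + 1)) f = Kc (φ i) (RH (g f)) := by
    intro i
    obtain ⟨d, hd⟩ : ∃ d, φ (i + 1) = φ i + 1 + d := ⟨φ (i + 1) - φ i - 1, by have := hφlt i; omega⟩
    obtain ⟨g, hg⟩ := chain_factor Kc (fun i => J' (st i)) hKc (φ i) d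
    exact ⟨(J' (st (φ i))).comp g, fun f => by rw [hd, hg]; rfl⟩
  choose G hG using hchain
  have htop : ∀ i j, i < j → (b (φ j)).take (l (φ i) + 1) = pfx σ (l (φ i) + 1) := by
    intro i j hij
    have h1 := (hinc i j hij).2
    have h2 := congrArg (List.take (l (φ i) + 1)) (htk (φ j))
    rwa [List.take_take, min_eq_left h1, pfx_take σ h1] at h2
  refine incomp_false pY H1 S (fun i => Kc (φ i) (LH (h (φ i))))
    (fun i => (l (φ i) + 1, b (φ i))) (fun i => ⟨hb _, hlb _⟩) ?_ (ε / 2) (by linarith)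
    (fun i => hp _) ?_
  · intro i j hpre
    simp only at hpre
    rcases lt_trichotomy i j with h3 | h3 | h3
    · exfalso
      apply htk' (φ i)
      rw [← htop i j h3]
      have h4 := hpre.trans (List.take_prefix _ _)
      have h5 := List.prefix_iff_eq_take.1 h4
      rw [List.length_take, min_eq_left (hlb (φ i))] at h5
      exact h5
    · exact h3
    · exfalso
      have h4 := hpre.length_le
      rw [List.length_take, List.length_take, min_eq_left (hlb (φ i)), min_eq_left (hlb (φ j))] at h4
      have := (hinc j i h3).2
      omega
  · intro m θ hθ
    have := norm_chain_le (fun i => Kc (φ i)) G hG (fun i => θ i • h (φ i)) 1 zero_le_one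
      (fun i => by rw [norm_smul, Real.norm_eq_abs, hθ, hh, one_mul]) m
    simpa only [map_smul] using this

end

noncomputable section

theorem Adm.mono {T : Set (List ℕ)} {F G : Finset (ℕ × List ℕ)} (hF : Adm T F) (hG : G ⊆ F) :
    Adm T G :=
  ⟨fun s hs => hF.1 s (hG hs), fun s hs s' hs' => hF.2 s (hG hs) s' (hG hs')⟩

/-- the upper estimate for almost disjoint sums -/
theorem gliding (lab : ℕ → CantorC) (lev : ℕ → ℕ) (T : Set (List ℕ)) (n : ℕ) (hn : 0 < n)
    (v : ℕ → VT) (K : ℝ) (hK : 0 ≤ K) (hv : ∀ k < n, nu lab lev T (v k) ≤ K)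
    (hs : ∀ k < n, ∀ b ∈ T, segp lab lev (0, b) (v k) *
      (3 * n * ∑ i ∈ Finset.range k, ((v i).support.card : ℝ)) ≤ 1) :
    nu lab lev T (∑ k ∈ Finset.range n, v k) ≤ Real.sqrt n * K + 1 := by
  classical
  apply nu_le _ _ _ _ _ (by positivity)
  intro F hF
  rcases F.eq_empty_or_nonempty with rfl | hne
  · simp
  set m : ℝ := (F.card : ℝ) with hm
  have hm1 : 1 ≤ Real.sqrt m := by
    rw [Real.one_le_sqrt, hm]; exact_mod_cast hne.card_pos
  let meets : ℕ × List ℕ → ℕ → Prop := fun s k => ∃ t ∈ (v k).support, onseg s t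
  let U : ℕ → Finset (ℕ × List ℕ) := fun k => F.filter fun s => ∃ i < k, meets s i
  let G : ℕ → Finset (ℕ × List ℕ) := fun k => F.filter fun s => meets s k ∧ ∀ i < k, ¬ meets s i
  have hU : ∀ k, ((U k).card : ℝ) ≤ ∑ i ∈ Finset.range k, ((v i).support.card : ℝ) := by
    intro k
    have h1 := adm_card_le hF ((Finset.range k).biUnion fun i => (v i).support) (U k)
      (Finset.filter_subset _ _) (by
        intro s hs
        obtain ⟨i, hi, t, ht, hst⟩ := (Finset.mem_filter.1 hs).2
        exact ⟨t, Finset.mem_biUnion.2 ⟨i, Finset.mem_range.2 hi, ht⟩, hst⟩)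
    have h2 := h1.trans Finset.card_biUnion_le
    exact_mod_cast h2
  have hGc : ∑ k ∈ Finset.range n, ((G k).card : ℝ) ≤ m := by
    have hdis : ∀ i ∈ Finset.range n, ∀ j ∈ Finset.range n, i ≠ j → Disjoint (G i) (G j) := by
      intro i _ j _ hij
      rw [Finset.disjoint_left]
      intro s hs hs'
      have h1 := (Finset.mem_filter.1 hs).2
      have h2 := (Finset.mem_filter.1 hs').2
      rcases lt_or_gt_of_ne hij with h | h
      · exact h2.2 i h h1.1
      · exact h1.2 j h h2.1
    have h1 := Finset.card_biUnion hdis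
    have h2 : ((Finset.range n).biUnion G).card ≤ F.card :=
      Finset.card_le_card (Finset.biUnion_subset.2 fun i _ => Finset.filter_subset _ _)
    rw [h1] at h2
    rw [hm]; exact_mod_cast h2
  have hone : ∀ k < n, ∑ s ∈ F, segp lab lev s (v k) ≤ Real.sqrt (G k).card * K + 1 / n := by
    intro k hk
    have h1 : ∑ s ∈ F, segp lab lev s (v k) ≤
        ∑ s ∈ U k, segp lab lev s (v k) + ∑ s ∈ G k, segp lab lev s (v k) := by
      rw [← Finset.sum_filter_add_sum_filter_not F (fun s => ∃ i < k, meets s i)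
        (fun s => segp lab lev s (v k))]
      refine add_le_add le_rfl ?_
      rw [← Finset.sum_filter_ne_zero]
      apply Finset.sum_le_sum_of_subset_of_nonneg
      · intro s hs
        rw [Finset.mem_filter, Finset.mem_filter] at hs
        refine Finset.mem_filter.2 ⟨hs.1.1, segp_ne_zero hs.2, fun i hi hmt => hs.1.2 ⟨i, hi, hmt⟩⟩
      · intros; exact apply_nonneg _ _
    have h2 : ∑ s ∈ G k, segp lab lev s (v k) ≤ Real.sqrt (G k).card * K := by
      refine (sum_le_nu lab lev (hF.mono (Finset.filter_subset _ _)) (v k)).trans ?_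
      gcongr
      exact hv k hk
    have h3 : ∑ s ∈ U k, segp lab lev s (v k) ≤ 1 / n := by
      rcases (U k).eq_empty_or_nonempty with h0 | ⟨s0, hs0⟩
      · rw [h0, Finset.sum_empty]; positivity
      have hUk := hU k
      have hsk := hs k hk
      generalize ∑ i ∈ Finset.range k, ((v i).support.card : ℝ) = N at hUk hsk
      have hN1 : (1 : ℝ) ≤ N := by
        refine le_trans ?_ hUk
        exact_mod_cast Finset.card_pos.2 ⟨s0, hs0⟩
      have hn' : (0 : ℝ) < n := by exact_mod_cast hn
      have h4 : ∀ s ∈ U k, segp lab lev s (v k) ≤ 1 / (n * N) := by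
        intro s hs'
        have hsF := hF.1 s (Finset.filter_subset _ _ hs')
        have h5 := segp_top lab lev s.2 s.1 hsF.2 (v k)
        have h6 := hsk s.2 hsF.1
        rw [le_div_iff₀ (by positivity)]
        change segp lab lev s (v k) ≤ _ at h5
        have : segp lab lev s (v k) * (n * N) ≤ (3 * segp lab lev (0, s.2) (v k)) * (n * N) := by
          gcongr
        linarith
      have h5 := Finset.sum_le_card_nsmul (U k) _ _ h4
      rw [nsmul_eq_mul] at h5
      refine h5.trans ?_
      have : ((U k).card : ℝ) * (1 / (n * N)) ≤ N * (1 / (n * N)) := by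
        gcongr
      refine this.trans (le_of_eq ?_)
      field_simp
    linarith
  have hn' : (0 : ℝ) < n := by exact_mod_cast hn
  have hcs : ∑ k ∈ Finset.range n, Real.sqrt (G k).card ≤ Real.sqrt n * Real.sqrt m := by
    have h1 := Finset.sum_mul_sq_le_sq_mul_sq (Finset.range n) (fun _ => (1 : ℝ))
      (fun k => Real.sqrt (G k).card)
    simp only [one_mul, one_pow, Finset.sum_const, Finset.card_range, nsmul_eq_mul, mul_one] at h1
    have h2 : ∑ k ∈ Finset.range n, Real.sqrt (G k).card ^ 2 = ∑ k ∈ Finset.range n, ((G k).card : ℝ) :=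
      Finset.sum_congr rfl fun k _ => Real.sq_sqrt (by positivity)
    rw [h2] at h1
    rw [← Real.sqrt_mul hn'.le]
    apply Real.le_sqrt_of_sq_le
    exact h1.trans (by gcongr)
  calc ∑ s ∈ F, segp lab lev s (∑ k ∈ Finset.range n, v k)
      ≤ ∑ s ∈ F, ∑ k ∈ Finset.range n, segp lab lev s (v k) :=
        Finset.sum_le_sum fun s _ => seminorm_sum_le _ _ _
    _ = ∑ k ∈ Finset.range n, ∑ s ∈ F, segp lab lev s (v k) := Finset.sum_comm
    _ ≤ ∑ k ∈ Finset.range n, (Real.sqrt (G k).card * K + 1 / n) :=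
        Finset.sum_le_sum fun k hk => hone k (Finset.mem_range.1 hk)
    _ = (∑ k ∈ Finset.range n, Real.sqrt (G k).card) * K + 1 := by
        rw [Finset.sum_add_distrib, Finset.sum_mul, Finset.sum_const, Finset.card_range,
          nsmul_eq_mul]
        congr 1
        field_simp
    _ ≤ Real.sqrt n * Real.sqrt m * K + Real.sqrt m := by gcongr
    _ = Real.sqrt m * (Real.sqrt n * K + 1) := by ring

/-- **Step 3.** -/
theorem step_three {Y : Type*} [NormedAddCommGroup Y] [NormedSpace ℝ Y]
    (lab : ℕ → CantorC) (lev : ℕ → ℕ) (T : Set (List ℕ)) (ι : VT →ₗ[ℝ] Y) (hι : DenseRange ι)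
    (hιn : ∀ v, ‖ι v‖ = nu lab lev T v)
    (hsmall : ∀ (S : CantorC →L[ℝ] Y) (ε : ℝ), 0 < ε → ∃ J : Copy, ∀ f, ∀ b ∈ T, ∀ v,
      segp lab lev (0, b) v ≤ ε * ‖f‖ + ‖ι v - S (J f)‖) : ¬ Embeds CantorC Y := by
  rintro ⟨S, c, hc, hS⟩
  have key : ∀ n : ℕ, 0 < n → ∀ k ≤ n, ∃ (v : ℕ → VT) (g : CantorC) (u : List Bool),
      (∀ y, pre y u.length = u → (k : ℝ) / 2 ≤ g y) ∧
      ‖S g - ι (∑ i ∈ Finset.range k, v i)‖ ≤ k / n ∧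
      (∀ i < k, nu lab lev T (v i) ≤ ‖S‖ + 1) ∧
      (∀ i < k, ∀ b ∈ T, segp lab lev (0, b) (v i) *
        (3 * n * ∑ j ∈ Finset.range i, ((v j).support.card : ℝ)) ≤ 1) := by
    intro n hn k
    have hn' : (1 : ℝ) ≤ n := by exact_mod_cast hn
    induction k with
    | zero =>
      intro _
      exact ⟨fun _ => 0, 0, [], by simp, by simp, by simp, by simp⟩
    | succ k ih =>
      intro hk
      obtain ⟨v, g, u, hg, hSg, hv, hs⟩ := ih (by omega)
      obtain ⟨N, hN⟩ : ∃ N, N = ∑ j ∈ Finset.range k, ((v j).support.card : ℝ) := ⟨_, rfl⟩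
      have hN0 : 0 ≤ N := by rw [hN]; positivity
      obtain ⟨ε, hε⟩ : ∃ ε : ℝ, ε = 1 / (6 * n * (N + 1)) := ⟨_, rfl⟩
      have hεpos : 0 < ε := by rw [hε]; positivity
      have hε1 : ε ≤ 1 / n := by
        rw [hε]; apply one_div_le_one_div_of_le (by linarith); nlinarith
      have hε2 : ε + ε ≤ 1 / (3 * n * (N + 1)) := by
        rw [hε]; apply le_of_eq; field_simp; ring
      obtain ⟨J, hJ⟩ := hsmall (S.comp (tr u).toContinuousLinearMap) ε hεpos
      have hex : ∃ θ : ℝ, |θ| = 1 ∧ ∃ x, J (θ • 1) x = 1 := by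
        have hnorm : ‖J 1‖ = 1 := by rw [LinearIsometry.norm_map]; exact norm_one
        obtain ⟨x, -, hx'⟩ := isCompact_univ.exists_isMaxOn (Set.univ_nonempty)
          ((J 1).continuous.norm.continuousOn (s := Set.univ))
        have hx : 1 = |J 1 x| := by
          rw [← Real.norm_eq_abs, ← hnorm]
          refine le_antisymm ?_ ((J 1).norm_coe_le_norm x)
          rw [ContinuousMap.norm_le _ (norm_nonneg _)]
          exact fun y => hx' (Set.mem_univ y)
        refine ⟨J 1 x, hx.symm, x, ?_⟩
        rw [map_smul, ContinuousMap.smul_apply, smul_eq_mul, ← abs_mul_abs_self, ← hx, one_mul]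
      obtain ⟨θ, hθ, x, hx⟩ := hex
      set f : CantorC := tr u (J (θ • 1)) with hf
      have hfn : ‖f‖ = 1 := by
        rw [hf, LinearIsometry.norm_map, LinearIsometry.norm_map, norm_smul, Real.norm_eq_abs, hθ,
          one_mul]; exact norm_one
      obtain ⟨w, hw⟩ := Metric.denseRange_iff.1 hι (S f) ε hεpos
      have hwn : ‖ι w - S f‖ ≤ ε := by rw [dist_eq_norm] at hw; rw [norm_sub_rev]; exact hw.le
      obtain ⟨u', hu'⟩ := cyl_in_open ({y | pre y u.length = u} ∩ {y | (1 / 2 : ℝ) < f y})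
        ((isOpen_cyl u).inter (isOpen_lt continuous_const f.continuous))
        ⟨glue u x, pre_glue _ _, by
          change (1 / 2 : ℝ) < f (glue u x)
          rw [hf, tr_glue, hx]; norm_num⟩
      have hupd : ∀ i < k, Function.update v k w i = v i := fun i hi =>
        Function.update_of_ne (by omega) _ _
      have hsum : ∀ i ≤ k, ∑ j ∈ Finset.range i, (((Function.update v k w) j).support.card : ℝ) =
          ∑ j ∈ Finset.range i, ((v j).support.card : ℝ) := fun i hi =>
        Finset.sum_congr rfl fun j hj => by rw [hupd j (by have := Finset.mem_range.1 hj; omega)]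
      refine ⟨Function.update v k w, g + f, u', ?_, ?_, ?_, ?_⟩
      · intro y hy
        obtain ⟨h1, h2⟩ := hu' y hy
        have h3 := hg y h1
        have h4 : (1 / 2 : ℝ) < f y := h2
        rw [ContinuousMap.add_apply]; push_cast; linarith
      · rw [Finset.sum_range_succ, Function.update_self, Finset.sum_congr rfl
          (fun i hi => hupd i (Finset.mem_range.1 hi)), map_add, map_add]
        have h1 : S g + S f - (ι (∑ i ∈ Finset.range k, v i) + ι w)
          = (S g - ι (∑ i ∈ Finset.range k, v i)) + -(ι w - S f) := by abel
        rw [h1]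
        refine (norm_add_le _ _).trans ?_
        rw [norm_neg]
        push_cast
        rw [add_div]
        linarith
      · intro i hi
        rcases Nat.lt_succ_iff_lt_or_eq.1 hi with h | rfl
        · rw [hupd i h]; exact hv i h
        · rw [Function.update_self, ← hιn]
          have h1 : ι w = S f + (ι w - S f) := by abel
          rw [h1]
          refine (norm_add_le _ _).trans ?_
          have h2 := S.le_opNorm f
          rw [hfn] at h2
          have h3 : 1 / (n : ℝ) ≤ 1 := by rw [div_le_one (by linarith)]; exact hn'
          linarith
      · intro i hi b hb
        rcases Nat.lt_succ_iff_lt_or_eq.1 hi with h | rfl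
        · rw [hupd i h, hsum i h.le]; exact hs i h b hb
        · rw [Function.update_self, hsum i le_rfl, ← hN]
          have h1 := hJ (θ • 1) b hb w
          have h2 : ‖(θ • 1 : CantorC)‖ = 1 := by
            rw [norm_smul, Real.norm_eq_abs, hθ, one_mul]; exact norm_one
          rw [h2, mul_one] at h1
          have h3 : segp lab lev (0, b) w ≤ 1 / (3 * n * (N + 1)) := by
            refine h1.trans (le_trans ?_ hε2)
            exact add_le_add le_rfl hwn
          calc segp lab lev (0, b) w * (3 * n * N) ≤ 1 / (3 * n * (N + 1)) * (3 * n * (N + 1)) := by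
                apply mul_le_mul h3 _ (by positivity) (by positivity)
                nlinarith
            _ = 1 := by field_simp
  have key2 : ∀ n : ℕ, 0 < n → c * (n / 2) ≤ Real.sqrt n * (‖S‖ + 1) + 2 := by
    intro n hn
    obtain ⟨v, g, u, hg, hSg, hv, hs⟩ := key n hn n le_rfl
    have h1 := gliding lab lev T n hn v (‖S‖ + 1) (by positivity) hv hs
    rw [← hιn] at h1
    rw [div_self (by exact_mod_cast hn.ne')] at hSg
    have h2 : ‖S g‖ ≤ ‖ι (∑ i ∈ Finset.range n, v i)‖ + 1 := by
      have := norm_add_le (S g - ι (∑ i ∈ Finset.range n, v i)) (ι (∑ i ∈ Finset.range n, v i))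
      rw [sub_add_cancel] at this
      linarith
    have h3 : (n : ℝ) / 2 ≤ ‖g‖ :=
      ((hg _ (pre_glue u (fun _ => false))).trans (le_abs_self _)).trans (g.norm_coe_le_norm _)
    have h4 := hS g
    have : c * (n / 2) ≤ c * ‖g‖ := by gcongr
    linarith
  set A := 2 * (‖S‖ + 3) / c with hA
  have hApos : 0 < A := by positivity
  obtain ⟨n, hnA⟩ := exists_nat_gt (A ^ 2 + 1)
  have hn1 : (1 : ℝ) ≤ n := by nlinarith [sq_nonneg A]
  have hn0 : 0 < n := by exact_mod_cast (lt_of_lt_of_le one_pos hn1)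
  have h1 := key2 n hn0
  have hsq : Real.sqrt n * Real.sqrt n = n := Real.mul_self_sqrt (by linarith)
  have hs1 : 1 ≤ Real.sqrt n := Real.one_le_sqrt.2 hn1
  have h2 : c * (n / 2) ≤ Real.sqrt n * (‖S‖ + 3) := by nlinarith
  have h3 : Real.sqrt n * c ≤ 2 * (‖S‖ + 3) := by
    have : Real.sqrt n * (Real.sqrt n * c) ≤ Real.sqrt n * (2 * (‖S‖ + 3)) := by
      rw [← mul_assoc, hsq]; linarith
    exact le_of_mul_le_mul_left this (by linarith)
  have h4 : Real.sqrt n ≤ A := by rw [hA, le_div_iff₀ hc]; exact h3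
  have h5 : (n : ℝ) ≤ A ^ 2 := by rw [← hsq, sq]; gcongr
  linarith

/-- **The amalgam does not contain `C(2^ℕ)`.** -/
theorem amalgam_not_embeds {Y : Type*} [NormedAddCommGroup Y] [NormedSpace ℝ Y]
    (lab : ℕ → CantorC) (lev : ℕ → ℕ) (B : Set (ℕ → ℕ)) (ι : VT →ₗ[ℝ] Y) (hι : DenseRange ι)
    (hιn : ∀ v, ‖ι v‖ = nu lab lev (Tr B) v)
    (H4 : ∀ σ, (∀ n, pfx σ n ∈ Tr B) → σ ∈ B)
    (hnu : ∀ σ ∈ B, ¬ Embeds CantorC (Xspan (lab ∘ σ))) : ¬ Embeds CantorC Y := by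
  have hext : ∀ s : ℕ × List ℕ, ∃ q : Seminorm ℝ Y, s.2 ∈ Tr B → s.1 ≤ s.2.length →
      (∀ v, q (ι v) = segp lab lev s v) ∧ ∀ y, q y ≤ 1 * ‖y‖ := by
    intro s
    by_cases h : s.2 ∈ Tr B ∧ s.1 ≤ s.2.length
    · obtain ⟨q, hq⟩ := exists_seminorm_extend ι hι (segp lab lev s) 1 (fun v => by
        rw [one_mul, hιn]; exact segp_le_nu lab lev h.1 h.2 v)
      exact ⟨q, fun _ _ => hq⟩
    · exact ⟨0, fun h1 h2 => absurd ⟨h1, h2⟩ h⟩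
  choose pY hpY using hext
  have hc : ∀ s : ℕ × List ℕ, s.2 ∈ Tr B → s.1 ≤ s.2.length → Continuous (pY s) := fun s h1 h2 =>
    seminorm_continuous _ 1 (hpY s h1 h2).2
  have hp0 : ∀ σ ∈ B, ∀ n, pfx σ n ∈ Tr B := fun σ hσ n => ⟨σ, hσ, n, rfl⟩
  have H1 : ∀ F, Adm (Tr B) F → ∀ y, ∑ s ∈ F, pY s y ≤ Real.sqrt F.card * ‖y‖ := by
    intro F hF
    refine le_of_dense ι hι (fun y => ∑ s ∈ F, pY s y) (fun y => Real.sqrt F.card * ‖y‖)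
      (continuous_finsetSum _ fun s hs => hc s (hF.1 s hs).1 (hF.1 s hs).2)
      (continuous_const.mul continuous_norm) ?_
    intro v
    change ∑ s ∈ F, pY s (ι v) ≤ Real.sqrt F.card * ‖ι v‖
    rw [hιn, Finset.sum_congr rfl fun s hs => (hpY s (hF.1 s hs).1 (hF.1 s hs).2).1 v]
    exact sum_le_nu lab lev hF v
  have H2 : ∀ b ∈ Tr B, ∀ k < b.length, ∀ y, pY (0, b) y ≤ pY (0, b.take k) y + pY (k + 1, b) y := by
    intro b hb k hk
    refine le_of_dense ι hι (fun y => pY (0, b) y) (fun y => pY (0, b.take k) y + pY (k + 1, b) y)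
      (hc (0, b) hb (Nat.zero_le _))
      ((hc (0, b.take k) (Tr_take hb k) (Nat.zero_le _)).add (hc (k + 1, b) hb hk)) ?_
    intro v
    change pY (0, b) (ι v) ≤ pY (0, b.take k) (ι v) + pY (k + 1, b) (ι v)
    rw [(hpY (0, b) hb (Nat.zero_le _)).1, (hpY (0, b.take k) (Tr_take hb k) (Nat.zero_le _)).1,
      (hpY (k + 1, b) hb hk).1]
    exact segp_split lab lev b k hk.le v
  have H3 : ∀ σ ∈ B, ∀ (S : CantorC →L[ℝ] Y) (ε : ℝ), 0 < ε →
      ∃ J : Copy, ∀ n f, pY (0, pfx σ n) (S (J f)) ≤ ε * ‖f‖ := by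
    intro σ hσ S ε hε
    exact step_one lab lev B ι hι hιn σ hσ (hnu σ hσ) pY
      (fun n v => (hpY (0, pfx σ n) (hp0 σ hσ n) (Nat.zero_le _)).1 v)
      (fun n y => (hpY (0, pfx σ n) (hp0 σ hσ n) (Nat.zero_le _)).2 y) S ε hε
  refine step_three lab lev (Tr B) ι hι hιn ?_
  intro S ε hε
  obtain ⟨J, hJ⟩ := step_two pY H1 H2 H3 H4 S ε hε
  refine ⟨J, fun f b hb v => ?_⟩
  have h1 := hpY (0, b) hb (Nat.zero_le _)
  rw [← h1.1]
  have h2 := map_add_le_add (pY (0, b)) (S (J f)) (ι v - S (J f))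
  rw [add_sub_cancel] at h2
  have h3 := h1.2 (ι v - S (J f))
  have h4 := hJ f b hb
  linarith

end

noncomputable section

/-- **Banach–Mazur.** -/
theorem banach_mazur (E : Type*) [NormedAddCommGroup E] [NormedSpace ℝ E]
    [TopologicalSpace.SeparableSpace E] : Nonempty (E →ₗᵢ[ℝ] CantorC) := by
  set K : Set (WeakDual ℝ E) := WeakDual.toStrongDual ⁻¹' Metric.closedBall 0 1 with hK
  have hKc : IsCompact K := WeakDual.isCompact_closedBall (0 : StrongDual ℝ E) 1
  have hKm : TopologicalSpace.MetrizableSpace K := WeakDual.metrizable_of_isCompact ℝ E K hKc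
  have hmem : ∀ φ : StrongDual ℝ E, ‖φ‖ ≤ 1 → StrongDual.toWeakDual φ ∈ K := by
    intro φ hφ
    rw [hK, Set.mem_preimage, mem_closedBall_zero_iff]
    exact hφ
  let : MetricSpace K := TopologicalSpace.metrizableSpaceMetric K
  have : CompactSpace K := isCompact_iff_compactSpace.1 hKc
  have : Nonempty K := ⟨⟨StrongDual.toWeakDual 0, hmem 0 (by simp)⟩⟩
  obtain ⟨g, hg, hgs⟩ := exists_nat_bool_continuous_surjective_of_compact K
  have hcont : ∀ v : E, Continuous fun x : CantorSet => ((g x : WeakDual ℝ E) : WeakDual ℝ E) v :=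
    fun v => (WeakDual.eval_continuous v).comp (continuous_subtype_val.comp hg)
  let A : E →ₗ[ℝ] CantorC :=
    { toFun := fun v => ⟨fun x => (g x : WeakDual ℝ E) v, hcont v⟩
      map_add' := fun v w => by ext x; exact map_add (g x : WeakDual ℝ E) v w
      map_smul' := fun c v => by ext x; exact map_smul (g x : WeakDual ℝ E) c v }
  refine ⟨⟨A, fun v => le_antisymm ?_ ?_⟩⟩
  · rw [ContinuousMap.norm_le _ (norm_nonneg _)]
    intro x
    have h1 : ‖WeakDual.toStrongDual (g x : WeakDual ℝ E)‖ ≤ 1 := by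
      have : WeakDual.toStrongDual (g x : WeakDual ℝ E) ∈ Metric.closedBall 0 1 := (g x).2
      exact mem_closedBall_zero_iff.1 this
    have h2 := (WeakDual.toStrongDual (g x : WeakDual ℝ E)).le_of_opNorm_le h1 v
    rw [one_mul] at h2
    exact h2
  · obtain ⟨φ, hφ, hv⟩ := exists_dual_vector'' ℝ v
    obtain ⟨x, hx⟩ := hgs ⟨StrongDual.toWeakDual φ, hmem φ hφ⟩
    have h1 : A v x = ‖v‖ := by
      change (g x : WeakDual ℝ E) v = ‖v‖
      rw [hx]; exact hv
    rw [← h1]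
    exact (le_abs_self _).trans ((A v).norm_coe_le_norm x)

/-- Banach–Mazur for seminorms -/
theorem banach_mazur_seminorm {V : Type*} [AddCommGroup V] [Module ℝ V] (p : Seminorm ℝ V)
    {I : Type*} [Countable I] [Nonempty I] (d : I → V) (hd : ∀ v, ∀ ε > 0, ∃ i, p (v - d i) < ε) :
    ∃ ι : V →ₗ[ℝ] CantorC, ∀ v, ‖ι v‖ = p v := by
  let : SeminormedAddCommGroup V := p.toAddGroupSeminorm.toSeminormedAddCommGroup
  have hn : ∀ v : V, ‖v‖ = p v := fun v => rfl
  let : NormedSpace ℝ V := ⟨fun c v => by rw [hn, hn, map_smul_eq_mul]⟩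
  have : TopologicalSpace.SeparableSpace V := by
    refine ⟨⟨Set.range d, Set.countable_range d, ?_⟩⟩
    rw [← DenseRange, Metric.denseRange_iff]
    intro v ε hε
    obtain ⟨i, hi⟩ := hd v ε hε
    exact ⟨i, by rw [dist_eq_norm, hn]; exact hi⟩
  have : TopologicalSpace.SeparableSpace (SeparationQuotient V) :=
    SeparationQuotient.surjective_mk.denseRange.separableSpace SeparationQuotient.continuous_mk
  obtain ⟨A⟩ := banach_mazur (SeparationQuotient V)
  refine ⟨A.toLinearMap.comp (SeparationQuotient.mkCLM ℝ V).toLinearMap, fun v => ?_⟩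
  rw [← hn]
  change ‖A (SeparationQuotient.mk v)‖ = ‖v‖
  rw [A.norm_map, SeparationQuotient.norm_mk]

theorem nu_separable (lab : ℕ → CantorC) (lev : ℕ → ℕ) (T : Set (List ℕ)) :
    ∃ d : (List ℕ →₀ ℕ) → VT, ∀ v, ∀ ε > 0, ∃ i, nu lab lev T (v - d i) < ε := by
  classical
  set D : ℕ → CantorC := fun n => n.casesOn 0 (TopologicalSpace.denseSeq CantorC) with hD
  refine ⟨fun i => i.mapRange D rfl, fun v ε hε => ?_⟩
  set η : ℝ := ε / (4 * (v.support.card + 1)) with hη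
  have hηp : 0 < η := by positivity
  have h1 : ∀ t, ∃ n, ‖v t - D n‖ < η := by
    intro t
    obtain ⟨n, hn⟩ := Metric.denseRange_iff.1 (TopologicalSpace.denseRange_denseSeq CantorC) (v t) η hηp
    exact ⟨n + 1, by rw [← dist_eq_norm]; exact hn⟩
  choose n hn using h1
  let i : List ℕ →₀ ℕ := Finsupp.onFinset v.support (fun t => if t ∈ v.support then n t else 0)
    (fun t ht => by by_contra h; simp [h] at ht)
  refine ⟨i, (nu_le_sum _ _ _ _).trans_lt ?_⟩
  have hi : ∀ t ∈ v.support, (v - i.mapRange D rfl) t = v t - D (n t) := by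
    intro t ht
    rw [Finsupp.sub_apply, Finsupp.mapRange_apply, Finsupp.onFinset_apply, if_pos ht]
  have hi' : ∀ t, t ∉ v.support → (v - i.mapRange D rfl) t = 0 := by
    intro t ht
    rw [Finsupp.sub_apply, Finsupp.mapRange_apply, Finsupp.onFinset_apply, if_neg ht,
      Finsupp.notMem_support_iff.1 ht]
    exact sub_zero _
  have hsub : (v - i.mapRange D rfl).support ⊆ v.support := by
    intro t ht
    by_contra h
    exact Finsupp.mem_support_iff.1 ht (hi' t h)
  have h2 : ∑ t ∈ (v - i.mapRange D rfl).support, ‖(v - i.mapRange D rfl) t‖ ≤ v.support.card * η := by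
    refine (Finset.sum_le_sum_of_subset_of_nonneg hsub fun _ _ _ => norm_nonneg _).trans ?_
    rw [← nsmul_eq_mul]
    refine Finset.sum_le_card_nsmul _ _ _ fun t ht => ?_
    rw [hi t ht]; exact (hn t).le
  have h3 : 4 * (v.support.card * η) < ε := by
    have : 4 * ((v.support.card + 1) * η) = ε := by rw [hη]; field_simp
    nlinarith
  linarith

/-- **Main amalgamation theorem.** -/
theorem amalgam (lab : ℕ → CantorC) (lev : ℕ → ℕ) (hlev : ∀ i, QQ (lev i) (lab i) = lab i)
    (B : Set (ℕ → ℕ)) (hB : IsClosed B) (hnu : ∀ σ ∈ B, ¬ Embeds CantorC (Xspan (lab ∘ σ))) :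
    ∃ Y : SB, ¬ Embeds CantorC Y.1 ∧ ∀ σ ∈ B, Embeds (Xspan (lab ∘ σ)) Y.1 := by
  obtain ⟨d, hd⟩ := nu_separable lab lev (Tr B)
  obtain ⟨ι, hι⟩ := banach_mazur_seminorm _ d hd
  let Y : Submodule ℝ CantorC := (LinearMap.range ι).topologicalClosure
  have hYc : IsClosed (Y : Set CantorC) := Submodule.isClosed_topologicalClosure _
  let ι' : VT →ₗ[ℝ] Y := ι.codRestrict Y fun v =>
    Submodule.le_topologicalClosure _ (LinearMap.mem_range_self ι v)
  have hι' : ∀ v, ‖ι' v‖ = nu lab lev (Tr B) v := fun v => hι v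
  have hdense : DenseRange ι' := by
    rw [Metric.denseRange_iff]
    intro y ε hε
    obtain ⟨z, ⟨v, rfl⟩, hz⟩ := Metric.mem_closure_iff.1 y.2 ε hε
    exact ⟨v, hz⟩
  have : CompleteSpace Y := hYc.completeSpace_coe
  have H4 : ∀ σ, (∀ n, pfx σ n ∈ Tr B) → σ ∈ B := by
    intro σ h
    rw [← hB.closure_eq, mem_closure_iff_nhds]
    intro U hU
    obtain ⟨I, t, ht, hsub⟩ := isOpen_pi_iff.1 isOpen_interior σ (mem_interior_iff_mem_nhds.2 hU)
    obtain ⟨n, hn⟩ := I.exists_nat_subset_range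
    obtain ⟨τ, hτ, m, hm⟩ := h n
    refine ⟨τ, interior_subset (hsub fun i hi => ?_), hτ⟩
    have hnm : n = m := by simpa using congrArg List.length hm
    subst hnm
    have hin : i < n := Finset.mem_range.1 (hn hi)
    have hst : σ i = τ i := by
      have := congrArg (fun l => l[i]?) hm
      simpa [pfx, hin] using this
    rw [← hst]
    exact (ht i hi).2
  refine ⟨⟨Y, hYc⟩, amalgam_not_embeds lab lev B ι' hdense hι' H4 hnu, fun σ hσ => ?_⟩
  refine embeds_Xspan (lab ∘ σ) (ι'.comp (Bmap lab lev σ)) 1 6 one_pos (fun a => ?_) (fun a => ?_)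
  · exact (hι' _).trans_le (nu_Bmap lab lev hlev B σ hσ a).2
  · rw [one_mul]; exact (nu_Bmap lab lev hlev B σ hσ a).1.trans (hι' _).ge

end

noncomputable section

/-! ### Coding of separable spaces by sequences of locally constant functions -/

/-- a dense sequence of locally constant functions -/
def DD : ℕ → CantorC
  | 0 => 0
  | n + 1 => QQ (n.unpair).1 (TopologicalSpace.denseSeq CantorC (n.unpair).2)

def DDlev : ℕ → ℕ
  | 0 => 0
  | n + 1 => (n.unpair).1

theorem QQ_DD (i : ℕ) : QQ (DDlev i) (DD i) = DD i := by
  cases i with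
  | zero => simp [DD]
  | succ n => rw [DD, DDlev, QQ_QQ, min_self]

theorem denseRange_DD : DenseRange DD := by
  rw [Metric.denseRange_iff]
  intro f ε hε
  obtain ⟨j, hj⟩ := Metric.denseRange_iff.1 (TopologicalSpace.denseRange_denseSeq CantorC) f (ε / 2)
    (by linarith)
  obtain ⟨m, hm⟩ := (((tendsto_QQ (TopologicalSpace.denseSeq CantorC j)).eventually
    (Metric.ball_mem_nhds _ (half_pos hε)))).exists
  refine ⟨Nat.pair m j + 1, ?_⟩
  rw [DD, Nat.unpair_pair]
  have h1 : dist (QQ m (TopologicalSpace.denseSeq CantorC j)) (TopologicalSpace.denseSeq CantorC j)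
    < ε / 2 := hm
  calc dist f _ ≤ dist f (TopologicalSpace.denseSeq CantorC j) +
        dist (TopologicalSpace.denseSeq CantorC j) (QQ m (TopologicalSpace.denseSeq CantorC j)) :=
        dist_triangle _ _ _
    _ < ε := by rw [dist_comm _ (QQ _ _)]; linarith

/-- equivalence of sequences with constant `2` -/
def Eqv2 {X Z : Type*} [NormedAddCommGroup X] [NormedSpace ℝ X]
    [NormedAddCommGroup Z] [NormedSpace ℝ Z] (x : ℕ → X) (y : ℕ → Z) : Prop :=
  ∀ a : ℕ →₀ ℝ, ‖Finsupp.linearCombination ℝ x a‖ ≤ 2 * ‖Finsupp.linearCombination ℝ y a‖ ∧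
    ‖Finsupp.linearCombination ℝ y a‖ ≤ 2 * ‖Finsupp.linearCombination ℝ x a‖

theorem exists_phi (x : CantorC) : ∃ φ : CantorC →L[ℝ] ℝ, (x ≠ 0 → φ x = 1) ∧ (x = 0 → φ = 0) := by
  by_cases h : x = 0
  · exact ⟨0, fun h' => absurd h h', fun _ => rfl⟩
  · obtain ⟨g, _, hg⟩ := exists_dual_vector'' ℝ x
    have hx : ‖x‖ ≠ 0 := norm_ne_zero_iff.2 h
    refine ⟨‖x‖⁻¹ • g, fun _ => ?_, fun h' => absurd h' h⟩
    rw [ContinuousLinearMap.smul_apply, hg]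
    simp [hx]

def phi (x : CantorC) : CantorC →L[ℝ] ℝ := (exists_phi x).choose

theorem phi_ne {x : CantorC} (h : x ≠ 0) : phi x x = 1 := (exists_phi x).choose_spec.1 h
theorem phi_zero {x : CantorC} (h : x = 0) : phi x = 0 := (exists_phi x).choose_spec.2 h

theorem phi_smul (x : CantorC) : phi x x • x = x := by
  by_cases h : x = 0
  · rw [h, smul_zero]
  · rw [phi_ne h, one_smul]

/-- Gram–Schmidt projections -/
def gsP (d : ℕ → CantorC) : ℕ → (CantorC →L[ℝ] CantorC)
  | 0 => 0
  | n + 1 => gsP d n +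
      ((phi (d n - gsP d n (d n))).comp (ContinuousLinearMap.id ℝ CantorC - gsP d n)).smulRight
        (d n - gsP d n (d n))

def gsx (d : ℕ → CantorC) (n : ℕ) : CantorC := d n - gsP d n (d n)

def gss (d : ℕ → CantorC) (n : ℕ) : CantorC →L[ℝ] ℝ :=
  (phi (gsx d n)).comp (ContinuousLinearMap.id ℝ CantorC - gsP d n)

theorem gss_apply (d : ℕ → CantorC) (n : ℕ) (y : CantorC) :
    gss d n y = phi (gsx d n) (y - gsP d n y) := rfl

theorem gsP_succ (d : ℕ → CantorC) (n : ℕ) (y : CantorC) :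
    gsP d (n + 1) y = gsP d n y + gss d n y • gsx d n := rfl

theorem gsP_idem (d : ℕ → CantorC) (n : ℕ) : ∀ y, gsP d n (gsP d n y) = gsP d n y := by
  induction n with
  | zero => intro y; rfl
  | succ n ih =>
    intro y
    have hx : gsP d n (gsx d n) = 0 := by rw [gsx, map_sub, ih, sub_self]
    have hs : gss d n (gsP d n y) = 0 := by rw [gss_apply, ih, sub_self, map_zero]
    have hsx : gss d n (gsx d n) • gsx d n = gsx d n := by
      rw [gss_apply, hx, sub_zero, phi_smul]
    rw [gsP_succ d n y, map_add, map_smul, gsP_succ d n (gsP d n y), gsP_succ d n (gsx d n), ih, hs,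
      hx, hsx]
    simp

theorem gsP_x (d : ℕ → CantorC) (n : ℕ) : gsP d n (gsx d n) = 0 := by
  rw [gsx, map_sub, gsP_idem, sub_self]

theorem gss_smul (d : ℕ → CantorC) (n : ℕ) : gss d n (gsx d n) • gsx d n = gsx d n := by
  rw [gss_apply, gsP_x, sub_zero, phi_smul]

theorem gss_P (d : ℕ → CantorC) (n : ℕ) (y : CantorC) : gss d n (gsP d n y) = 0 := by
  rw [gss_apply, gsP_idem, sub_self, map_zero]

theorem gsP_comp (d : ℕ → CantorC) (n k : ℕ) (y : CantorC) :
    gsP d (n + k) (gsP d n y) = gsP d n y ∧ gsP d n (gsP d (n + k) y) = gsP d n y := by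
  induction k generalizing y with
  | zero => exact ⟨gsP_idem d n y, gsP_idem d n y⟩
  | succ k ih =>
    have hx : gsP d n (gsx d (n + k)) = 0 := by
      rw [← (ih (gsx d (n + k))).2, gsP_x, map_zero]
    have hs : gss d (n + k) (gsP d n y) = 0 := by
      rw [← (ih y).1, gss_P]
    rw [← Nat.add_assoc]
    constructor
    · rw [gsP_succ, (ih y).1, hs, zero_smul, add_zero]
    · rw [gsP_succ, map_add, map_smul, hx, smul_zero, add_zero, (ih y).2]

theorem gsP_succ_x (d : ℕ → CantorC) (n : ℕ) : gsP d (n + 1) (gsx d n) = gsx d n := by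
  rw [gsP_succ, gsP_x, gss_smul, zero_add]

theorem gss_self (d : ℕ → CantorC) (n : ℕ) (h : gsx d n ≠ 0) : gss d n (gsx d n) = 1 := by
  rw [gss_apply, gsP_x, sub_zero, phi_ne h]

theorem gss_ne (d : ℕ → CantorC) {m n : ℕ} (h : m ≠ n) : gss d m (gsx d n) = 0 := by
  rcases lt_or_gt_of_ne h with h | h
  · by_cases hx : gsx d m = 0
    · rw [gss_apply, phi_zero hx]; rfl
    · obtain ⟨k, rfl⟩ : ∃ k, n = m + 1 + k := ⟨n - m - 1, by omega⟩
      have h1 : gsP d (m + 1) (gsx d (m + 1 + k)) = 0 := by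
        rw [← (gsP_comp d (m + 1) k _).2, gsP_x, map_zero]
      have h2 : gsP d m (gsx d (m + 1 + k)) = 0 := by
        rw [← (gsP_comp d m 1 _).2, h1, map_zero]
      rw [gsP_succ, h2, zero_add] at h1
      exact (smul_eq_zero.1 h1).resolve_right hx
  · obtain ⟨k, rfl⟩ : ∃ k, m = n + 1 + k := ⟨m - n - 1, by omega⟩
    have h1 : gsP d (n + 1 + k) (gsx d n) = gsx d n := by
      rw [← gsP_succ_x d n]; exact (gsP_comp d (n + 1) k _).1
    rw [← h1, gss_P]

theorem gsP_mem (d : ℕ → CantorC) (n : ℕ) (y : CantorC) :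
    gsP d n y ∈ Submodule.span ℝ (gsx d '' Set.Iio n) := by
  induction n with
  | zero => exact Submodule.zero_mem _
  | succ n ih =>
    rw [gsP_succ]
    refine Submodule.add_mem _ (Submodule.span_mono (Set.image_mono fun i hi => ?_) ih)
      (Submodule.smul_mem _ _ (Submodule.subset_span ⟨n, Nat.lt_succ_self n, rfl⟩))
    exact Nat.lt_succ_of_lt hi

theorem gsx_mem (d : ℕ → CantorC) (E : Submodule ℝ CantorC) (hd : ∀ n, d n ∈ E) (n : ℕ) :
    gsx d n ∈ E := by
  induction n using Nat.strong_induction_on with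
  | _ n ih =>
    refine Submodule.sub_mem _ (hd n) (Submodule.span_le.2 ?_ (gsP_mem d n (d n)))
    rintro _ ⟨i, hi, rfl⟩
    exact ih i hi

theorem d_mem_span (d : ℕ → CantorC) (n : ℕ) : d n ∈ Submodule.span ℝ (Set.range (gsx d)) := by
  have h1 : d n = gsx d n + gsP d n (d n) := by rw [gsx]; abel
  rw [h1]
  exact Submodule.add_mem _ (Submodule.subset_span ⟨n, rfl⟩)
    (Submodule.span_mono (Set.image_subset_range _ _) (gsP_mem d n (d n)))

/-- **Coding**. -/
theorem exists_code (X : SB) : ∃ (x : ℕ → CantorC) (σ : ℕ → ℕ), Xspan x = X.1 ∧ Eqv2 x (DD ∘ σ) := by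
  let d : ℕ → CantorC := fun n => (TopologicalSpace.denseSeq X.1 n : CantorC)
  have hd : ∀ n, d n ∈ X.1 := fun n => (TopologicalSpace.denseSeq X.1 n).2
  have hch : ∀ n, ∃ k, (gsx d n = 0 → DD k = 0) ∧
      ‖gsx d n - DD k‖ ≤ (1 / 2) ^ (n + 2) / (‖gss d n‖ + 1) := by
    intro n
    by_cases h : gsx d n = 0
    · refine ⟨0, fun _ => rfl, ?_⟩
      rw [h, DD, sub_zero, norm_zero]; positivity
    · obtain ⟨k, hk⟩ := Metric.denseRange_iff.1 denseRange_DD (gsx d n)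
        ((1 / 2) ^ (n + 2) / (‖gss d n‖ + 1)) (by positivity)
      exact ⟨k, fun h' => absurd h' h, by rw [← dist_eq_norm]; exact hk.le⟩
  choose σ hσ0 hσ using hch
  refine ⟨gsx d, σ, ?_, ?_⟩
  · apply le_antisymm
    · refine Submodule.topologicalClosure_minimal _ (Submodule.span_le.2 ?_) X.2
      rintro _ ⟨n, rfl⟩
      exact gsx_mem d X.1 hd n
    · intro y hy
      refine Metric.mem_closure_iff.2 fun ε hε => ?_
      obtain ⟨n, hn⟩ := Metric.denseRange_iff.1 (TopologicalSpace.denseRange_denseSeq X.1) ⟨y, hy⟩ ε hε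
      exact ⟨d n, d_mem_span d n, hn⟩
  · intro a
    have hcoef : ∀ n, gsx d n ≠ 0 → |a n| ≤ ‖gss d n‖ * ‖Finsupp.linearCombination ℝ (gsx d) a‖ := by
      intro n hn
      have h1 : gss d n (Finsupp.linearCombination ℝ (gsx d) a) = a n := by
        rw [Finsupp.linearCombination_apply, Finsupp.sum, map_sum, Finset.sum_eq_single n]
        · rw [map_smul, gss_self d n hn, smul_eq_mul, mul_one]
        · intro b _ hb
          rw [map_smul, gss_ne d hb.symm, smul_zero]
        · intro hna
          rw [Finsupp.notMem_support_iff.1 hna, zero_smul, map_zero]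
      rw [← h1, ← Real.norm_eq_abs]
      exact (gss d n).le_opNorm _
    have hdiff : ‖Finsupp.linearCombination ℝ (gsx d) a - Finsupp.linearCombination ℝ (DD ∘ σ) a‖ ≤
        1 / 2 * ‖Finsupp.linearCombination ℝ (gsx d) a‖ := by
      set L := ‖Finsupp.linearCombination ℝ (gsx d) a‖ with hL
      have hL0 : 0 ≤ L := norm_nonneg _
      rw [Finsupp.linearCombination_apply, Finsupp.linearCombination_apply, Finsupp.sum, Finsupp.sum,
        ← Finset.sum_sub_distrib]
      have hterm : ∀ n ∈ a.support, ‖a n • gsx d n - a n • (DD ∘ σ) n‖ ≤ (1 / 2) ^ (n + 2) * L := by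
        intro n _
        rw [← smul_sub, norm_smul, Real.norm_eq_abs]
        by_cases h : gsx d n = 0
        · rw [Function.comp_apply, hσ0 n h, h, sub_zero, norm_zero, mul_zero]; positivity
        · calc |a n| * ‖gsx d n - (DD ∘ σ) n‖
              ≤ (‖gss d n‖ * L) * ((1 / 2) ^ (n + 2) / (‖gss d n‖ + 1)) :=
                mul_le_mul (hcoef n h) (hσ n) (norm_nonneg _) (by positivity)
            _ = (‖gss d n‖ / (‖gss d n‖ + 1)) * ((1 / 2) ^ (n + 2) * L) := by ring
            _ ≤ 1 * ((1 / 2) ^ (n + 2) * L) := by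
                gcongr
                rw [div_le_one (by positivity)]; linarith
            _ = _ := one_mul _
      refine (norm_sum_le_of_le _ hterm).trans ?_
      rw [← Finset.sum_mul]
      gcongr
      have h2 : Summable fun n : ℕ => ((1 : ℝ) / 2) ^ (n + 2) := by
        simpa only [pow_add] using summable_geometric_two.mul_right (((1 : ℝ) / 2) ^ 2)
      refine (h2.sum_le_tsum a.support fun _ _ => by positivity).trans (le_of_eq ?_)
      simp only [pow_add]
      rw [tsum_mul_right, tsum_geometric_two]; norm_num
    set u := Finsupp.linearCombination ℝ (gsx d) a
    set w := Finsupp.linearCombination ℝ (DD ∘ σ) a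
    have h1 : ‖u‖ ≤ ‖u - w‖ + ‖w‖ := by simpa using norm_add_le (u - w) w
    have h2 : ‖w‖ ≤ ‖u - w‖ + ‖u‖ := by
      rw [norm_sub_rev]; simpa using norm_add_le (w - u) u
    have := norm_nonneg u
    constructor <;> linarith

theorem Eqv2.embeds {X Z : Type*} [NormedAddCommGroup X] [NormedSpace ℝ X]
    [NormedAddCommGroup Z] [NormedSpace ℝ Z] [CompleteSpace Z] {x : ℕ → X} {y : ℕ → Z}
    (h : Eqv2 x y) : Embeds (Xspan x) (Xspan y) := by
  have : CompleteSpace (Xspan y) := (isClosed_Xspan y).completeSpace_coe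
  refine embeds_Xspan x (Xmap y) (1 / 2) 2 (by norm_num) (fun a => (h a).2) (fun a => ?_)
  have h1 := (h a).1
  change _ ≤ ‖Finsupp.linearCombination ℝ y a‖
  linarith

theorem Eqv2.symm {X Z : Type*} [NormedAddCommGroup X] [NormedSpace ℝ X]
    [NormedAddCommGroup Z] [NormedSpace ℝ Z] {x : ℕ → X} {y : ℕ → Z}
    (h : Eqv2 x y) : Eqv2 y x := fun a => ⟨(h a).2, (h a).1⟩

end

noncomputable section

/-! ### Analytic classes -/

theorem SB_ext {X X' : SB} (h : X.1 = X'.1) : X = X' := Subtype.ext h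

/-- the closed span as an element of `SB` -/
def Sp (x : ℕ → CantorC) : SB := ⟨Xspan x, isClosed_Xspan x⟩

theorem continuous_lc {Z : Type*} [NormedAddCommGroup Z] [NormedSpace ℝ Z] (a : ℕ →₀ ℝ) :
    Continuous fun x : ℕ → Z => Finsupp.linearCombination ℝ x a := by
  simp only [Finsupp.linearCombination_apply, Finsupp.sum]
  exact continuous_finsetSum _ fun i _ => (continuous_apply i).const_smul _

theorem Sp_inter_nonempty (x : ℕ → CantorC) (U : Set CantorC) (hU : IsOpen U) :
    (((Sp x).1 : Set CantorC) ∩ U).Nonempty ↔ ∃ a : ℕ →₀ ℝ, Finsupp.linearCombination ℝ x a ∈ U := by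
  constructor
  · rintro ⟨y, hy, hyU⟩
    obtain ⟨z, hzU, hz⟩ := mem_closure_iff.1 hy U hU hyU
    obtain ⟨a, rfl⟩ := (Finsupp.mem_span_range_iff_exists_finsupp).1 hz
    exact ⟨a, by rw [Finsupp.linearCombination_apply]; exact hzU⟩
  · rintro ⟨a, ha⟩
    exact ⟨_, (Xmap x a).2, ha⟩

theorem measurable_into_SB {α : Type*} [MeasurableSpace α] (f : α → SB)
    (h : ∀ U : Set CantorC, IsOpen U → MeasurableSet {a | (((f a).1 : Set CantorC) ∩ U).Nonempty}) :
    Measurable f := by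
  refine measurable_generateFrom ?_
  rintro _ ⟨U, hU, rfl⟩
  exact h U hU

theorem measurableSet_inter {α : Type*} [MeasurableSpace α] (f : α → SB) (hf : Measurable f)
    (U : Set CantorC) (hU : IsOpen U) : MeasurableSet {a | (((f a).1 : Set CantorC) ∩ U).Nonempty} :=
  hf (MeasurableSpace.measurableSet_generateFrom ⟨U, hU, rfl⟩)

theorem measurable_Sp {α : Type*} [MeasurableSpace α] [TopologicalSpace α] [OpensMeasurableSpace α]
    (g : α → ℕ → CantorC) (hg : Continuous g) : Measurable fun a => Sp (g a) := by
  apply measurable_into_SB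
  intro U hU
  apply IsOpen.measurableSet
  simp only [Sp_inter_nonempty _ U hU]
  have : {a | ∃ b : ℕ →₀ ℝ, Finsupp.linearCombination ℝ (g a) b ∈ U} =
      ⋃ b : ℕ →₀ ℝ, (fun a => Finsupp.linearCombination ℝ (g a) b) ⁻¹' U := by
    ext a; simp
  rw [this]
  exact isOpen_iUnion fun b => hU.preimage ((continuous_lc b).comp hg)

theorem measurableSet_SB_eq {α : Type*} [MeasurableSpace α] (f g : α → SB) (hf : Measurable f)
    (hg : Measurable g) : MeasurableSet {a | f a = g a} := by
  have h1 : {a | f a = g a} = ⋂ U ∈ TopologicalSpace.countableBasis CantorC,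
      {a | (((f a).1 : Set CantorC) ∩ U).Nonempty ↔ (((g a).1 : Set CantorC) ∩ U).Nonempty} := by
    ext a
    simp only [Set.mem_ofPred_eq, Set.mem_iInter]
    constructor
    · intro h U _; rw [h]
    · intro h
      have key : ∀ E E' : SB, (∀ U ∈ TopologicalSpace.countableBasis CantorC,
          ((E.1 : Set CantorC) ∩ U).Nonempty → ((E'.1 : Set CantorC) ∩ U).Nonempty) → E.1 ≤ E'.1 := by
        intro E E' hU y hy
        have hc : y ∈ closure (E'.1 : Set CantorC) := by
          rw [(TopologicalSpace.isBasis_countableBasis CantorC).mem_closure_iff]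
          intro U hUb hyU
          rw [Set.inter_comm]
          exact hU U hUb ⟨y, hy, hyU⟩
        rwa [E'.2.closure_eq] at hc
      exact SB_ext (le_antisymm (key _ _ fun U hU => (h U hU).1) (key _ _ fun U hU => (h U hU).2))
  rw [h1]
  refine MeasurableSet.biInter (TopologicalSpace.countable_countableBasis CantorC) fun U hU => ?_
  have hUo := TopologicalSpace.isOpen_of_mem_countableBasis hU
  exact (measurableSet_inter f hf U hUo).iff (measurableSet_inter g hg U hUo)

theorem exists_param {α : Type*} [TopologicalSpace α] {s : Set α} (hs : AnalyticSet s)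
    (hne : s.Nonempty) : ∃ f : (ℕ → ℕ) → α, Continuous f ∧ Set.range f = s := by
  rw [AnalyticSet] at hs
  exact hs.resolve_left hne.ne_empty

/-- sequences in two spaces that are uniformly equivalent form a closed set -/
theorem isClosed_pairs (Z : Type*) [NormedAddCommGroup Z] [NormedSpace ℝ Z] :
    IsClosed {p : (ℕ → CantorC) × (ℕ → Z) × ℕ | ∀ a : ℕ →₀ ℝ,
    ‖Finsupp.linearCombination ℝ p.1 a‖ ≤ p.2.2 * ‖Finsupp.linearCombination ℝ p.2.1 a‖ ∧
    ‖Finsupp.linearCombination ℝ p.2.1 a‖ ≤ p.2.2 * ‖Finsupp.linearCombination ℝ p.1 a‖} := by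
  have : {p : (ℕ → CantorC) × (ℕ → Z) × ℕ | ∀ a : ℕ →₀ ℝ,
    ‖Finsupp.linearCombination ℝ p.1 a‖ ≤ p.2.2 * ‖Finsupp.linearCombination ℝ p.2.1 a‖ ∧
    ‖Finsupp.linearCombination ℝ p.2.1 a‖ ≤ p.2.2 * ‖Finsupp.linearCombination ℝ p.1 a‖}
      = ⋂ a : ℕ →₀ ℝ, {p : (ℕ → CantorC) × (ℕ → Z) × ℕ |
      ‖Finsupp.linearCombination ℝ p.1 a‖ ≤ p.2.2 * ‖Finsupp.linearCombination ℝ p.2.1 a‖ ∧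
      ‖Finsupp.linearCombination ℝ p.2.1 a‖ ≤ p.2.2 * ‖Finsupp.linearCombination ℝ p.1 a‖} := by
    ext p; rw [Set.mem_iInter]; exact Iff.rfl
  rw [this]
  refine isClosed_iInter fun a => ?_
  have h1 : Continuous fun p : (ℕ → CantorC) × (ℕ → Z) × ℕ =>
      ‖Finsupp.linearCombination ℝ p.1 a‖ := ((continuous_lc a).comp continuous_fst).norm
  have h2 : Continuous fun p : (ℕ → CantorC) × (ℕ → Z) × ℕ =>
      ‖Finsupp.linearCombination ℝ p.2.1 a‖ :=
    ((continuous_lc a).comp (continuous_fst.comp continuous_snd)).norm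
  have h3 : Continuous fun p : (ℕ → CantorC) × (ℕ → Z) × ℕ => (p.2.2 : ℝ) :=
    continuous_of_discreteTopology.comp (continuous_snd.comp continuous_snd)
  exact (isClosed_le h1 (h3.mul h2)).inter (isClosed_le h2 (h3.mul h1))

theorem polish_seq (Z : Type*) [NormedAddCommGroup Z] [NormedSpace ℝ Z] [CompleteSpace Z]
    [SecondCountableTopology Z] : PolishSpace (ℕ → Z) := inferInstance

theorem polish_prod {A B : Type*} [TopologicalSpace A] [TopologicalSpace B] [PolishSpace A]
    [PolishSpace B] : PolishSpace (A × B) := inferInstance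

theorem embeds_pairs {E Z : Type*} [SeminormedAddCommGroup E] [NormedSpace ℝ E]
    [NormedAddCommGroup Z] [NormedSpace ℝ Z] (T : E →L[ℝ] Z) (c : ℝ) (hc : 0 < c)
    (hT : ∀ x, c * ‖x‖ ≤ ‖T x‖) (x' : ℕ → E) : ∃ k : ℕ, ∀ a : ℕ →₀ ℝ,
    ‖Finsupp.linearCombination ℝ x' a‖ ≤ k * ‖Finsupp.linearCombination ℝ (fun n => T (x' n)) a‖ ∧
    ‖Finsupp.linearCombination ℝ (fun n => T (x' n)) a‖ ≤ k * ‖Finsupp.linearCombination ℝ x' a‖ := by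
  obtain ⟨k, hk⟩ := exists_nat_ge (max ‖T‖ (1 / c))
  refine ⟨k, fun a => ?_⟩
  have h2 : Finsupp.linearCombination ℝ (fun n => T (x' n)) a
      = T (Finsupp.linearCombination ℝ x' a) := by
    rw [Finsupp.linearCombination_apply, Finsupp.linearCombination_apply, Finsupp.sum,
        Finsupp.sum, map_sum]
    exact Finset.sum_congr rfl fun i _ => by rw [map_smul]
  rw [h2]
  constructor
  · have h3 := hT (Finsupp.linearCombination ℝ x' a)
    have h4 : 1 / c ≤ k := (le_max_right _ _).trans hk
    calc ‖Finsupp.linearCombination ℝ x' a‖ = 1 / c * (c * ‖Finsupp.linearCombination ℝ x' a‖) := by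
          field_simp
      _ ≤ k * ‖T (Finsupp.linearCombination ℝ x' a)‖ := by
          gcongr
  · exact T.le_of_opNorm_le ((le_max_left _ _).trans hk) _

theorem norm_lc_sub (X : Submodule ℝ CantorC) (x' : ℕ → X) (a : ℕ →₀ ℝ) :
    ‖Finsupp.linearCombination ℝ (fun n => (x' n : CantorC)) a‖ =
      ‖Finsupp.linearCombination ℝ x' a‖ := by
  have : Finsupp.linearCombination ℝ (fun n => (x' n : CantorC)) a =
      X.subtype (Finsupp.linearCombination ℝ x' a) := by
    rw [Finsupp.linearCombination_apply, Finsupp.linearCombination_apply, Finsupp.sum,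
      Finsupp.sum, map_sum]
    rfl
  rw [this]; rfl

/-- subspaces of `Z` form an analytic class -/
theorem analytic_embeds' (Z : Type) [NormedAddCommGroup Z] [NormedSpace ℝ Z] [CompleteSpace Z]
    [SecondCountableTopology Z] : IsAnalyticIn {X : SB | Embeds X.1 Z} := by
  obtain ⟨P, hPd⟩ : ∃ P, P = {p : (ℕ → CantorC) × (ℕ → Z) × ℕ | ∀ a : ℕ →₀ ℝ,
    ‖Finsupp.linearCombination ℝ p.1 a‖ ≤ p.2.2 * ‖Finsupp.linearCombination ℝ p.2.1 a‖ ∧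
    ‖Finsupp.linearCombination ℝ p.2.1 a‖ ≤ p.2.2 * ‖Finsupp.linearCombination ℝ p.1 a‖} := ⟨_, rfl⟩
  have hP : IsClosed P := hPd ▸ isClosed_pairs Z
  have p1 : PolishSpace (ℕ → CantorC) := polish_seq CantorC
  have p2 : PolishSpace (ℕ → Z) := polish_seq Z
  have p3 : PolishSpace ((ℕ → Z) × ℕ) := polish_prod
  have p4 : PolishSpace ((ℕ → CantorC) × (ℕ → Z) × ℕ) := polish_prod
  have hne : P.Nonempty := by
    rw [hPd]
    refine ⟨(fun _ => 0, fun _ => 0, 0), fun a => ?_⟩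
    have h1 : ∀ {Z : Type} [NormedAddCommGroup Z] [NormedSpace ℝ Z],
      Finsupp.linearCombination ℝ (fun _ : ℕ => (0 : Z)) a = 0 := by
      intros; simp [Finsupp.linearCombination_apply]
    constructor
    · rw [h1, norm_zero]; positivity
    · rw [h1, norm_zero]; positivity
  obtain ⟨f, hf, hfr⟩ := exists_param hP.analyticSet hne
  refine ⟨fun γ => Sp (f γ).1, measurable_Sp _ (continuous_fst.comp hf), ?_⟩
  ext X
  constructor
  · rintro ⟨T, c, hc, hT⟩
    obtain ⟨x, -, hx, -⟩ := exists_code X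
    have hxm : ∀ n, x n ∈ X.1 := fun n => by rw [← hx]; exact mem_Xspan x n
    obtain ⟨k, hk⟩ := embeds_pairs T c hc hT fun n => ⟨x n, hxm n⟩
    have hmem : ((x, fun n => T ⟨x n, hxm n⟩, k) : (ℕ → CantorC) × (ℕ → Z) × ℕ) ∈ P := by
      rw [hPd]
      intro a
      have h1 := norm_lc_sub X.1 (fun n => ⟨x n, hxm n⟩) a
      have h2 := hk a
      exact ⟨h1.trans_le h2.1, h2.2.trans_eq (congrArg (fun t : ℝ => (k : ℝ) * t) h1.symm)⟩
    rw [← hfr] at hmem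
    obtain ⟨γ, hγ⟩ := hmem
    refine ⟨γ, SB_ext ?_⟩
    change Xspan (f γ).1 = X.1
    rw [hγ]; exact hx
  · rintro ⟨γ, rfl⟩
    have hmem : f γ ∈ P := by rw [← hfr]; exact ⟨γ, rfl⟩
    rw [hPd] at hmem
    change Embeds (Xspan (f γ).1) Z
    generalize f γ = p at hmem
    refine embeds_Xspan p.1 (Finsupp.linearCombination ℝ p.2.1) (1 / (p.2.2 + 1)) p.2.2
      (by positivity) (fun a => (hmem a).2) (fun a => ?_)
    have h1 := (hmem a).1
    rw [one_div, inv_mul_le_iff₀ (by positivity)]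
    have := norm_nonneg (Finsupp.linearCombination ℝ p.2.1 a)
    linarith

theorem analytic_embeds (Y : SB) : IsAnalyticIn {X : SB | Embeds X.1 Y.1} := by
  have : CompleteSpace Y.1 := Y.2.completeSpace_coe
  exact analytic_embeds' Y.1

/-- (i) implies (iii) -/
theorem one_three (C : Set SB) (h : ∃ Y : SB, (∀ X ∈ C, Embeds ↥X.1 ↥Y.1) ∧ ¬ Embeds CantorC ↥Y.1) :
    ∃ A : Set SB, IsAnalyticIn A ∧ A ⊆ NU ∧ C ⊆ A := by
  obtain ⟨Y, hY, hnY⟩ := h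
  exact ⟨_, analytic_embeds Y, fun X hX hU => hnY (hU.trans' hX), hY⟩

/-- amalgamation of a set of codes with witnesses -/
theorem amalgam_codes (B : Set (ℕ → ℕ)) (hB : IsClosed B)
    (hnu : ∀ τ ∈ B, ¬ Embeds CantorC (Xspan (DD ∘ fun n => (τ n).unpair.1))) :
    ∃ Y : SB, ¬ Embeds CantorC Y.1 ∧
      ∀ X : SB, (∃ (x : ℕ → CantorC) (τ : ℕ → ℕ), Xspan x = X.1 ∧ τ ∈ B ∧
        Eqv2 x (DD ∘ fun n => (τ n).unpair.1)) → Embeds X.1 Y.1 := by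
  obtain ⟨Y, hY, hYB⟩ := amalgam (fun i => DD i.unpair.1) (fun i => DDlev i.unpair.1)
    (fun i => QQ_DD _) B hB hnu
  refine ⟨Y, hY, ?_⟩
  rintro X ⟨x, τ, hx, hτ, he⟩
  rw [← hx]
  exact he.embeds.trans' (hYB τ hτ)

/-- (iii) implies (i) -/
theorem three_one (C : Set SB) (h : ∃ A : Set SB, IsAnalyticIn A ∧ A ⊆ NU ∧ C ⊆ A) :
    ∃ Y : SB, (∀ X ∈ C, Embeds ↥X.1 ↥Y.1) ∧ ¬ Embeds CantorC ↥Y.1 := by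
  obtain ⟨A, ⟨f, hf, rfl⟩, hA, hCA⟩ := h
  let W := (ℕ → ℕ) × (ℕ → CantorC) × (ℕ → ℕ)
  let _ : MeasurableSpace W := borel W
  have : BorelSpace W := ⟨rfl⟩
  have p1 : PolishSpace (ℕ → CantorC) := polish_seq CantorC
  have p2 : PolishSpace ((ℕ → CantorC) × (ℕ → ℕ)) := polish_prod
  have : PolishSpace W := polish_prod
  have hR : MeasurableSet {p : W | Sp p.2.1 = f p.1 ∧ Eqv2 p.2.1 (DD ∘ p.2.2)} := by
    have h1 : MeasurableSet {p : W | Sp p.2.1 = f p.1} :=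
      measurableSet_SB_eq _ _ (measurable_Sp (fun p : W => p.2.1) (continuous_fst.comp continuous_snd))
        (hf.comp (continuous_fst : Continuous fun p : W => p.1).measurable)
    have h2 : IsClosed {p : W | Eqv2 p.2.1 (DD ∘ p.2.2)} := by
      have : {p : W | Eqv2 p.2.1 (DD ∘ p.2.2)} = ⋂ a : ℕ →₀ ℝ, {p : W |
        ‖Finsupp.linearCombination ℝ p.2.1 a‖ ≤ 2 * ‖Finsupp.linearCombination ℝ (DD ∘ p.2.2) a‖ ∧
        ‖Finsupp.linearCombination ℝ (DD ∘ p.2.2) a‖ ≤ 2 * ‖Finsupp.linearCombination ℝ p.2.1 a‖} := by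
        ext p; rw [Set.mem_iInter]; exact Iff.rfl
      rw [this]
      refine isClosed_iInter fun a => ?_
      have h3 : Continuous fun p : W => ‖Finsupp.linearCombination ℝ p.2.1 a‖ :=
        ((continuous_lc a).comp (continuous_fst.comp continuous_snd)).norm
      have h4 : Continuous fun p : W => DD ∘ p.2.2 :=
        continuous_pi fun n => continuous_of_discreteTopology.comp
          ((continuous_apply n).comp (continuous_snd.comp continuous_snd))
      have h5 : Continuous fun p : W => ‖Finsupp.linearCombination ℝ (DD ∘ p.2.2) a‖ :=
        ((continuous_lc a).comp h4).norm
      exact (isClosed_le h3 (continuous_const.mul h5)).inter (isClosed_le h5 (continuous_const.mul h3))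
    exact h1.inter h2.measurableSet
  have hRa := hR.analyticSet.image_of_continuous
    ((continuous_snd.comp continuous_snd : Continuous fun p : W => p.2.2))
  obtain ⟨x0, σ0, hx0, he0⟩ := exists_code (f fun _ => 0)
  obtain ⟨g, hg, hgr⟩ := exists_param hRa ⟨σ0, (fun _ => 0, x0, σ0), ⟨SB_ext hx0, he0⟩, rfl⟩
  have hun : ∀ φ : ℕ → ℕ, Continuous fun τ : ℕ → ℕ => fun n => φ (τ n) := fun φ =>
    continuous_pi fun n => continuous_of_discreteTopology.comp (continuous_apply n)
  let B : Set (ℕ → ℕ) := {τ | g (fun n => (τ n).unpair.2) = fun n => (τ n).unpair.1}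
  have hB : IsClosed B := isClosed_eq (hg.comp (hun fun i => i.unpair.2)) (hun fun i => i.unpair.1)
  obtain ⟨Y, hY, hYC⟩ := amalgam_codes B hB (by
    intro τ hτ hU
    have hτ' : g (fun n => (τ n).unpair.2) = fun n => (τ n).unpair.1 := hτ
    have : (fun n => (τ n).unpair.1) ∈ Set.range g := ⟨_, hτ'⟩
    rw [hgr] at this
    obtain ⟨p, ⟨hp1, hp2⟩, hp3⟩ := this
    rw [← hp3] at hU
    have h1 : Embeds CantorC (Sp p.2.1).1 := hU.trans' hp2.symm.embeds
    rw [hp1] at h1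
    exact hA ⟨p.1, rfl⟩ h1)
  refine ⟨Y, fun X hX => hYC X ?_, hY⟩
  obtain ⟨γ, rfl⟩ := hCA hX
  obtain ⟨x, σ, hx, he⟩ := exists_code (f γ)
  have : σ ∈ Set.range g := by
    rw [hgr]; exact ⟨(γ, x, σ), ⟨SB_ext hx, he⟩, rfl⟩
  obtain ⟨ρ, hρ⟩ := this
  have h1 : (fun n => (Nat.pair (σ n) (ρ n)).unpair.1) = σ := by ext n; simp
  have h2 : (fun n => (Nat.pair (σ n) (ρ n)).unpair.2) = ρ := by ext n; simp
  refine ⟨x, fun n => Nat.pair (σ n) (ρ n), hx, ?_, ?_⟩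
  · change g (fun n => (Nat.pair (σ n) (ρ n)).unpair.2) = fun n => (Nat.pair (σ n) (ρ n)).unpair.1
    rw [h1, h2, hρ]
  · rw [h1]; exact he

end

noncomputable section

/-! ### Schauder basis constants -/

/-- convergent sequences of partial sums -/
def PS {E : Type*} [NormedAddCommGroup E] [NormedSpace ℝ E] (e : ℕ → E) :
    Submodule ℝ C(OnePoint ℕ, E) where
  carrier := {f | f (0 : ℕ) = 0 ∧ ∀ n : ℕ, f (n + 1 : ℕ) - f n ∈ Submodule.span ℝ {e n}}
  add_mem' := by
    rintro f g ⟨hf, hf'⟩ ⟨hg, hg'⟩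
    refine ⟨by simp only [ContinuousMap.add_apply, hf, hg, add_zero], fun n => ?_⟩
    have := Submodule.add_mem _ (hf' n) (hg' n)
    simp only [ContinuousMap.add_apply]
    rwa [add_sub_add_comm]
  zero_mem' := ⟨rfl, fun n => by simp⟩
  smul_mem' := by
    rintro c f ⟨hf, hf'⟩
    refine ⟨by simp only [ContinuousMap.smul_apply, hf, smul_zero], fun n => ?_⟩
    have := Submodule.smul_mem _ c (hf' n)
    simp only [ContinuousMap.smul_apply]
    rwa [← smul_sub]

theorem isClosed_PS {E : Type*} [NormedAddCommGroup E] [NormedSpace ℝ E] (e : ℕ → E) :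
    IsClosed (PS e : Set C(OnePoint ℕ, E)) := by
  have h1 : IsClosed {f : C(OnePoint ℕ, E) | f (0 : ℕ) = 0} :=
    isClosed_eq (continuous_eval_const _) continuous_const
  have h2 : IsClosed {f : C(OnePoint ℕ, E) |
      ∀ n : ℕ, f (n + 1 : ℕ) - f n ∈ Submodule.span ℝ {e n}} := by
    have : {f : C(OnePoint ℕ, E) | ∀ n : ℕ, f (n + 1 : ℕ) - f n ∈ Submodule.span ℝ {e n}}
        = ⋂ n : ℕ, {f : C(OnePoint ℕ, E) | f (n + 1 : ℕ) - f n ∈ Submodule.span ℝ {e n}} := by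
      ext f; rw [Set.mem_iInter]; exact Iff.rfl
    rw [this]
    refine isClosed_iInter fun n => ?_
    exact (Submodule.closed_of_finiteDimensional (Submodule.span ℝ {e n})).preimage
      ((continuous_eval_const _).sub (continuous_eval_const _))
  exact h1.inter h2

theorem mem_PS_iff {E : Type*} [NormedAddCommGroup E] [NormedSpace ℝ E] (e : ℕ → E)
    (f : C(OnePoint ℕ, E)) : f ∈ PS e ↔
      ∃ a : ℕ → ℝ, ∀ n : ℕ, f n = ∑ i ∈ Finset.range n, a i • e i := by
  constructor
  · rintro ⟨h0, h1⟩
    have h2 : ∀ n, ∃ c : ℝ, c • e n = f (n + 1 : ℕ) - f n := fun n =>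
      Submodule.mem_span_singleton.1 (h1 n)
    choose a ha using h2
    refine ⟨a, fun n => ?_⟩
    induction n with
    | zero => simpa using h0
    | succ n ih => rw [Finset.sum_range_succ, ← ih, ha n]; abel
  · rintro ⟨a, ha⟩
    refine ⟨by rw [ha 0]; simp, fun n => ?_⟩
    rw [ha, ha, Finset.sum_range_succ, add_sub_cancel_left]
    exact Submodule.smul_mem _ _ (Submodule.mem_span_singleton_self _)

theorem tendsto_OnePoint {E : Type*} [NormedAddCommGroup E] (f : C(OnePoint ℕ, E)) :
    Tendsto (fun n : ℕ => f n) atTop (𝓝 (f OnePoint.infty)) :=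
  (OnePoint.continuous_iff_from_nat f).1 f.continuous

theorem PS_bound {E : Type*} [NormedAddCommGroup E] [NormedSpace ℝ E] [CompleteSpace E]
    (e : ℕ → E) (he : IsSchauderBasis e) :
    ∃ K : ℝ, 0 ≤ K ∧ ∀ f ∈ PS e, ‖f‖ ≤ K * ‖f OnePoint.infty‖ := by
  have : CompleteSpace (PS e) := (isClosed_PS e).completeSpace_coe
  let ev : PS e →L[ℝ] E := (ContinuousMap.evalCLM ℝ OnePoint.infty).comp (PS e).subtypeL
  have hev : ∀ f : PS e, ev f = f.1 OnePoint.infty := fun f => rfl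
  have hker : ev.ker = ⊥ := by
    rw [LinearMap.ker_eq_bot']
    rintro ⟨f, hf⟩ h0
    have h0' : f OnePoint.infty = 0 := h0
    obtain ⟨a, ha⟩ := (mem_PS_iff e f).1 hf
    have ht := tendsto_OnePoint f
    simp only [ha] at ht
    rw [h0'] at ht
    have := (he 0).unique ht (y₂ := fun _ => 0) (by simp)
    subst this
    ext x
    change f x = 0
    induction x using OnePoint.rec with
    | infty => exact h0'
    | coe n => rw [ha n]; simp
  have hran : ev.range = ⊤ := by
    rw [LinearMap.range_eq_top]
    intro y
    obtain ⟨a, ha, -⟩ := he y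
    refine ⟨⟨OnePoint.continuousMapMkNat _ y ha, ?_⟩, ?_⟩
    · rw [mem_PS_iff]; exact ⟨a, fun n => rfl⟩
    · rfl
  let eq := ContinuousLinearEquiv.ofBijective ev hker hran
  refine ⟨‖(eq.symm : E →L[ℝ] PS e)‖, norm_nonneg _, fun f hf => ?_⟩
  have h1 : eq.symm (ev ⟨f, hf⟩) = ⟨f, hf⟩ :=
    ContinuousLinearEquiv.ofBijective_symm_apply_apply ev hker hran _
  have h2 := (eq.symm : E →L[ℝ] PS e).le_opNorm (ev ⟨f, hf⟩)
  rw [ContinuousLinearEquiv.coe_coe, h1] at h2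
  exact h2

theorem basis_const {E : Type*} [NormedAddCommGroup E] [NormedSpace ℝ E] [CompleteSpace E]
    (e : ℕ → E) (he : IsSchauderBasis e) (hn : ∀ n, ‖e n‖ = 1) :
    ∃ K : ℝ, 0 < K ∧ ∀ (a : ℕ → ℝ) (N n : ℕ), n < N →
      |a n| ≤ K * ‖∑ i ∈ Finset.range N, a i • e i‖ := by
  obtain ⟨K, hK, h⟩ := PS_bound e he
  refine ⟨2 * K + 1, by positivity, fun a N n hnN => ?_⟩
  let b : ℕ → ℝ := fun i => if i < N then a i else 0
  have hb : ∀ m, N ≤ m → ∑ i ∈ Finset.range m, b i • e i = ∑ i ∈ Finset.range N, a i • e i := by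
    intro m hm
    induction m, hm using Nat.le_induction with
    | base => exact Finset.sum_congr rfl fun i hi => by simp [b, Finset.mem_range.1 hi]
    | succ m hm ih =>
      rw [Finset.sum_range_succ, ih]
      simp [b, not_lt.2 hm]
  have ht : Tendsto (fun m => ∑ i ∈ Finset.range m, b i • e i) atTop
      (𝓝 (∑ i ∈ Finset.range N, a i • e i)) := by
    refine tendsto_const_nhds.congr' ?_
    filter_upwards [eventually_ge_atTop N] with m hm
    exact (hb m hm).symm
  let f := OnePoint.continuousMapMkNat _ _ ht
  have hf : f ∈ PS e := (mem_PS_iff e f).2 ⟨b, fun n => rfl⟩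
  have h1 := h f hf
  have h2 : ‖f (n + 1 : ℕ) - f n‖ ≤ 2 * ‖f‖ := by
    have h3 := f.norm_coe_le_norm (n + 1 : ℕ)
    have h4 := f.norm_coe_le_norm (n : ℕ)
    have h5 := norm_sub_le (f (n + 1 : ℕ)) (f n)
    linarith
  have h6 : f (n + 1 : ℕ) - f n = a n • e n := by
    change (∑ i ∈ Finset.range (n + 1), b i • e i) - ∑ i ∈ Finset.range n, b i • e i = _
    rw [Finset.sum_range_succ, add_sub_cancel_left]
    simp [b, hnN]
  rw [h6, norm_smul, hn, mul_one, Real.norm_eq_abs] at h2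
  have h7 : f OnePoint.infty = ∑ i ∈ Finset.range N, a i • e i := rfl
  rw [h7] at h1
  have := norm_nonneg (∑ i ∈ Finset.range N, a i • e i)
  nlinarith

theorem Xspan_basis {E : Type*} [NormedAddCommGroup E] [NormedSpace ℝ E]
    (e : ℕ → E) (he : IsSchauderBasis e) : Xspan e = ⊤ := by
  rw [eq_top_iff]
  intro y _
  obtain ⟨a, ha, -⟩ := he y
  refine mem_closure_of_tendsto ha (Eventually.of_forall fun m => ?_)
  exact Submodule.sum_mem _ fun i _ => Submodule.smul_mem _ _ (Submodule.subset_span ⟨i, rfl⟩)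

/-- sums over finitely supported coefficients as sums over ranges -/
theorem lc_eq_range {E : Type*} [NormedAddCommGroup E] [NormedSpace ℝ E] (x : ℕ → E) (a : ℕ →₀ ℝ)
    (N : ℕ) (hN : ∀ i ∈ a.support, i < N) :
    Finsupp.linearCombination ℝ x a = ∑ i ∈ Finset.range N, a i • x i := by
  rw [Finsupp.linearCombination_apply]
  exact Finsupp.sum_of_support_subset _ (fun i hi => Finset.mem_range.2 (hN i hi)) _
    (fun i _ => zero_smul _ _)

/-- a branch gives universality -/
theorem embeds_of_equiv {Z : Type*} [NormedAddCommGroup Z] [NormedSpace ℝ Z] [CompleteSpace Z]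
    (e : ℕ → CantorC) (he : IsSchauderBasis e) (y : ℕ → Z) (δ : ℝ) (hδ : 0 < δ)
    (h : ∀ (N : ℕ) (a : ℕ → ℝ),
      δ * ‖∑ i ∈ Finset.range N, a i • e i‖ ≤ ‖∑ i ∈ Finset.range N, a i • y i‖ ∧
      ‖∑ i ∈ Finset.range N, a i • y i‖ ≤ δ⁻¹ * ‖∑ i ∈ Finset.range N, a i • e i‖) :
    Embeds CantorC Z := by
  have hl : ∀ a : ℕ →₀ ℝ, δ * ‖Finsupp.linearCombination ℝ e a‖ ≤ ‖Finsupp.linearCombination ℝ y a‖ ∧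
      ‖Finsupp.linearCombination ℝ y a‖ ≤ δ⁻¹ * ‖Finsupp.linearCombination ℝ e a‖ := by
    intro a
    obtain ⟨N, hN⟩ : ∃ N, ∀ i ∈ a.support, i < N :=
      ⟨a.support.sup id + 1, fun i hi => Nat.lt_succ_of_le (Finset.le_sup (f := id) hi)⟩
    rw [lc_eq_range e a N hN, lc_eq_range y a N hN]
    exact h N a
  have h1 : Embeds (Xspan e) Z := embeds_Xspan e (Finsupp.linearCombination ℝ y) δ δ⁻¹ hδ
    (fun a => (hl a).2) (fun a => (hl a).1)
  have h2 : Embeds CantorC (Xspan e) := by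
    have hm : ∀ x : CantorC, x ∈ Xspan e := fun x => by rw [Xspan_basis e he]; trivial
    refine ⟨(ContinuousLinearMap.id ℝ CantorC).codRestrict (Xspan e) hm, 1, one_pos, fun x => ?_⟩
    rw [one_mul]; exact le_refl ‖x‖
  exact h2.trans' h1

/-- small perturbations of sequences equivalent to the basis -/
theorem perturb {W Z : Type*} [NormedAddCommGroup W] [NormedSpace ℝ W]
    [NormedAddCommGroup Z] [NormedSpace ℝ Z] (e : ℕ → W) (K : ℝ)
    (hK : ∀ (a : ℕ → ℝ) (N n : ℕ), n < N → |a n| ≤ K * ‖∑ i ∈ Finset.range N, a i • e i‖)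
    (η : ℝ) (hη : 0 ≤ η) (y z : ℕ → Z) (N : ℕ)
    (hyz : ∀ i < N, ‖z i - y i‖ ≤ η * (1 / 2) ^ (i + 1)) (a : ℕ → ℝ) :
    ‖∑ i ∈ Finset.range N, a i • z i - ∑ i ∈ Finset.range N, a i • y i‖ ≤
      η * K * ‖∑ i ∈ Finset.range N, a i • e i‖ := by
  set S := ‖∑ i ∈ Finset.range N, a i • e i‖ with hS
  have h0 : ∑ i ∈ Finset.range N, ((1 : ℝ) / 2) ^ (i + 1) = 1 - (1 / 2) ^ N := by
    clear_value S; clear hyz hS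
    induction N with
    | zero => simp
    | succ N ih => rw [Finset.sum_range_succ, ih]; ring
  rcases Nat.eq_zero_or_pos N with rfl | hN
  · simp [hS]
  have hKS : 0 ≤ K * S := (abs_nonneg _).trans (hK a N 0 hN)
  rw [← Finset.sum_sub_distrib]
  calc ‖∑ i ∈ Finset.range N, (a i • z i - a i • y i)‖
      ≤ ∑ i ∈ Finset.range N, K * S * (η * (1 / 2) ^ (i + 1)) := by
        refine norm_sum_le_of_le _ fun i hi => ?_
        have hi' := Finset.mem_range.1 hi
        rw [← smul_sub, norm_smul, Real.norm_eq_abs]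
        exact mul_le_mul (hK a N i hi') (hyz i hi') (norm_nonneg _) hKS
    _ = K * S * η * (1 - (1 / 2) ^ N) := by
        rw [← h0, Finset.mul_sum]; exact Finset.sum_congr rfl fun i _ => by ring
    _ ≤ K * S * η * 1 := by
        apply mul_le_mul_of_nonneg_left _ (mul_nonneg hKS hη)
        have : (0 : ℝ) ≤ (1 / 2) ^ N := by positivity
        linarith
    _ = η * K * S := by ring

end

noncomputable section

/-! ### Trees and ranks -/

/-- strictly decreasing rank functions -/
def SDec {Λ : Type*} (T : Set (List Λ)) (ρ : List Λ → Ordinal.{0}) : Prop :=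
  ∀ l a, l ++ [a] ∈ T → ρ (l ++ [a]) < ρ l

theorem tdi_zero {Λ : Type*} (T : Set (List Λ)) : treeDerivIter T 0 = T :=
  Ordinal.limitRecOn_zero _ _ _

theorem tdi_succ {Λ : Type*} (T : Set (List Λ)) (o : Ordinal.{0}) :
    treeDerivIter T (o + 1) = treeDeriv (treeDerivIter T o) :=
  Ordinal.limitRecOn_add_one _ _ _ _

theorem tdi_limit {Λ : Type*} (T : Set (List Λ)) (o : Ordinal.{0}) (ho : Order.IsSuccLimit o) :
    treeDerivIter T o = ⋂ (o' : Ordinal.{0}) (_ : o' < o), treeDerivIter T o' :=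
  Ordinal.limitRecOn_limit _ _ _ _ ho

theorem tdi_subset {Λ : Type*} (T : Set (List Λ)) (o : Ordinal.{0}) : treeDerivIter T o ⊆ T := by
  induction o using Ordinal.limitRecOn with
  | zero => rw [tdi_zero]
  | add_one o ih => rw [tdi_succ]; exact fun l hl => ih hl.1
  | limit o ho ih =>
    rw [tdi_limit T o ho]
    intro l hl
    have h0 : (0 : Ordinal.{0}) < o := ho.bot_lt
    exact ih 0 h0 (Set.mem_iInter₂.1 hl 0 h0)

theorem le_of_mem_tdi {Λ : Type*} (T : Set (List Λ)) (ρ : List Λ → Ordinal.{0}) (hρ : SDec T ρ)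
    (o : Ordinal.{0}) : ∀ l ∈ treeDerivIter T o, o ≤ ρ l := by
  induction o using Ordinal.limitRecOn with
  | zero => exact fun l _ => zero_le
  | add_one o ih =>
    rw [tdi_succ]
    rintro l ⟨-, a, ha⟩
    rw [Order.add_one_le_iff]
    exact (ih _ ha).trans_lt (hρ l a (tdi_subset T o ha))
  | limit o ho ih =>
    rw [tdi_limit T o ho]
    intro l hl
    refine le_of_forall_lt fun o' ho' => ?_
    have h1 : o' + 1 < o := ho.add_one_lt ho'
    have := ih _ h1 l (Set.mem_iInter₂.1 hl _ h1)
    exact Order.add_one_le_iff.1 this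

theorem tdi_empty {Λ : Type*} (T : Set (List Λ)) (ρ : List Λ → Ordinal.{0}) (hρ : SDec T ρ)
    (ξ : Ordinal.{0}) (h : ∀ l ∈ T, ρ l < ξ) : treeDerivIter T ξ = ∅ := by
  rw [Set.eq_empty_iff_forall_notMem]
  intro l hl
  exact absurd (le_of_mem_tdi T ρ hρ ξ l hl) (not_le.2 (h l (tdi_subset T ξ hl)))

theorem treeRank_le {Λ : Type*} (T : Set (List Λ)) (ρ : List Λ → Ordinal.{0}) (hρ : SDec T ρ)
    (ξ : Ordinal.{0}) (h : ∀ l ∈ T, ρ l < ξ) : treeRank T ≤ ξ :=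
  csInf_le' (tdi_empty T ρ hρ ξ h)

/-- the extension relation -/
def ExtRel {Λ : Type*} (T : Set (List Λ)) (m l : List Λ) : Prop := m ∈ T ∧ ∃ a, m = l ++ [a]

theorem wf_of_not_ill {Λ : Type*} (T : Set (List Λ)) (hT : IsTree T) (h : ¬ TreeIllFounded T) :
    WellFounded (ExtRel T) := by
  rw [wellFounded_iff_isEmpty_descending_chain]
  refine ⟨fun ⟨f, hf⟩ => h ?_⟩
  have hlen : ∀ n, n ≤ (f n).length := by
    intro n
    induction n with
    | zero => exact Nat.zero_le _
    | succ n ih =>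
      obtain ⟨-, a, ha⟩ := hf n
      rw [ha, List.length_append, List.length_singleton]; omega
  have hpre : ∀ m n, m ≤ n → f m <+: f n := by
    intro m n hmn
    induction n, hmn using Nat.le_induction with
    | base => exact List.prefix_rfl
    | succ n hmn ih =>
      obtain ⟨-, a, ha⟩ := hf n
      exact ih.trans ⟨[a], ha.symm⟩
  refine ⟨fun i => (f (i + 1))[i]'(hlen (i + 1)), fun n => ?_⟩
  have h1 : (List.ofFn fun i : Fin n => (f (i + 1))[(i : ℕ)]'(hlen (i + 1))) = (f (n + 1)).take n := by
    have := hlen (n + 1)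
    refine List.ext_getElem (by simp; omega) fun i h2 h3 => ?_
    rw [List.getElem_ofFn, List.getElem_take]
    exact (hpre (i + 1) (n + 1) (by simp at h2; omega)).getElem _
  rw [h1]
  exact hT _ _ (List.take_prefix _ _) (hf n).1

/-- the canonical rank -/
theorem exists_rank {Λ : Type} (T : Set (List Λ)) (hT : IsTree T) (h : ¬ TreeIllFounded T) :
    ∃ ρ : List Λ → Ordinal.{0}, SDec T ρ ∧ ∀ l ∈ T, ρ l < treeRank T := by
  have hwf : IsWellFounded _ (ExtRel T) := ⟨wf_of_not_ill T hT h⟩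
  let ρ : List Λ → Ordinal.{0} := IsWellFounded.rank (ExtRel T)
  have hρ : SDec T ρ := fun l a hla => IsWellFounded.rank_lt_of_rel (r := ExtRel T) ⟨hla, a, rfl⟩
  have hmem : ∀ o : Ordinal.{0}, ∀ l ∈ T, o ≤ ρ l → l ∈ treeDerivIter T o := by
    intro o
    induction o using Ordinal.limitRecOn with
    | zero => intro l hl _; rwa [tdi_zero]
    | add_one o ih =>
      intro l hl ho
      rw [tdi_succ]
      have ho' : o < ρ l := Order.add_one_le_iff.1 ho
      refine ⟨ih l hl ho'.le, ?_⟩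
      rw [show ρ l = _ from IsWellFounded.rank_eq (ExtRel T) l, Ordinal.lt_iSup_iff] at ho'
      obtain ⟨⟨m, hm, a, rfl⟩, hb⟩ := ho'
      exact ⟨a, ih _ hm (Order.lt_succ_iff.1 hb)⟩
    | limit o ho ih =>
      intro l hl hol
      rw [tdi_limit T o ho]
      exact Set.mem_iInter₂.2 fun o' ho' => ih o' ho' l hl (ho'.le.trans hol)
  refine ⟨ρ, hρ, fun l hl => ?_⟩
  have hne : {ξ : Ordinal.{0} | treeDerivIter T ξ = ∅}.Nonempty :=
    ⟨Order.succ (⨆ l, ρ l), tdi_empty T ρ hρ _ fun l _ => Order.lt_succ_iff.2 (Ordinal.le_iSup ρ l)⟩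
  have h1 : treeDerivIter T (treeRank T) = ∅ := csInf_mem hne
  by_contra h2
  have := hmem _ l hl (not_lt.1 h2)
  rw [h1] at this
  exact this

theorem omega1_eq : omega1 = Ordinal.omega 1 := Cardinal.ord_aleph 1

theorem succ_lt_omega1 {o : Ordinal.{0}} (h : o < omega1) : Order.succ o < omega1 := by
  rw [omega1_eq] at *
  exact (Cardinal.isSuccLimit_omega 1).succ_lt h

theorem iSup_lt_omega1 {α : Type} [Countable α] {f : α → Ordinal.{0}} (h : ∀ a, f a < omega1) :
    ⨆ a, f a < omega1 := by
  rw [omega1_eq] at *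
  exact Ordinal.iSup_lt_omega_one h

/-- countable trees have countable rank -/
theorem exists_rank_countable {Λ : Type} [Countable Λ] (T : Set (List Λ)) (hT : IsTree T)
    (h : ¬ TreeIllFounded T) :
    ∃ ρ : List Λ → Ordinal.{0}, SDec T ρ ∧ ∀ l, ρ l < omega1 := by
  have hwf : IsWellFounded _ (ExtRel T) := ⟨wf_of_not_ill T hT h⟩
  refine ⟨IsWellFounded.rank (ExtRel T),
    fun l a hla => IsWellFounded.rank_lt_of_rel (r := ExtRel T) ⟨hla, a, rfl⟩, fun l => ?_⟩
  induction l using IsWellFounded.induction (ExtRel T) with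
  | ind l ih =>
  rw [IsWellFounded.rank_eq]
  exact iSup_lt_omega1 fun b => succ_lt_omega1 (ih b.1 b.2)

/-! ### Bourgain trees -/

theorem mem_bt_ofFn {W : Type*} [SeminormedAddCommGroup W] [NormedSpace ℝ W] (e : ℕ → W)
    (δ : ℝ) {Y : Type*} [SeminormedAddCommGroup Y] [NormedSpace ℝ Y] (y : ℕ → Y) (N : ℕ) :
    (List.ofFn fun i : Fin N => y i) ∈ bourgainTree e δ Y ↔ ∀ a : ℕ → ℝ,
      δ * ‖∑ i ∈ Finset.range N, a i • e i‖ ≤ ‖∑ i ∈ Finset.range N, a i • y i‖ ∧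
      ‖∑ i ∈ Finset.range N, a i • y i‖ ≤ δ⁻¹ * ‖∑ i ∈ Finset.range N, a i • e i‖ := by
  have h : ∀ a : ℕ → ℝ, ∑ i ∈ Finset.range N, a i • (List.ofFn fun i : Fin N => y i).getD i 0
      = ∑ i ∈ Finset.range N, a i • y i := fun a => Finset.sum_congr rfl fun i hi => by
    have := Finset.mem_range.1 hi
    simp [List.getD_eq_getElem?_getD, this]
  simp only [bourgainTree, Set.mem_ofPred_eq, List.length_ofFn, h]

theorem list_eq_ofFn {Y : Type*} [Zero Y] (l : List Y) :
    (List.ofFn fun i : Fin l.length => l.getD i 0) = l := by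
  refine List.ext_getElem (by simp) fun i h1 h2 => ?_
  simp [List.getD_eq_getElem?_getD]

theorem isTree_bt {W : Type*} [SeminormedAddCommGroup W] [NormedSpace ℝ W] (e : ℕ → W)
    (δ : ℝ) {Y : Type*} [SeminormedAddCommGroup Y] [NormedSpace ℝ Y] :
    IsTree (bourgainTree e δ Y) := by
  rintro s _ ⟨t, rfl⟩ ht a
  have h1 := ht fun i => if i < s.length then a i else 0
  have h2 : ∀ {Z : Type _} [SeminormedAddCommGroup Z] [NormedSpace ℝ Z] (z : ℕ → Z),
      ∑ i ∈ Finset.range (s ++ t).length, (if i < s.length then a i else 0) • z i =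
      ∑ i ∈ Finset.range s.length, a i • z i := by
    intro Z _ _ z
    rw [List.length_append, Finset.sum_range_add]
    simp only [add_lt_iff_neg_left, not_lt_zero, if_false, zero_smul, Finset.sum_const_zero, add_zero]
    exact Finset.sum_congr rfl fun i hi => by rw [if_pos (Finset.mem_range.1 hi)]
  have h2' : ∑ i ∈ Finset.range (s ++ t).length, (if i < s.length then a i else 0) • e i =
      ∑ i ∈ Finset.range s.length, a i • e i := by
    rw [List.length_append, Finset.sum_range_add]
    simp only [add_lt_iff_neg_left, not_lt_zero, if_false, zero_smul, Finset.sum_const_zero, add_zero]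
    exact Finset.sum_congr rfl fun i hi => by rw [if_pos (Finset.mem_range.1 hi)]
  rw [h2', h2] at h1
  have h3 : ∑ i ∈ Finset.range s.length, a i • (s ++ t).getD i 0 =
      ∑ i ∈ Finset.range s.length, a i • s.getD i 0 :=
    Finset.sum_congr rfl fun i hi => by
      rw [List.getD_append _ _ _ _ (Finset.mem_range.1 hi)]
  rw [h3] at h1
  exact h1

theorem embeds_of_ill {Z : Type*} [NormedAddCommGroup Z] [NormedSpace ℝ Z] [CompleteSpace Z]
    (e : ℕ → CantorC) (he : IsSchauderBasis e) (δ : ℝ) (hδ : 0 < δ)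
    (h : TreeIllFounded (bourgainTree e δ Z)) : Embeds CantorC Z := by
  obtain ⟨σ, hσ⟩ := h
  exact embeds_of_equiv e he σ δ hδ fun N => (mem_bt_ofFn e δ σ N).1 (hσ N)

end

noncomputable section

/-! ### Subspaces of a non-universal space have bounded index -/

/-- the combined perturbation estimate -/
theorem perturb_mem {W E Z : Type*} [NormedAddCommGroup W] [NormedSpace ℝ W]
    [SeminormedAddCommGroup E] [NormedSpace ℝ E]
    [NormedAddCommGroup Z] [NormedSpace ℝ Z] (e : ℕ → W) (K : ℝ) (hK0 : 0 < K)
    (hK : ∀ (a : ℕ → ℝ) (N n : ℕ), n < N → |a n| ≤ K * ‖∑ i ∈ Finset.range N, a i • e i‖)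
    (T : E →L[ℝ] Z) (c : ℝ) (hc : 0 < c) (hT : ∀ x, c * ‖x‖ ≤ ‖T x‖) (δ : ℝ) (hδ : 0 < δ) :
    ∃ η : ℝ, 0 < η ∧ ∃ k : ℕ, ∀ (x : ℕ → E) (z : ℕ → Z) (N : ℕ),
      (∀ i < N, ‖z i - T (x i)‖ ≤ η * (1 / 2) ^ (i + 1)) →
      (∀ a : ℕ → ℝ, δ * ‖∑ i ∈ Finset.range N, a i • e i‖ ≤ ‖∑ i ∈ Finset.range N, a i • x i‖ ∧
        ‖∑ i ∈ Finset.range N, a i • x i‖ ≤ δ⁻¹ * ‖∑ i ∈ Finset.range N, a i • e i‖) →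
      ∀ a : ℕ → ℝ, ((k : ℝ) + 1)⁻¹ * ‖∑ i ∈ Finset.range N, a i • e i‖ ≤
          ‖∑ i ∈ Finset.range N, a i • z i‖ ∧
        ‖∑ i ∈ Finset.range N, a i • z i‖ ≤
          (((k : ℝ) + 1)⁻¹)⁻¹ * ‖∑ i ∈ Finset.range N, a i • e i‖ := by
  obtain ⟨k, hk⟩ := exists_nat_ge (max (2 / (c * δ)) (‖T‖ * δ⁻¹ + c * δ / 2))
  have hk1 : 2 / (c * δ) ≤ k := (le_max_left _ _).trans hk
  have hk2 : ‖T‖ * δ⁻¹ + c * δ / 2 ≤ k := (le_max_right _ _).trans hk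
  have hcδ : 0 < c * δ := by positivity
  refine ⟨c * δ / 2 / K, by positivity, k, fun x z N hz hx a => ?_⟩
  have h1 := perturb e K hK (c * δ / 2 / K) (by positivity) (fun i => T (x i)) z N hz a
  have h2 : ∑ i ∈ Finset.range N, a i • T (x i) = T (∑ i ∈ Finset.range N, a i • x i) := by
    rw [map_sum]; exact Finset.sum_congr rfl fun i _ => by rw [map_smul]
  rw [h2, div_mul_cancel₀ _ hK0.ne'] at h1
  obtain ⟨h3, h4⟩ := hx a
  have h5 := hT (∑ i ∈ Finset.range N, a i • x i)
  have h6 := T.le_opNorm (∑ i ∈ Finset.range N, a i • x i)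
  have h7 := norm_nonneg (∑ i ∈ Finset.range N, a i • e i)
  have h11 := norm_sub_norm_le (T (∑ i ∈ Finset.range N, a i • x i)) (∑ i ∈ Finset.range N, a i • z i)
  have h12 := norm_sub_norm_le (∑ i ∈ Finset.range N, a i • z i) (T (∑ i ∈ Finset.range N, a i • x i))
  rw [norm_sub_rev] at h11
  have hT0 := norm_nonneg T
  generalize ‖∑ i ∈ Finset.range N, a i • z i - T (∑ i ∈ Finset.range N, a i • x i)‖ = D at *
  generalize ‖T (∑ i ∈ Finset.range N, a i • x i)‖ = A at *
  generalize ‖∑ i ∈ Finset.range N, a i • x i‖ = B at *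
  generalize ‖∑ i ∈ Finset.range N, a i • e i‖ = S at *
  generalize ‖∑ i ∈ Finset.range N, a i • z i‖ = R at *
  rw [inv_inv]
  have h8 : c * (δ * S) ≤ c * B := mul_le_mul_of_nonneg_left h3 hc.le
  have h9 : ‖T‖ * B ≤ ‖T‖ * (δ⁻¹ * S) := mul_le_mul_of_nonneg_left h4 hT0
  have h10 : ((k : ℝ) + 1)⁻¹ ≤ c * δ / 2 := by
    rw [inv_le_comm₀ (by positivity) (by positivity), inv_div]; linarith
  constructor
  · have : ((k : ℝ) + 1)⁻¹ * S ≤ c * δ / 2 * S := mul_le_mul_of_nonneg_right h10 h7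
    linarith
  · have : (‖T‖ * δ⁻¹ + c * δ / 2) * S ≤ ((k : ℝ) + 1) * S :=
      mul_le_mul_of_nonneg_right (by linarith) h7
    linarith

theorem mem_bt_map {W : Type*} [SeminormedAddCommGroup W] [NormedSpace ℝ W] (e : ℕ → W)
    (δ : ℝ) {Y : Type*} [SeminormedAddCommGroup Y] [NormedSpace ℝ Y] {Λ : Type*} (φ : Λ → Y)
    (l : List Λ) (N : ℕ) (hl : l.length = N) (y : ℕ → Y)
    (hy : ∀ i (hi : i < l.length), y i = φ l[i])
    (h : ∀ a : ℕ → ℝ,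
      δ * ‖∑ i ∈ Finset.range N, a i • e i‖ ≤ ‖∑ i ∈ Finset.range N, a i • y i‖ ∧
      ‖∑ i ∈ Finset.range N, a i • y i‖ ≤ δ⁻¹ * ‖∑ i ∈ Finset.range N, a i • e i‖) :
    l.map φ ∈ bourgainTree e δ Y := by
  have h1 := (mem_bt_ofFn e δ y N).2 h
  have h2 : (List.ofFn fun i : Fin N => y i) = l.map φ := by
    refine List.ext_getElem (by simp [hl]) fun i h3 h4 => ?_
    rw [List.getElem_ofFn, List.getElem_map]
    exact hy i (by simpa using h4)
  rwa [h2] at h1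

theorem isTree_map {Λ Y : Type*} (φ : Λ → Y) (T : Set (List Y)) (hT : IsTree T) :
    IsTree {l : List Λ | l.map φ ∈ T} :=
  fun s t hst ht => hT (s.map φ) (t.map φ) (hst.map φ) ht

theorem ill_map {Λ Y : Type*} (φ : Λ → Y) (T : Set (List Y))
    (h : TreeIllFounded {l : List Λ | l.map φ ∈ T}) : TreeIllFounded T := by
  obtain ⟨σ, hσ⟩ := h
  refine ⟨fun i => φ (σ i), fun n => ?_⟩
  have := hσ n
  rw [Set.mem_ofPred_eq, List.map_ofFn] at this
  exact this

theorem rank_bound (e : ℕ → CantorC) (he : IsSchauderBasis e) (hn : ∀ n, ‖e n‖ = 1)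
    (Z : Type) [NormedAddCommGroup Z] [NormedSpace ℝ Z] [CompleteSpace Z]
    [SecondCountableTopology Z] (hZ : ¬ Embeds CantorC Z) :
    ∃ ξ : Ordinal.{0}, ξ < omega1 ∧ ∀ (E : Type) [SeminormedAddCommGroup E] [NormedSpace ℝ E],
      Embeds E Z → ∀ δ : ℝ, 0 < δ → treeRank (bourgainTree e δ E) ≤ ξ := by
  obtain ⟨K, hK0, hK⟩ := basis_const e he hn
  let d : ℕ → Z := TopologicalSpace.denseSeq Z
  have hd : DenseRange d := TopologicalSpace.denseRange_denseSeq Z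
  have hr : ∀ k : ℕ, ∃ ρ : List ℕ → Ordinal.{0},
      SDec {l : List ℕ | l.map d ∈ bourgainTree e ((k : ℝ) + 1)⁻¹ Z} ρ ∧ ∀ l, ρ l < omega1 := fun k =>
    exists_rank_countable _ (isTree_map d _ (isTree_bt _ _)) fun h =>
      hZ (embeds_of_ill e he _ (by positivity) (ill_map d _ h))
  choose ρ hρ hρ1 using hr
  refine ⟨Order.succ (⨆ p : ℕ × List ℕ, ρ p.1 p.2),
    succ_lt_omega1 (iSup_lt_omega1 fun p => hρ1 p.1 p.2), ?_⟩
  rintro E _ _ ⟨T, c, hc, hT⟩ δ hδ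
  obtain ⟨η, hη, k, hk⟩ := perturb_mem e K hK0 hK T c hc hT δ hδ
  have hch : ∀ (i : ℕ) (x : E), ∃ m : ℕ, ‖d m - T x‖ ≤ η * (1 / 2) ^ (i + 1) := by
    intro i x
    obtain ⟨m, hm⟩ := Metric.denseRange_iff.1 hd (T x) (η * (1 / 2) ^ (i + 1)) (by positivity)
    exact ⟨m, by rw [← dist_eq_norm, dist_comm]; exact hm.le⟩
  choose g hg using hch
  have hmem : ∀ l ∈ bourgainTree e δ E, (l.mapIdx g).map d ∈ bourgainTree e ((k : ℝ) + 1)⁻¹ Z := by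
    intro l hl
    refine mem_bt_map e _ d (l.mapIdx g) l.length (by simp) (fun i => d (g i (l.getD i 0))) ?_
      (hk (fun i => l.getD i 0) _ l.length (fun i _ => hg i _) hl)
    intro i hi
    have hi' : i < l.length := by simpa using hi
    simp [List.getElem_mapIdx, hi']
  refine treeRank_le _ (fun l => ρ k (l.mapIdx g)) ?_ _ ?_
  · intro l a hla
    have h1 := hmem _ hla
    rw [List.mapIdx_append] at h1
    change ρ k ((l ++ [a]).mapIdx g) < ρ k (l.mapIdx g)
    rw [List.mapIdx_append]
    exact hρ k _ _ h1
  · intro l _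
    exact Order.lt_succ_iff.2 (Ordinal.le_iSup (fun p : ℕ × List ℕ => ρ p.1 p.2) (k, l.mapIdx g))

/-- (i) implies (ii) -/
theorem one_two (e : ℕ → CantorC) (he : IsSchauderBasis e) (hn : ∀ n, ‖e n‖ = 1) (C : Set SB)
    (h : ∃ Y : SB, (∀ X ∈ C, Embeds ↥X.1 ↥Y.1) ∧ ¬ Embeds CantorC ↥Y.1) :
    (⨆ X : C, bourgainIndex e ↥X.1.1) < omega1 := by
  obtain ⟨Y, hY, hnY⟩ := h
  have : CompleteSpace Y.1 := Y.2.completeSpace_coe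
  obtain ⟨ξ, hξ, h⟩ := rank_bound e he hn Y.1 hnY
  refine lt_of_le_of_lt (ciSup_le' fun X => ?_) hξ
  have hill : ¬ ∃ δ ∈ Set.Ioc (0:ℝ) 1, TreeIllFounded (bourgainTree e δ X.1.1) := by
    rintro ⟨δ, hδ, hi⟩
    have : CompleteSpace X.1.1 := X.1.2.completeSpace_coe
    have h2 : Embeds CantorC X.1.1 := embeds_of_ill e he δ hδ.1 hi
    exact hnY (h2.trans' (hY X.1 X.2))
  rw [bourgainIndex, if_neg hill]
  exact ciSup_le' fun δ => h X.1.1 (hY X.1 X.2) δ.1 δ.2.1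

end

noncomputable section

/-! ### Classes of bounded index -/

/-- rational coefficient vectors as real ones -/
def rv (v : ℕ →₀ ℚ) : ℕ →₀ ℝ := v.mapRange (fun q : ℚ => (q : ℝ)) (by simp)

/-- evaluation of a rational vector along a sequence -/
def rev {Z : Type*} [NormedAddCommGroup Z] [NormedSpace ℝ Z] (y : ℕ → Z) (v : ℕ →₀ ℚ) : Z :=
  Finsupp.linearCombination ℝ y (rv v)

theorem rv_approx {Z : Type*} [NormedAddCommGroup Z] [NormedSpace ℝ Z] (y : ℕ → Z) (a : ℕ →₀ ℝ)
    (ε : ℝ) (hε : 0 < ε) : ∃ v : ℕ →₀ ℚ, ‖rev y v - Finsupp.linearCombination ℝ y a‖ < ε := by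
  classical
  let M : ℝ := ∑ i ∈ a.support, ‖y i‖ + 1
  have hM : 0 < M := by
    have : 0 ≤ ∑ i ∈ a.support, ‖y i‖ := Finset.sum_nonneg fun i _ => norm_nonneg _
    simp only [M]; linarith
  have hq : ∀ i, ∃ q : ℚ, |(q : ℝ) - a i| ≤ ε / M := by
    intro i
    obtain ⟨q, hq⟩ := exists_rat_near (a i) (ε := ε / M) (by positivity)
    exact ⟨q, by rw [abs_sub_comm]; exact hq.le⟩
  choose q hq using hq
  let v : ℕ →₀ ℚ := Finsupp.onFinset a.support (fun i => if i ∈ a.support then q i else 0)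
    (fun i hi => by by_contra h; simp [h] at hi)
  refine ⟨v, ?_⟩
  have h1 : rev y v = ∑ i ∈ a.support, (q i : ℝ) • y i := by
    rw [rev, Finsupp.linearCombination_apply]
    have hsub : (rv v).support ⊆ a.support := by
      intro i hi
      by_contra h
      apply Finsupp.mem_support_iff.1 hi
      simp only [rv, Finsupp.mapRange_apply, v, Finsupp.onFinset_apply, if_neg h, Rat.cast_zero]
    refine (Finsupp.sum_of_support_subset (rv v) hsub (fun i t => t • y i)
      (fun i _ => zero_smul _ _)).trans ?_
    · refine Finset.sum_congr rfl fun i hi => ?_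
      have : rv v i = q i := by
        simp only [rv, Finsupp.mapRange_apply, v, Finsupp.onFinset_apply, if_pos hi]
      rw [this]
  rw [h1, Finsupp.linearCombination_apply, Finsupp.sum, ← Finset.sum_sub_distrib]
  calc ‖∑ i ∈ a.support, ((q i : ℝ) • y i - a i • y i)‖
      ≤ ∑ i ∈ a.support, ε / M * ‖y i‖ := by
        refine norm_sum_le_of_le _ fun i _ => ?_
        rw [← sub_smul, norm_smul, Real.norm_eq_abs]
        exact mul_le_mul_of_nonneg_right (hq i) (norm_nonneg _)
    _ = ε / M * (M - 1) := by rw [← Finset.mul_sum]; simp [M]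
    _ < ε := by
        rw [div_mul_eq_mul_div, div_lt_iff₀ hM]
        nlinarith

theorem sum_rev {Z : Type*} [NormedAddCommGroup Z] [NormedSpace ℝ Z] (y : ℕ → Z)
    (l : List (ℕ →₀ ℚ)) (a : ℕ → ℝ) :
    ∑ i ∈ Finset.range l.length, a i • (l.map (rev y)).getD i 0 =
      Finsupp.linearCombination ℝ y (∑ i ∈ Finset.range l.length, a i • rv (l.getD i 0)) := by
  rw [map_sum]
  refine Finset.sum_congr rfl fun i hi => ?_
  have hi' := Finset.mem_range.1 hi
  rw [map_smul, List.getD_eq_getElem _ _ hi', List.getD_eq_getElem _ _ (by simpa using hi'),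
    List.getElem_map, rev]

/-- transferring tree membership between equivalent sequences -/
theorem bt_transfer {W Z Z' : Type*} [NormedAddCommGroup W] [NormedSpace ℝ W]
    [NormedAddCommGroup Z] [NormedSpace ℝ Z] [NormedAddCommGroup Z'] [NormedSpace ℝ Z']
    (e : ℕ → W) (x : ℕ → Z) (y : ℕ → Z')
    (hxy : ∀ a : ℕ →₀ ℝ, ‖Finsupp.linearCombination ℝ x a‖ ≤ 2 * ‖Finsupp.linearCombination ℝ y a‖ ∧
      ‖Finsupp.linearCombination ℝ y a‖ ≤ 2 * ‖Finsupp.linearCombination ℝ x a‖) (δ : ℝ)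
    (l : List (ℕ →₀ ℚ)) (hl : l.map (rev y) ∈ bourgainTree e δ Z') :
    l.map (rev x) ∈ bourgainTree e (δ / 2) Z := by
  intro a
  have h1 := hl a
  rw [List.length_map] at h1 ⊢
  rw [sum_rev] at h1 ⊢
  have h2 := hxy (∑ i ∈ Finset.range l.length, a i • rv (l.getD i 0))
  generalize ‖Finsupp.linearCombination ℝ y (∑ i ∈ Finset.range l.length, a i • rv (l.getD i 0))‖ = A at *
  generalize ‖Finsupp.linearCombination ℝ x (∑ i ∈ Finset.range l.length, a i • rv (l.getD i 0))‖ = B at *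
  generalize ‖∑ i ∈ Finset.range l.length, a i • e i‖ = S at *
  rw [inv_div, div_eq_mul_inv 2 δ]
  constructor <;> linarith [h1.1, h1.2, h2.1, h2.2]

/-- sets depending on finitely many coordinates are closed -/
theorem isClosed_of_finite_dep (S : Set (ℕ → ℕ)) (N : ℕ)
    (h : ∀ τ τ' : ℕ → ℕ, (∀ n < N, τ n = τ' n) → τ ∈ S → τ' ∈ S) : IsClosed S := by
  have h1 : S = (fun (τ : ℕ → ℕ) (i : Fin N) => τ i) ⁻¹' ((fun (τ : ℕ → ℕ) (i : Fin N) => τ i) '' S) := by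
    refine Set.Subset.antisymm (Set.subset_preimage_image _ _) ?_
    rintro τ ⟨τ', hτ', he⟩
    exact h τ' τ (fun n hn => congrFun he ⟨n, hn⟩) hτ'
  rw [h1]
  exact (isClosed_discrete _).preimage (continuous_pi fun i => continuous_apply _)

theorem rev_dep {Z : Type*} [NormedAddCommGroup Z] [NormedSpace ℝ Z] (l : List (ℕ →₀ ℚ)) :
    ∃ N : ℕ, ∀ y y' : ℕ → Z, (∀ n < N, y n = y' n) → l.map (rev y) = l.map (rev y') := by
  induction l with
  | nil => exact ⟨0, fun _ _ _ => rfl⟩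
  | cons v l ih =>
    obtain ⟨N, hN⟩ := ih
    obtain ⟨M, hM⟩ : ∃ M, ∀ i ∈ (rv v).support, i < M :=
      ⟨(rv v).support.sup id + 1, fun i hi => Nat.lt_succ_of_le (Finset.le_sup (f := id) hi)⟩
    refine ⟨max N M, fun y y' h => ?_⟩
    rw [List.map_cons, List.map_cons, hN y y' fun n hn => h n (hn.trans_le (le_max_left _ _))]
    congr 1
    rw [rev, rev, Finsupp.linearCombination_apply, Finsupp.linearCombination_apply]
    refine Finset.sum_congr rfl fun i hi => ?_
    change rv v i • y i = rv v i • y' i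
    rw [h i ((hM i hi).trans_le (le_max_right _ _))]

theorem exists_item : ∃ q : ℕ × List (ℕ →₀ ℚ) → ℕ, Function.Injective q := by
  have : Countable (ℕ →₀ ℚ) := inferInstance
  exact exists_injective_nat _

/-- the set of codes with decreasing ordinal witnesses -/
def BB (e : ℕ → CantorC) (q : ℕ × List (ℕ →₀ ℚ) → ℕ) (o : ℕ → Ordinal.{0}) : Set (ℕ → ℕ) :=
  {τ | ∀ (k : ℕ) (l : List (ℕ →₀ ℚ)) (v : ℕ →₀ ℚ),
    (l ++ [v]).map (rev (DD ∘ fun n => (τ n).unpair.1)) ∈ bourgainTree e ((k : ℝ) + 1)⁻¹ CantorC →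
    o (τ (q (k, l ++ [v]))).unpair.2 < o (τ (q (k, l))).unpair.2}

theorem isClosed_BB (e : ℕ → CantorC) (q : ℕ × List (ℕ →₀ ℚ) → ℕ) (o : ℕ → Ordinal.{0}) :
    IsClosed (BB e q o) := by
  have : BB e q o = ⋂ (k : ℕ) (l : List (ℕ →₀ ℚ)) (v : ℕ →₀ ℚ), {τ : ℕ → ℕ |
    (l ++ [v]).map (rev (DD ∘ fun n => (τ n).unpair.1)) ∈ bourgainTree e ((k : ℝ) + 1)⁻¹ CantorC →
    o (τ (q (k, l ++ [v]))).unpair.2 < o (τ (q (k, l))).unpair.2} := by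
    ext τ; simp only [Set.mem_iInter]; exact Iff.rfl
  rw [this]
  refine isClosed_iInter fun k => isClosed_iInter fun l => isClosed_iInter fun v => ?_
  obtain ⟨N, hN⟩ := rev_dep (Z := CantorC) (l ++ [v])
  refine isClosed_of_finite_dep _ (max N (max (q (k, l ++ [v])) (q (k, l)) + 1)) ?_
  intro τ τ' h hτ hm
  have h1 := hN (DD ∘ fun n => (τ n).unpair.1) (DD ∘ fun n => (τ' n).unpair.1) fun n hn => by
    simp only [Function.comp, h n (hn.trans_le (le_max_left _ _))]
  rw [← h1] at hm
  have h2 := hτ hm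
  rw [h (q (k, l ++ [v])) (by omega), h (q (k, l)) (by omega)] at h2
  exact h2

theorem BB_nonuniversal (e : ℕ → CantorC) (he : IsSchauderBasis e) (hn : ∀ n, ‖e n‖ = 1)
    (q : ℕ × List (ℕ →₀ ℚ) → ℕ) (o : ℕ → Ordinal.{0}) (τ : ℕ → ℕ) (hτ : τ ∈ BB e q o) :
    ¬ Embeds CantorC (Xspan (DD ∘ fun n => (τ n).unpair.1)) := by
  obtain ⟨K, hK0, hK⟩ := basis_const e he hn
  obtain ⟨y, hy⟩ : ∃ y, y = (DD ∘ fun n => (τ n).unpair.1) := ⟨_, rfl⟩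
  rw [← hy]
  rintro ⟨T', c, hc, hT'⟩
  let T : CantorC →L[ℝ] CantorC := (Xspan y).subtypeL.comp T'
  have hT : ∀ x, c * ‖x‖ ≤ ‖T x‖ := hT'
  obtain ⟨η, hη, k, hk⟩ := perturb_mem e K hK0 hK T c hc hT 1 one_pos
  have hch : ∀ i, ∃ v : ℕ →₀ ℚ, ‖rev y v - T (e i)‖ ≤ η * (1 / 2) ^ (i + 1) := by
    intro i
    have hpos : 0 < η * (1 / 2) ^ (i + 1) := by positivity
    obtain ⟨a, ha⟩ := Metric.denseRange_iff.1 (denseRange_Xmap y) (T' (e i)) _ (half_pos hpos)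
    obtain ⟨v, hv⟩ := rv_approx y a _ (half_pos hpos)
    refine ⟨v, ?_⟩
    have h1 : ‖T (e i) - Finsupp.linearCombination ℝ y a‖ < η * (1 / 2) ^ (i + 1) / 2 := by
      rw [dist_eq_norm] at ha; exact ha
    have h2 := norm_sub_le_norm_sub_add_norm_sub (rev y v) (Finsupp.linearCombination ℝ y a) (T (e i))
    rw [norm_sub_rev] at h1
    linarith
  choose v hv using hch
  have hmem : ∀ N, ((List.range N).map v).map (rev y) ∈ bourgainTree e ((k : ℝ) + 1)⁻¹ CantorC := by
    intro N
    refine mem_bt_map e _ (rev y) ((List.range N).map v) N (by simp) (fun i => rev y (v i)) (by simp)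
      (hk e _ N (fun i _ => hv i) fun a => ?_)
    constructor <;> simp
  have hdec : ∀ N, o (τ (q (k, (List.range (N + 1)).map v))).unpair.2 <
      o (τ (q (k, (List.range N).map v))).unpair.2 := by
    intro N
    have h1 := hmem (N + 1)
    rw [List.range_succ, List.map_append, List.map_singleton] at h1 ⊢
    rw [hy] at h1
    exact hτ k _ _ h1
  exact (wellFounded_iff_isEmpty_descending_chain.1 (wellFounded_lt (α := Ordinal.{0}))).false
    ⟨fun N => o (τ (q (k, (List.range N).map v))).unpair.2, hdec⟩

theorem exists_code_BB (e : ℕ → CantorC) (q : ℕ × List (ℕ →₀ ℚ) → ℕ) (hq : Function.Injective q)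
    (o : ℕ → Ordinal.{0}) (ξ : Ordinal.{0}) (ho : ∀ η ≤ ξ, ∃ n, o n = η) (X : SB)
    (hill : ∀ δ ∈ Set.Ioc (0 : ℝ) 1, ¬ TreeIllFounded (bourgainTree e δ X.1))
    (hrk : ∀ δ ∈ Set.Ioc (0 : ℝ) 1, treeRank (bourgainTree e δ X.1) ≤ ξ) :
    ∃ (x : ℕ → CantorC) (τ : ℕ → ℕ), Xspan x = X.1 ∧ τ ∈ BB e q o ∧
        Eqv2 x (DD ∘ fun n => (τ n).unpair.1) := by
  classical
  obtain ⟨x, σ, hx, hxσ⟩ := exists_code X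
  have hδ : ∀ k : ℕ, ((k : ℝ) + 1)⁻¹ / 2 ∈ Set.Ioc (0 : ℝ) 1 := by
    intro k
    refine ⟨by positivity, ?_⟩
    have : ((k : ℝ) + 1)⁻¹ ≤ 1 := inv_le_one_of_one_le₀ (by linarith [(Nat.cast_nonneg k : (0 : ℝ) ≤ k)])
    linarith
  have hr : ∀ k : ℕ, ∃ ρ : List X.1 → Ordinal.{0}, SDec (bourgainTree e (((k : ℝ) + 1)⁻¹ / 2) X.1) ρ ∧
      ∀ l ∈ bourgainTree e (((k : ℝ) + 1)⁻¹ / 2) X.1, ρ l < ξ := by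
    intro k
    obtain ⟨ρ, h1, h2⟩ := exists_rank _ (isTree_bt e (((k : ℝ) + 1)⁻¹ / 2)) (hill _ (hδ k))
    exact ⟨ρ, h1, fun l hl => (h2 l hl).trans_le (hrk _ (hδ k))⟩
  choose ρ hρ hρξ using hr
  have hxm : ∀ n, x n ∈ X.1 := fun n => by rw [← hx]; exact mem_Xspan x n
  let x' : ℕ → X.1 := fun n => ⟨x n, hxm n⟩
  have hx' : ∀ a, ‖Finsupp.linearCombination ℝ x a‖ = ‖Finsupp.linearCombination ℝ x' a‖ :=
    fun a => norm_lc_sub X.1 x' a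
  have hc : ∀ p : ℕ × List (ℕ →₀ ℚ), ∃ n : ℕ,
      ρ p.1 (p.2.map (rev x')) ≤ ξ → o n = ρ p.1 (p.2.map (rev x')) := by
    intro p
    by_cases h : ρ p.1 (p.2.map (rev x')) ≤ ξ
    · obtain ⟨n, hn⟩ := ho _ h; exact ⟨n, fun _ => hn⟩
    · exact ⟨0, fun h' => absurd h' h⟩
  choose g hg using hc
  let r : ℕ → ℕ := Function.extend q g fun _ => 0
  have hrq : ∀ p, r (q p) = g p := fun p => hq.extend_apply g _ p
  have h1 : (fun n => (Nat.pair (σ n) (r n)).unpair.1) = σ := by ext n; simp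
  refine ⟨x, fun n => Nat.pair (σ n) (r n), hx, ?_, by rw [h1]; exact hxσ⟩
  intro k l v hm
  rw [h1] at hm
  simp only [Nat.unpair_pair, hrq]
  have h2 : (l ++ [v]).map (rev x') ∈ bourgainTree e (((k : ℝ) + 1)⁻¹ / 2) X.1 := by
    refine bt_transfer e x' (DD ∘ σ) (fun a => ?_) _ _ hm
    rw [← hx']
    exact hxσ a
  have h3 : l.map (rev x') ∈ bourgainTree e (((k : ℝ) + 1)⁻¹ / 2) X.1 :=
    isTree_bt e _ _ _ ((List.prefix_append l [v]).map _) h2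
  have h4 := hρξ k _ h2
  have h5 := hρξ k _ h3
  rw [hg (k, l ++ [v]) h4.le, hg (k, l) h5.le]
  rw [List.map_append] at h2 ⊢
  exact hρ k _ _ h2

/-- (ii) implies (i) -/
theorem two_one (e : ℕ → CantorC) (he : IsSchauderBasis e) (hn : ∀ n, ‖e n‖ = 1) (C : Set SB)
    (h : (⨆ X : C, bourgainIndex e ↥X.1.1) < omega1) :
    ∃ Y : SB, (∀ X ∈ C, Embeds ↥X.1 ↥Y.1) ∧ ¬ Embeds CantorC ↥Y.1 := by
  obtain ⟨ξ, hξ⟩ : ∃ ξ, ξ = ⨆ X : C, bourgainIndex e ↥X.1.1 := ⟨_, rfl⟩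
  rw [← hξ] at h
  have hle : ∀ X : C, bourgainIndex e X.1.1 ≤ ξ := fun X => by
    rw [hξ]; exact Ordinal.le_iSup (fun X : C => bourgainIndex e X.1.1) X
  have hcount : (Set.Iic ξ).Countable := by
    have h1 : Order.succ ξ < omega1 := succ_lt_omega1 h
    rw [omega1, Cardinal.lt_ord] at h1
    rw [← Order.Iio_succ, Cardinal.countable_iff_lt_aleph_one, Cardinal.mk_Iio_ordinal]
    have h2 := Cardinal.lift_lt.{0, 1}.2 h1
    rwa [Cardinal.lift_aleph, Ordinal.lift_one] at h2
  obtain ⟨o, ho⟩ := hcount.exists_eq_range ⟨ξ, le_refl ξ⟩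
  obtain ⟨q, hq⟩ := exists_item
  obtain ⟨Y, hY, hYC⟩ := amalgam_codes (BB e q o) (isClosed_BB e q o)
    fun τ hτ => BB_nonuniversal e he hn q o τ hτ
  refine ⟨Y, fun X hX => hYC X ?_, hY⟩
  have hXle := hle ⟨X, hX⟩
  have hill : ¬ ∃ δ ∈ Set.Ioc (0:ℝ) 1, TreeIllFounded (bourgainTree e δ X.1) := by
    intro hi
    rw [bourgainIndex, if_pos hi] at hXle
    exact absurd h (not_lt.2 hXle)
  rw [bourgainIndex, if_neg hill] at hXle
  refine exists_code_BB e q hq o ξ (fun η hη => ?_) X (fun δ hδ hi => hill ⟨δ, hδ, hi⟩) fun δ hδ => ?_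
  · have : η ∈ Set.range o := ho ▸ hη
    exact this
  · exact (Ordinal.le_iSup (fun δ : Set.Ioc (0:ℝ) 1 => treeRank (bourgainTree e δ.1 X.1)) ⟨δ, hδ⟩).trans
      hXle

end

/-- **Theorem.** For a class `C ⊆ SB` the following are equivalent:
(i) `C` admits a separable universal space which is not universal for all separable
Banach spaces; (ii) `sup{φ_NU(X) : X ∈ C} < ω₁`; (iii) there is an analytic subset
`A` of `NU` with `C ⊆ A`. -/
theorem small_universal_space_characterization
    (e : ℕ → CantorC) (hbasis : IsSchauderBasis e) (hnorm : ∀ n, ‖e n‖ = 1)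
    (C : Set SB) :
    List.TFAE
      [ ∃ Y : SB, (∀ X ∈ C, Embeds ↥X.1 ↥Y.1) ∧ ¬ Embeds CantorC ↥Y.1,
        (⨆ X : C, bourgainIndex e ↥X.1.1) < omega1,
        ∃ A : Set SB, IsAnalyticIn A ∧ A ⊆ NU ∧ C ⊆ A ] := by
  tfae_have 1 → 3 := one_three C
  tfae_have 3 → 1 := three_one C
  tfae_have 1 → 2 := one_two e hbasis hnorm C
  tfae_have 2 → 1 := two_one e hbasis hnorm C
  tfae_finish
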